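/- There exists an absolute constant ε > 0 such that for every δ > 0 there is N ∈ ℕ with the following property. Let k be an integer with 3 ≤ k ≤ 9, let G be a finite abelian group (written additively) of order n ≥ N, let p be a real with n^{−ε} ≤ p ≤ 1, and let R be a p-random subset of G. Then with probability at least 1 − δ the following holds for every R' ⊆ G with |R' Δ R| ≤ p^{10^{10}}·n/(log n)^{10^{23}}, k dividing |R'|, and 0 ∉ R': (1) if ∑_{x∈R'} x = 0, then R' can be partitioned into k-element sets each of which admits an ordering as a rainbow cycle-candidate; (2) if k = 4 and ∑_{x∈R'} x = (|R'|/4)·α for some α ∈ G ∖ {0}, then R' can be partitioned into 4-element sets each of which admits an ordering as a rainbow path-candidate with sum α. -/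

import Mathlib

open scoped Classical

/-- The probability that a `p`-random subset of the finite type `G` (each element included
independently with probability `p`) equals the finset `A`. -/
noncomputable def setProb (G : Type) [Fintype G] [DecidableEq G] (p : ℝ) (A : Finset G) : ℝ :=
  p ^ A.card * (1 - p) ^ (Fintype.card G - A.card)

/-- The partial sum `c₁ + ⋯ + cⱼ` of the first `j` entries of the tuple `c`. -/
def partialSum {G : Type} [AddCommGroup G] {k : ℕ} (c : Fin k → G) (j : ℕ) : G :=
  ∑ i ∈ Finset.univ.filter (fun i : Fin k => (i : ℕ) < j), c i

/-- `(c₁, …, c_k)` is a path-candidate if its `k+1` partial sums are pairwise distinct. -/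
def IsPathCandidate {G : Type} [AddCommGroup G] {k : ℕ} (c : Fin k → G) : Prop :=
  ∀ j j', j ≤ k → j' ≤ k → j ≠ j' → partialSum c j ≠ partialSum c j'

/-- `(c₁, …, c_k)` is a cycle-candidate if `(c₁, …, c_{k-1})` is a path-candidate and the
total sum is `0`. -/
def IsCycleCandidate {G : Type} [AddCommGroup G] {k : ℕ} (c : Fin k → G) : Prop :=
  (∀ j j', j ≤ k - 1 → j' ≤ k - 1 → j ≠ j' → partialSum c j ≠ partialSum c j') ∧
  partialSum c k = 0

/-! ### Tilings and block systems -/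

/-- `S` is a disjoint union of sets satisfying `OK`. -/
def Tiles {G : Type} [DecidableEq G] (OK : Finset G → Prop) (S : Finset G) : Prop :=
  ∃ P : Finset (Finset G), (∀ A ∈ P, ∀ B ∈ P, A ≠ B → Disjoint A B) ∧
    P.biUnion id = S ∧ ∀ A ∈ P, OK A

namespace Tiles

variable {G : Type} [DecidableEq G] {OK : Finset G → Prop} {S T : Finset G}

theorem empty : Tiles OK (∅ : Finset G) := ⟨∅, by simp, by simp, by simp⟩

theorem of_ok (h : OK S) : Tiles OK S := ⟨{S}, by simp, by simp, by simpa using h⟩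

theorem union (hS : Tiles OK S) (hT : Tiles OK T) (h : Disjoint S T) : Tiles OK (S ∪ T) := by
  obtain ⟨P, hP, rfl, hP'⟩ := hS
  obtain ⟨Q, hQ, rfl, hQ'⟩ := hT
  have key : ∀ A ∈ P, ∀ B ∈ Q, Disjoint A B := fun A hA B hB =>
    h.mono (Finset.subset_biUnion_of_mem id hA) (Finset.subset_biUnion_of_mem id hB)
  refine ⟨P ∪ Q, ?_, by rw [Finset.union_biUnion], ?_⟩
  · intro A hA B hB hAB
    rcases Finset.mem_union.1 hA with hA | hA <;> rcases Finset.mem_union.1 hB with hB | hB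
    · exact hP A hA B hB hAB
    · exact key A hA B hB
    · exact (key B hB A hA).symm
    · exact hQ A hA B hB hAB
  · intro A hA
    rcases Finset.mem_union.1 hA with hA | hA
    exacts [hP' A hA, hQ' A hA]

theorem biUnion {ι : Type*} [DecidableEq ι] {s : Finset ι} {f : ι → Finset G}
    (hf : ∀ i ∈ s, Tiles OK (f i))
    (hd : ∀ i ∈ s, ∀ j ∈ s, i ≠ j → Disjoint (f i) (f j)) : Tiles OK (s.biUnion f) := by
  induction s using Finset.induction_on with
  | empty => simpa using empty
  | insert a s ha ih =>
    rw [Finset.biUnion_insert]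
    refine (hf a (by simp)).union (ih (fun i hi => hf i (by simp [hi]))
      (fun i hi j hj => hd i (by simp [hi]) j (by simp [hj]))) ?_
    rw [Finset.disjoint_biUnion_right]
    intro i hi
    exact hd a (by simp) i (by simp [hi]) (by rintro rfl; exact ha hi)

/-- A tiled set by sets of size `k` contains tiled subsets of every size `k * j` up to its own,
with tiled complements. -/
theorem exists_subset {k : ℕ} (hk : ∀ B, OK B → B.card = k) (hS : Tiles OK S) {j : ℕ}
    (hj : k * j ≤ S.card) (h0 : 0 < k) :
    ∃ S' ⊆ S, Tiles OK S' ∧ Tiles OK (S \ S') ∧ S'.card = k * j := by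
  obtain ⟨P, hP, rfl, hP'⟩ := hS
  have hcard : ∀ Q ⊆ P, (Q.biUnion id).card = k * Q.card := by
    intro Q hQ
    rw [Finset.card_biUnion (t := id) (fun A hA B hB hAB => hP A (hQ hA) B (hQ hB) hAB),
      Finset.sum_congr rfl (fun A hA => hk (id A) (hP' A (hQ hA))), Finset.sum_const, smul_eq_mul,
      mul_comm]
  have hj' : j ≤ P.card := by
    rw [hcard P subset_rfl] at hj
    exact Nat.le_of_mul_le_mul_left hj h0
  obtain ⟨Q, hQ, hQc⟩ := Finset.exists_subset_card_eq hj'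
  have hdiff : P.biUnion id \ Q.biUnion id = (P \ Q).biUnion id := by
    ext x
    simp only [Finset.mem_sdiff, Finset.mem_biUnion, id, not_exists, not_and]
    constructor
    · rintro ⟨⟨A, hA, hx⟩, h⟩
      exact ⟨A, ⟨hA, fun hAQ => h A hAQ hx⟩, hx⟩
    · rintro ⟨A, ⟨hA, hAQ⟩, hx⟩
      refine ⟨⟨A, hA, hx⟩, fun B hB hxB => ?_⟩
      have := hP A hA B (hQ hB) (by rintro rfl; exact hAQ hB)
      exact Finset.disjoint_left.1 this hx hxB
  refine ⟨Q.biUnion id, Finset.biUnion_subset_biUnion_of_subset_left _ hQ,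
    ⟨Q, fun A hA B hB => hP A (hQ hA) B (hQ hB), rfl, fun A hA => hP' A (hQ hA)⟩, ?_, ?_⟩
  · rw [hdiff]
    have hPQ : P \ Q ⊆ P := Finset.sdiff_subset
    exact ⟨P \ Q, fun A hA B hB => hP A (hPQ hA) B (hPQ hB), rfl, fun A hA => hP' A (hPQ hA)⟩
  · rw [hcard Q hQ, hQc]

theorem card_sum [AddCommGroup G] {k : ℕ} {τ : G} (hk : ∀ B, OK B → B.card = k)
    (hτ : ∀ B, OK B → ∑ x ∈ B, x = τ) (hS : Tiles OK S) :
    ∃ m : ℕ, S.card = k * m ∧ ∑ x ∈ S, x = m • τ := by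
  obtain ⟨P, hP, rfl, hP'⟩ := hS
  refine ⟨P.card, ?_, ?_⟩
  · rw [Finset.card_biUnion (t := id) (fun A hA B hB hAB => hP A hA B hB hAB),
      Finset.sum_congr rfl (fun A hA => hk (id A) (hP' A hA)), Finset.sum_const, smul_eq_mul,
      mul_comm]
  · rw [Finset.sum_biUnion (t := id) (fun A hA B hB hAB => hP A hA B hB hAB)]
    simp only [id]
    rw [Finset.sum_congr rfl (fun A hA => hτ A (hP' A hA)), Finset.sum_const]

end Tiles

/-- A family of admissible `k`-sets of sum `τ`, in which almost every triple `x, y, z` can be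
completed by a flexible filler `F` of size `k - 3`. -/
structure BlockSystem (G : Type) [AddCommGroup G] [DecidableEq G] where
  OK : Finset G → Prop
  k : ℕ
  τ : G
  Filler : Finset G → Prop
  bad : G → Finset G → Finset G
  three_le : 3 ≤ k
  le_nine : k ≤ 9
  card_of_ok : ∀ {B}, OK B → B.card = k
  sum_of_ok : ∀ {B}, OK B → ∑ x ∈ B, x = τ
  card_of_filler : ∀ {F}, Filler F → F.card = k - 3
  card_bad : ∀ x F, (bad x F).card ≤ 20
  ok_of_filler : ∀ {F x y z}, Filler F → x ≠ 0 → y ≠ 0 → z ≠ 0 → y ∉ bad x F →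
    x + y + z = τ - ∑ e ∈ F, e → x ≠ y → x ≠ z → y ≠ z → x ∉ F → y ∉ F → z ∉ F →
    OK (insert x (insert y (insert z F)))
  exists_filler : ∀ S V : Finset G, 20 + V.card ≤ S.card → (0 : G) ∉ S →
    ∃ F ⊆ S, Filler F ∧ (3 < k → ∑ e ∈ F, e ∉ V)
  tau_of_k : k = 3 → τ = 0

/-- The sum that the three free elements of a block with filler `F` must have. -/
def BlockSystem.δ {G : Type} [AddCommGroup G] [DecidableEq G] (B : BlockSystem G)
    (F : Finset G) : G := B.τ - ∑ e ∈ F, e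

/-! ### The block systems of cycles and of paths -/

theorem exists_tuple_of_list {G : Type} [AddCommGroup G] [DecidableEq G] {k : ℕ} (L : List G)
    (hL : L.Nodup) (hk : L.length = k) :
    ∃ c : Fin k → G, Function.Injective c ∧ Finset.univ.image c = L.toFinset ∧
      ∀ j, partialSum c j = (L.take j).sum := by
  subst hk
  refine ⟨fun i => L.get i, List.nodup_iff_injective_get.1 hL, ?_, ?_⟩
  · ext x
    simp [List.mem_iff_get]
  · intro j
    have h := List.sum_take_ofFn (fun i => L.get i) j
    rw [List.ofFn_get] at h
    exact h.symm

theorem exists_filler_list {G : Type} [AddCommGroup G] [DecidableEq G] (m : ℕ) :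
    ∀ S V : Finset G, 3 * m + V.card ≤ S.card →
    ∃ l : List G, l.length = m ∧ l.Nodup ∧ l.toFinset ⊆ S ∧
      (∀ i j, i < j → j ≤ m → (l.take i).sum ≠ (l.take j).sum) ∧ (0 < m → l.sum ∉ V) := by
  induction m with
  | zero => exact fun S V _ => ⟨[], by simp; omega⟩
  | succ m ih =>
    intro S V hSV
    obtain ⟨l, hl, hnd, hS, hseg, -⟩ := ih S ∅ (by simp; omega)
    set Ex : Finset G := l.toFinset ∪ (Finset.range (m + 1)).image
      (fun i => (l.take i).sum - l.sum) ∪ V.image (fun v => v - l.sum) with hEx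
    have hcard : Ex.card < S.card := by
      have h1 : l.toFinset.card ≤ m := hl ▸ l.toFinset_card_le
      have h2 : ((Finset.range (m + 1)).image (fun i => (l.take i).sum - l.sum)).card ≤ m + 1 :=
        Finset.card_image_le.trans (by simp)
      have h3 : (V.image (fun v => v - l.sum)).card ≤ V.card := Finset.card_image_le
      have h4 := Finset.card_union_le (l.toFinset ∪ (Finset.range (m + 1)).image
        (fun i => (l.take i).sum - l.sum)) (V.image (fun v => v - l.sum))
      have h5 := Finset.card_union_le l.toFinset ((Finset.range (m + 1)).image
        (fun i => (l.take i).sum - l.sum))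
      rw [hEx]
      omega
    obtain ⟨e, heS, heEx⟩ := Finset.exists_mem_notMem_of_card_lt_card hcard
    simp only [hEx, Finset.mem_union, not_or, Finset.mem_image, not_exists, not_and,
      Finset.mem_range, List.mem_toFinset] at heEx
    obtain ⟨⟨he1, he2⟩, he3⟩ := heEx
    refine ⟨l ++ [e], by simp [hl], ?_, ?_, ?_, ?_⟩
    · rw [List.nodup_append]
      refine ⟨hnd, by simp, ?_⟩
      rintro a ha b hb rfl
      simp at hb
      exact he1 (hb ▸ ha)
    · intro x hx
      simp at hx
      rcases hx with rfl | hx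
      · exact heS
      · exact hS (by simpa using hx)
    · intro i j hij hj
      rw [List.take_append_of_le_length (by omega)]
      rcases Nat.lt_or_ge m j with h | h
      · have : (l ++ [e]).take j = l ++ [e] := List.take_of_length_le (by simp; omega)
        rw [this, List.sum_append]
        intro heq
        apply he2 i (by omega)
        rw [heq]
        simp
      · rw [List.take_append_of_le_length (by omega)]
        exact hseg i j hij h
    · intro _ hV
      refine he3 _ hV ?_
      simp

/-- A list of distinct elements whose contiguous segments have nonzero sums. -/
def IsSegmentFiller {G : Type} [AddCommGroup G] [DecidableEq G] (m : ℕ) (F : Finset G)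
    (l : List G) : Prop :=
  l.length = m ∧ l.Nodup ∧ l.toFinset = F ∧
    ∀ i j, i < j → j ≤ m → (l.take i).sum ≠ (l.take j).sum

theorem nodup_of_filler {G : Type} [DecidableEq G] {x y z : G} {l : List G} (hl : l.Nodup)
    (hxy : x ≠ y) (hxz : x ≠ z) (hyz : y ≠ z) (hx : x ∉ l.toFinset) (hy : y ∉ l.toFinset)
    (hz : z ∉ l.toFinset) : (x :: y :: (l ++ [z])).Nodup := by
  simp only [List.mem_toFinset] at hx hy hz
  simp only [List.nodup_cons, List.mem_cons, List.mem_append, List.not_mem_nil, or_false,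
    List.nodup_append, not_or]
  refine ⟨⟨hxy, hx, hxz⟩, ⟨hy, hyz⟩, hl, by simp, ?_⟩
  rintro a ha b rfl rfl
  exact hz ha

theorem cycle_of_filler {G : Type} [AddCommGroup G] [DecidableEq G] {m : ℕ} {F : Finset G}
    {l : List G} (hl : IsSegmentFiller m F l) {x y z : G} (hx0 : x ≠ 0)
    (hbad : ∀ i ≤ m, y ≠ - (l.take i).sum ∧ y ≠ -x - (l.take i).sum)
    (hsum : x + y + z = 0 - ∑ e ∈ F, e) (hxy : x ≠ y) (hxz : x ≠ z) (hyz : y ≠ z)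
    (hx : x ∉ F) (hy : y ∉ F) (hz : z ∉ F) :
    ∃ c : Fin (m + 3) → G, Function.Injective c ∧
      Finset.univ.image c = insert x (insert y (insert z F)) ∧ IsCycleCandidate c := by
  obtain ⟨hlen, hnd, rfl, hseg⟩ := hl
  obtain ⟨c, hc, him, hps⟩ := exists_tuple_of_list (k := m + 3) (x :: y :: (l ++ [z]))
    (nodup_of_filler hnd hxy hxz hyz hx hy hz) (by simp [hlen])
  refine ⟨c, hc, ?_, ?_, ?_⟩
  · rw [him]
    ext a
    simp only [List.mem_toFinset, List.mem_cons, List.mem_append, List.not_mem_nil, or_false,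
      Finset.mem_insert]
    tauto
  · have key : ∀ j j', j < j' → j' ≤ m + 2 → partialSum c j ≠ partialSum c j' := by
      intro j j' hjj hj'
      rw [hps, hps]
      match j, j', hjj, hj' with
      | 0, 1, _, _ => simpa using hx0.symm
      | 0, j' + 2, _, h =>
        rw [List.take_succ_cons, List.take_succ_cons, List.take_append_of_le_length (by omega)]
        intro h'
        apply (hbad j' (by omega)).2
        simp only [List.take_zero, List.sum_nil, List.sum_cons] at h'
        have : y + (x + (List.take j' l).sum) = 0 := by rw [h']; abel
        rw [eq_neg_of_add_eq_zero_left this]; abel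
      | 1, j' + 2, _, h =>
        rw [List.take_succ_cons, List.take_succ_cons, List.take_succ_cons,
          List.take_append_of_le_length (by omega)]
        intro h'
        apply (hbad j' (by omega)).1
        simp only [List.take_zero, List.sum_nil, List.sum_cons, add_zero] at h'
        exact eq_neg_of_add_eq_zero_left (left_eq_add.1 h')
      | j + 2, j' + 2, hjj, h =>
        rw [List.take_succ_cons, List.take_succ_cons, List.take_succ_cons, List.take_succ_cons,
          List.take_append_of_le_length (by omega), List.take_append_of_le_length (by omega)]
        intro h'
        apply hseg j j' (by omega) (by omega)
        simpa using h'
    intro j j' hj hj' hne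
    rcases Nat.lt_or_gt_of_ne hne with h | h
    · exact key j j' h (by omega)
    · exact (key j' j h (by omega)).symm
  · rw [hps, List.take_of_length_le (by simp [hlen])]
    have h1 : ∑ e ∈ l.toFinset, e = l.sum := by
      rw [List.sum_toFinset _ hnd]; simp
    rw [h1] at hsum
    simp only [List.sum_cons, List.sum_append, List.sum_nil]
    rw [show x + (y + (l.sum + (z + 0))) = (x + y + z) + l.sum by abel, hsum]
    abel

theorem sum_eq_partialSum {G : Type} [AddCommGroup G] {k : ℕ} (c : Fin k → G) :
    ∑ i, c i = partialSum c k := by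
  unfold partialSum
  exact Finset.sum_congr (by ext i; simp) (fun _ _ => rfl)

/-- The block system of rainbow cycle-candidates of length `k`. -/
noncomputable def cycleSystem (G : Type) [AddCommGroup G] [DecidableEq G] (k : ℕ) (hk : 3 ≤ k)
    (hk' : k ≤ 9) : BlockSystem G where
  OK A := ∃ c : Fin k → G, Function.Injective c ∧ Finset.univ.image c = A ∧ IsCycleCandidate c
  k := k
  τ := 0
  Filler F := ∃ l, IsSegmentFiller (k - 3) F l
  bad x F := if h : ∃ l, IsSegmentFiller (k - 3) F l then
    (Finset.range (k - 2)).image (fun i => - (h.choose.take i).sum) ∪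
      (Finset.range (k - 2)).image (fun i => -x - (h.choose.take i).sum) else ∅
  three_le := hk
  le_nine := hk'
  card_of_ok := by
    rintro _ ⟨c, hc, rfl, -⟩
    simp [Finset.card_image_of_injective _ hc]
  sum_of_ok := by
    rintro _ ⟨c, hc, rfl, -, h⟩
    rw [Finset.sum_image (fun a _ b _ h => hc h), sum_eq_partialSum, h]
  card_of_filler := by
    rintro F ⟨l, h1, h2, rfl, -⟩
    rw [List.toFinset_card_of_nodup h2, h1]
  card_bad := by
    intro x F
    split_ifs with h
    · refine (Finset.card_union_le _ _).trans ((Nat.add_le_add Finset.card_image_le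
        Finset.card_image_le).trans ?_)
      simp only [Finset.card_range]
      omega
    · simp
  ok_of_filler := by
    intro F x y z hF hx hy hz hbad hsum hxy hxz hyz hxF hyF hzF
    rw [dif_pos hF] at hbad
    simp only [Finset.mem_union, Finset.mem_image, Finset.mem_range, not_or, not_exists,
      not_and] at hbad
    have := cycle_of_filler (m := k - 3) hF.choose_spec hx (y := y) (z := z)
      (fun i hi => ⟨fun h => hbad.1 i (by omega) h.symm, fun h => hbad.2 i (by omega) h.symm⟩)
      hsum hxy hxz hyz hxF hyF hzF
    rwa [Nat.sub_add_cancel hk] at this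
  exists_filler := by
    intro S V h _
    obtain ⟨l, h1, h2, h3, h4, h5⟩ := exists_filler_list (k - 3) S V (by omega)
    refine ⟨l.toFinset, h3, ⟨l, h1, h2, rfl, h4⟩, fun hk => ?_⟩
    rw [List.sum_toFinset _ h2]
    simpa using h5 (by omega)
  tau_of_k := fun _ => rfl

theorem path_of_filler {G : Type} [AddCommGroup G] [DecidableEq G] {e α x y z : G} (he : e ≠ 0)
    (heα : e ≠ α) (hα : α ≠ 0) (hx0 : x ≠ 0) (hy0 : y ≠ 0) (hz0 : z ≠ 0) (h1 : y ≠ -x)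
    (h2 : y ≠ α - e) (h3 : y ≠ α) (h4 : y ≠ α - x) (hsum : x + y + z = α - e) (hxy : x ≠ y)
    (hxz : x ≠ z) (hyz : y ≠ z) (hx : x ≠ e) (hy : y ≠ e) (hz : z ≠ e) :
    ∃ c : Fin 4 → G, Function.Injective c ∧
      Finset.univ.image c = {x, y, z, e} ∧ IsPathCandidate c ∧ ∑ i, c i = α := by
  obtain ⟨c, hc, him, hps⟩ := exists_tuple_of_list (k := 4) [y, x, z, e]
    (by simp; tauto) rfl
  have hα' : α = y + x + z + e := by rw [eq_sub_iff_add_eq] at hsum; rw [← hsum]; abel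
  refine ⟨c, hc, ?_, ?_, ?_⟩
  · rw [him]
    ext a
    simp only [List.mem_toFinset, List.mem_cons, List.not_mem_nil, or_false,
      Finset.mem_insert, Finset.mem_singleton]
    tauto
  · have key : ∀ j j', j < j' → j' ≤ 4 → partialSum c j ≠ partialSum c j' := by
      intro j j' hjj hj'
      rw [hps, hps]
      subst hα'
      have q0 : x + y ≠ 0 := fun h => h1 (eq_neg_of_add_eq_zero_right h)
      have q1 : y + x + z ≠ 0 := fun h => heα (by rw [h, zero_add])
      have q2 : x + z ≠ 0 := fun h => h2 (by
        rw [show y + x + z + e - e = y + (x + z) by abel, h, add_zero])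
      have q3 : x + z + e ≠ 0 := fun h => h3 (by
        rw [show y + x + z + e = y + (x + z + e) by abel, h, add_zero])
      have q4 : z + e ≠ 0 := fun h => h4 (by
        rw [show y + x + z + e - x = y + (z + e) by abel, h, add_zero])
      have q5 : y + x ≠ 0 := by rwa [add_comm]
      intro h
      replace h := sub_eq_zero.2 h.symm
      interval_cases j' <;> interval_cases j <;>
        simp only [List.take_succ_cons, List.take_zero, List.sum_cons, List.sum_nil] at h <;>
        first
        | (refine hy0 ?_; rw [← h]; abel1)
        | (refine hx0 ?_; rw [← h]; abel1)
        | (refine hz0 ?_; rw [← h]; abel1)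
        | (refine he ?_; rw [← h]; abel1)
        | (refine hα ?_; rw [← h]; abel1)
        | (refine q1 ?_; rw [← h]; abel1)
        | (refine q2 ?_; rw [← h]; abel1)
        | (refine q3 ?_; rw [← h]; abel1)
        | (refine q4 ?_; rw [← h]; abel1)
        | (refine q5 ?_; rw [← h]; abel1)
    intro j j' hj hj' hne
    rcases Nat.lt_or_gt_of_ne hne with h | h
    · exact key j j' h (by omega)
    · exact (key j' j h (by omega)).symm
  · rw [sum_eq_partialSum, hps, hα']
    simp; abel

/-- The block system of rainbow path-candidates of length `4` and sum `α`. -/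
noncomputable def pathSystem (G : Type) [AddCommGroup G] [DecidableEq G] (α : G) (hα : α ≠ 0) :
    BlockSystem G where
  OK A := ∃ c : Fin 4 → G, Function.Injective c ∧ Finset.univ.image c = A ∧
    IsPathCandidate c ∧ ∑ i, c i = α
  k := 4
  τ := α
  Filler F := ∃ e, e ≠ 0 ∧ e ≠ α ∧ F = {e}
  bad x F := {-x, α - ∑ e ∈ F, e, α, α - x}
  three_le := by norm_num
  le_nine := by norm_num
  card_of_ok := by
    rintro _ ⟨c, hc, rfl, -⟩
    simp [Finset.card_image_of_injective _ hc]
  sum_of_ok := by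
    rintro _ ⟨c, hc, rfl, -, h⟩
    rw [Finset.sum_image (fun a _ b _ h => hc h), h]
  card_of_filler := by
    rintro F ⟨e, -, -, rfl⟩
    simp
  card_bad := fun x F => Finset.card_le_four.trans (by norm_num)
  ok_of_filler := by
    rintro _ x y z ⟨e, he, heα, rfl⟩ hx hy hz hbad hsum hxy hxz hyz hxF hyF hzF
    simp only [Finset.sum_singleton, Finset.mem_insert, Finset.mem_singleton, not_or]
      at hbad hsum hxF hyF hzF
    exact path_of_filler he heα hα hx hy hz hbad.1 hbad.2.1 hbad.2.2.1 hbad.2.2.2 hsum hxy hxz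
      hyz hxF hyF hzF
  exists_filler := by
    intro S V h h0
    have hlt : (insert α V).card < S.card := (Finset.card_insert_le _ _).trans_lt (by omega)
    obtain ⟨e, heS, he⟩ := Finset.exists_mem_notMem_of_card_lt_card hlt
    simp only [Finset.mem_insert, not_or] at he
    exact ⟨{e}, by simpa using heS, ⟨e, fun h => h0 (h ▸ heS), he.1, rfl⟩, fun _ => by
      simpa using he.2⟩
  tau_of_k := fun h => by norm_num at h

/-! ### A compaction network -/

namespace Compaction

/-- The number of elements of `F` below `p`. -/
def rank (F : Finset ℕ) (p : ℕ) : ℕ := (F.filter (· < p)).card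

/-- The position after `b` stages of the element starting at `p`. -/
def pos (F : Finset ℕ) (b p : ℕ) : ℕ := p - (p - rank F p) % 2 ^ b

theorem rank_le (F : Finset ℕ) (p : ℕ) : rank F p ≤ p := by
  have h : F.filter (· < p) ⊆ Finset.range p := by
    intro x hx
    simp at hx ⊢
    exact hx.2
  simpa [rank] using Finset.card_le_card h

theorem rank_lt_of_lt {F : Finset ℕ} {p q : ℕ} (hp : p ∈ F) (h : p < q) :
    rank F p < rank F q := by
  apply Finset.card_lt_card
  rw [Finset.ssubset_iff_of_subset]
  · exact ⟨p, by simp [hp, h], by simp⟩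
  · intro x hx
    simp at hx ⊢
    exact ⟨hx.1, by omega⟩

theorem rank_sub_le (F : Finset ℕ) (p q : ℕ) :
    rank F q ≤ rank F p + (q - p) := by
  have hsub : F.filter (· < q) ⊆ F.filter (· < p) ∪ Finset.Ico p q := by
    intro x hx
    simp at hx ⊢
    by_cases hxp : x < p
    · exact Or.inl ⟨hx.1, hxp⟩
    · exact Or.inr ⟨by omega, hx.2⟩
  have := (Finset.card_le_card hsub).trans (Finset.card_union_le _ _)
  simpa [rank] using this

theorem pos_injOn (F : Finset ℕ) (b : ℕ) : Set.InjOn (pos F b) F := by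
  have key : ∀ p ∈ F, ∀ q ∈ F, p < q → pos F b p ≠ pos F b q := by
    intro p hp q hq hpq heq
    unfold pos at heq
    have h1 := rank_lt_of_lt hp hpq
    have h2 := rank_sub_le F p q
    have h3 := rank_le F p
    have h4 := rank_le F q
    have hm1 := Nat.mod_le (p - rank F p) (2 ^ b)
    have hm2 := Nat.mod_le (q - rank F q) (2 ^ b)
    have hl1 := Nat.mod_lt (p - rank F p) (Nat.two_pow_pos b)
    have hl2 := Nat.mod_lt (q - rank F q) (Nat.two_pow_pos b)
    have hd1 := Nat.div_add_mod (p - rank F p) (2 ^ b)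
    have hd2 := Nat.div_add_mod (q - rank F q) (2 ^ b)
    set B := 2 ^ b
    have hle : (p - rank F p) / B ≤ (q - rank F q) / B := Nat.div_le_div_right (by omega)
    have : B * ((p - rank F p) / B) ≤ B * ((q - rank F q) / B) := Nat.mul_le_mul_left _ hle
    omega
  intro p hp q hq heq
  rcases lt_trichotomy p q with h | h | h
  · exact absurd heq (key p hp q hq h)
  · exact h
  · exact absurd heq.symm (key q hq p hp h)

theorem pos_zero (F : Finset ℕ) (p : ℕ) : pos F 0 p = p := by simp [pos, Nat.mod_one]

theorem pos_le (F : Finset ℕ) (b p : ℕ) : pos F b p ≤ p := Nat.sub_le _ _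

theorem pos_top {F : Finset ℕ} {m p : ℕ} (h : p < 2 ^ m) : pos F m p = rank F p := by
  have := rank_le F p
  rw [pos, Nat.mod_eq_of_lt (by omega)]
  omega

theorem pos_succ (F : Finset ℕ) (b p : ℕ) :
    pos F b p = pos F (b + 1) p ∨ pos F b p = pos F (b + 1) p + 2 ^ b := by
  have h := Nat.mod_pow_succ (b := 2) (x := p - rank F p) (k := b)
  have h1 := Nat.mod_le (p - rank F p) (2 ^ (b + 1))
  unfold pos
  rcases Nat.mod_two_eq_zero_or_one ((p - rank F p) / 2 ^ b) with h2 | h2 <;> rw [h2] at h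
  · left; rw [h]; simp
  · right; rw [mul_one] at h; omega

/-- Gadgets `(b, j)` with three options `(b + 1, j)`, `(b, j)`, `(b, j + 2 ^ b)` can absorb any
`u` of the `M` nodes at level `0` along with all the nodes at later levels, except for `u` nodes
at the last one. -/
theorem exists_assignment {M u m : ℕ} (hm : 1 ≤ m) (hM : M ≤ 2 ^ m) {F : Finset ℕ}
    (hF : F ⊆ Finset.range M) (hu : F.card = u) :
    ∃ f : ℕ × ℕ → ℕ × ℕ,
      (∀ w ∈ Finset.range m ×ˢ Finset.range M,
        f w = (w.1 + 1, w.2) ∨ f w = (w.1, w.2) ∨ f w = (w.1, w.2 + 2 ^ w.1)) ∧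
      Set.InjOn f (Finset.range m ×ˢ Finset.range M : Finset (ℕ × ℕ)) ∧
      (Finset.range m ×ˢ Finset.range M).image f =
        ({0} ×ˢ F) ∪ ((Finset.Ioc 0 m ×ˢ Finset.range M) \ ({m} ×ˢ Finset.range u)) := by
  have hFM : ∀ p ∈ F, p < M := fun p hp => Finset.mem_range.1 (hF hp)
  have hrank : F.image (rank F) = Finset.range u := by
    apply Finset.eq_of_subset_of_card_le
    · intro x hx
      obtain ⟨p, hp, rfl⟩ := Finset.mem_image.1 hx
      rw [Finset.mem_range, ← hu]
      apply Finset.card_lt_card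
      rw [Finset.ssubset_iff_of_subset (Finset.filter_subset _ _)]
      exact ⟨p, hp, by simp⟩
    · rw [Finset.card_image_of_injOn, hu, Finset.card_range]
      intro p hp q hq h
      have := pos_injOn F m hp hq
      rw [pos_top ((hFM p hp).trans_le hM), pos_top ((hFM q hq).trans_le hM)] at this
      exact this h
  let f : ℕ × ℕ → ℕ × ℕ := fun w =>
    if h : ∃ p ∈ F, pos F (w.1 + 1) p = w.2 then (w.1, pos F w.1 h.choose) else (w.1 + 1, w.2)
  have hf1 : ∀ b p, p ∈ F → f (b, pos F (b + 1) p) = (b, pos F b p) := by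
    intro b p hp
    have h : ∃ q ∈ F, pos F (b + 1) q = pos F (b + 1) p := ⟨p, hp, rfl⟩
    have h2 := h.choose_spec
    have h3 : h.choose = p := pos_injOn F (b + 1) h2.1 hp h2.2
    simp only [f, dif_pos h, h3]
  have hf2 : ∀ b j, (¬ ∃ p ∈ F, pos F (b + 1) p = j) → f (b, j) = (b + 1, j) := by
    intro b j h
    simp only [f, dif_neg h]
  refine ⟨f, ?_, ?_, ?_⟩
  · rintro ⟨b, j⟩ -
    by_cases h : ∃ p ∈ F, pos F (b + 1) p = j
    · obtain ⟨p, hp, rfl⟩ := h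
      rw [hf1 b p hp]
      right
      simpa using pos_succ F b p
    · exact Or.inl (hf2 b j h)
  · rintro ⟨b, j⟩ - ⟨b', j'⟩ - heq
    by_cases h : ∃ p ∈ F, pos F (b + 1) p = j <;> by_cases h' : ∃ p ∈ F, pos F (b' + 1) p = j'
    · obtain ⟨p, hp, rfl⟩ := h
      obtain ⟨p', hp', rfl⟩ := h'
      rw [hf1 b p hp, hf1 b' p' hp', Prod.mk.injEq] at heq
      obtain ⟨rfl, heq⟩ := heq
      rw [pos_injOn F b hp hp' heq]
    · obtain ⟨p, hp, rfl⟩ := h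
      rw [hf1 b p hp, hf2 b' j' h', Prod.mk.injEq] at heq
      obtain ⟨rfl, heq⟩ := heq
      exact absurd ⟨p, hp, heq⟩ h'
    · obtain ⟨p', hp', rfl⟩ := h'
      rw [hf1 b' p' hp', hf2 b j h, Prod.mk.injEq] at heq
      obtain ⟨rfl, heq⟩ := heq
      exact absurd ⟨p', hp', heq.symm⟩ h
    · rw [hf2 b j h, hf2 b' j' h', Prod.mk.injEq] at heq
      simpa using heq
  · ext ⟨c, i⟩
    simp only [Finset.mem_image, Finset.mem_product, Finset.mem_union, Finset.mem_sdiff,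
      Finset.mem_singleton, Finset.mem_range, Finset.mem_Ioc, Prod.exists]
    constructor
    · rintro ⟨b, j, ⟨hb, hj⟩, heq⟩
      by_cases h : ∃ p ∈ F, pos F (b + 1) p = j
      · obtain ⟨p, hp, rfl⟩ := h
        rw [hf1 b p hp, Prod.mk.injEq] at heq
        obtain ⟨rfl, rfl⟩ := heq
        rcases Nat.eq_zero_or_pos b with rfl | hb0
        · exact Or.inl ⟨rfl, by rwa [pos_zero]⟩
        · exact Or.inr ⟨⟨⟨hb0, hb.le⟩, (pos_le F b p).trans_lt (hFM p hp)⟩, by omega⟩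
      · rw [hf2 b j h, Prod.mk.injEq] at heq
        obtain ⟨rfl, rfl⟩ := heq
        refine Or.inr ⟨⟨⟨by omega, by omega⟩, hj⟩, ?_⟩
        rintro ⟨rfl, hju⟩
        apply h
        rw [← Finset.mem_range, ← hrank] at hju
        obtain ⟨p, hp, rfl⟩ := Finset.mem_image.1 hju
        exact ⟨p, hp, pos_top ((hFM p hp).trans_le hM)⟩
    · rintro (⟨rfl, hi⟩ | ⟨⟨⟨hc, hcm⟩, hi⟩, hne⟩)
      · exact ⟨0, pos F 1 i, ⟨hm, (pos_le F 1 i).trans_lt (hFM i hi)⟩, by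
          rw [hf1 0 i hi, pos_zero]⟩
      · by_cases h : ∃ p ∈ F, pos F c p = i
        · obtain ⟨p, hp, rfl⟩ := h
          have hcm' : c < m := by
            by_contra hcm'
            obtain rfl : c = m := by omega
            apply hne
            rw [pos_top ((hFM p hp).trans_le hM), ← Finset.mem_range, ← hrank]
            exact ⟨rfl, Finset.mem_image_of_mem _ hp⟩
          exact ⟨c, pos F (c + 1) p, ⟨hcm', (pos_le F _ p).trans_lt (hFM p hp)⟩, hf1 c p hp⟩
        · obtain ⟨b, rfl⟩ : ∃ b, c = b + 1 := ⟨c - 1, by omega⟩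
          exact ⟨b, i, ⟨by omega, hi⟩, hf2 b i h⟩

end Compaction

/-! ### Supply of translated configurations -/

/-- Doubling is injective. -/
def DoublingInjective (G : Type) [AddCommGroup G] : Prop :=
  Function.Injective (fun x : G => x + x)

/-- Even after deleting any `κ` elements, `C` contains translates and reflected translates of
any two quadruples, subject to nondegeneracy conditions. -/
def Supply {G : Type} [AddCommGroup G] [DecidableEq G] (C : Finset G) (κ : ℕ) : Prop :=
  ∀ a b e : Fin 4 → G, (∀ i j, a i ≠ b j ∨ DoublingInjective G) →
    (∀ i, e i ≠ 0 ∨ DoublingInjective G) → ∀ Bad : Finset G, Bad.card ≤ κ →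
    ∃ t, (∀ i j, t + a i ≠ b j - t) ∧ (∀ i, t + t ≠ e i) ∧ (∀ i, t + a i ∈ C \ Bad) ∧
      ∀ j, b j - t ∈ C \ Bad

namespace Supply

variable {G : Type} [AddCommGroup G] [DecidableEq G] {C : Finset G} {κ : ℕ}

theorem exists_pair (h : Supply C κ) {s e₀ e₁ : G} (hs : s ≠ 0)
    (h₀ : e₀ ≠ 0 ∨ DoublingInjective G) (h₁ : e₁ ≠ 0 ∨ DoublingInjective G) {Bad : Finset G}
    (hBad : Bad.card ≤ κ) :
    ∃ x, x ∈ C \ Bad ∧ s - x ∈ C \ Bad ∧ x ≠ s - x ∧ x + x ≠ e₀ ∧ x + x ≠ e₁ := by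
  obtain ⟨t, h1, h2, h3, h4⟩ := h (fun _ => 0) (fun _ => s) ![e₀, e₁, e₁, e₁]
    (fun _ _ => Or.inl hs.symm) (by intro i; fin_cases i <;> assumption) Bad hBad
  exact ⟨t, by simpa using h3 0, h4 0, by simpa using h1 0 0, h2 0, h2 1⟩

theorem lt_card (h : Supply C κ) {s : G} (hs : s ≠ 0) : κ < C.card := by
  by_contra hlt
  obtain ⟨x, hx, -⟩ := h.exists_pair hs (Or.inl hs) (Or.inl hs) (Bad := C) (by omega)
  simp at hx

theorem exists_two (h : Supply C κ) {s : G} (hs : s ≠ 0) (d : G) {Bad : Finset G}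
    (hBad : Bad.card ≤ κ) (hκ : 2 ≤ κ) : ∃ u, u ∈ C \ Bad ∧ u + d ∈ C \ Bad := by
  have hlt : ({0, d} : Finset G).card < C.card :=
    Finset.card_le_two.trans_lt (hκ.trans_lt (h.lt_card hs))
  obtain ⟨w, -, hw⟩ := Finset.exists_mem_notMem_of_card_lt_card hlt
  simp only [Finset.mem_insert, Finset.mem_singleton, not_or] at hw
  obtain ⟨t, -, -, h3, -⟩ := h ![0, d, 0, 0] (fun _ => w) (fun _ => s)
    (by intro i j; left; fin_cases i <;> simp [Ne.symm hw.1, Ne.symm hw.2])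
    (fun _ => Or.inl hs) Bad hBad
  exact ⟨t, by simpa using h3 0, h3 1⟩

end Supply

namespace BlockSystem

variable {G : Type} [AddCommGroup G] [DecidableEq G] (B : BlockSystem G)

theorem card_filler_le {F : Finset G} (hF : B.Filler F) : F.card ≤ 6 := by
  have := B.card_of_filler hF
  have := B.le_nine
  omega

theorem δ_eq_zero (hk : B.k = 3) {F : Finset G} (hF : B.Filler F) : B.δ F = 0 := by
  have h : F = ∅ := by
    rw [← Finset.card_eq_zero, B.card_of_filler hF, hk]
  rw [δ, B.tau_of_k hk, h]
  simp

theorem exists_filler_sdiff {C : Finset G} {κ : ℕ} (hC : κ < C.card) (Bad V : Finset G)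
    (h0 : (0 : G) ∈ Bad) (h : Bad.card + V.card + 19 ≤ κ) :
    ∃ F, F ⊆ C \ Bad ∧ B.Filler F ∧ (3 < B.k → B.δ F ∉ V) := by
  obtain ⟨F, hF, hF', hV⟩ := B.exists_filler (C \ Bad) (V.image (fun v => B.τ - v)) (by
    have h1 := Finset.le_card_sdiff Bad C
    have h2 : (V.image (fun v => B.τ - v)).card ≤ V.card := Finset.card_image_le
    omega) (by simp [h0])
  refine ⟨F, hF, hF', fun hk hmem => hV hk ?_⟩
  rw [Finset.mem_image]
  exact ⟨_, hmem, by simp [δ]⟩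

theorem ok_block {F : Finset G} {x y z : G} (hF : B.Filler F) (hx : x ≠ 0) (hy : y ≠ 0)
    (hz : z ≠ 0) (hbad : y ∉ B.bad x F) (hsum : x + y + z = B.δ F) (hxy : x ≠ y) (hxz : x ≠ z)
    (hyz : y ≠ z) (hxF : x ∉ F) (hyF : y ∉ F) (hzF : z ∉ F) :
    B.OK (insert x (insert y (insert z F))) :=
  B.ok_of_filler hF hx hy hz hbad hsum hxy hxz hyz hxF hyF hzF

theorem tiles_family {ι : Type} [Fintype ι] [DecidableEq ι] {x y z : ι → G} {F : ι → Finset G}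
    (hF : ∀ i, B.Filler (F i)) (hx0 : ∀ i, x i ≠ 0) (hy0 : ∀ i, y i ≠ 0) (hz0 : ∀ i, z i ≠ 0)
    (hbad : ∀ i, y i ∉ B.bad (x i) (F i)) (hsum : ∀ i, x i + y i + z i = B.δ (F i))
    (hx : Function.Injective x) (hy : Function.Injective y) (hz : Function.Injective z)
    (hxy : ∀ i j, x i ≠ y j) (hxz : ∀ i j, x i ≠ z j) (hyz : ∀ i j, y i ≠ z j)
    (hxF : ∀ i j, x i ∉ F j) (hyF : ∀ i j, y i ∉ F j) (hzF : ∀ i j, z i ∉ F j)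
    (hFF : ∀ i j, i ≠ j → Disjoint (F i) (F j)) :
    Tiles B.OK (Finset.univ.image x ∪ Finset.univ.image y ∪ Finset.univ.image z ∪
      Finset.univ.biUnion F) := by
  have h : Tiles B.OK (Finset.univ.biUnion fun i => insert (x i) (insert (y i)
      (insert (z i) (F i)))) := by
    apply Tiles.biUnion
    · exact fun i _ => Tiles.of_ok (B.ok_block (hF i) (hx0 i) (hy0 i) (hz0 i) (hbad i) (hsum i)
        (hxy i i) (hxz i i) (hyz i i) (hxF i i) (hyF i i) (hzF i i))
    · intro i _ j _ hij
      simp only [Finset.disjoint_insert_left, Finset.disjoint_insert_right, Finset.mem_insert,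
        not_or]
      exact ⟨⟨hx.ne hij.symm, hxy j i, hxz j i, hxF j i⟩,
        ⟨(hxy i j).symm, hy.ne hij.symm, hyz j i, hyF j i⟩,
        ⟨(hxz i j).symm, (hyz i j).symm, hz.ne hij.symm, hzF j i⟩,
        hxF i j, hyF i j, hzF i j, hFF i j hij⟩
  convert h using 1
  ext g
  simp only [Finset.mem_union, Finset.mem_image, Finset.mem_univ, true_and, Finset.mem_biUnion,
    Finset.mem_insert, exists_or, eq_comm, or_assoc]

end BlockSystem

/-! ### The three-way absorbing gadget -/

namespace BlockSystem

variable {G : Type} [AddCommGroup G] [DecidableEq G] (B : BlockSystem G)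

/-- A system of four disjoint fillers inside `C \ Bad` with generic sums relative to the pairs
`{a₂, s - a₂}` and `{a₃, s - a₃}`. -/
def FourFillers (C Bad : Finset G) (s a₂ a₃ : G) (F : Fin 4 → Finset G) : Prop :=
  (∀ i, F i ⊆ C \ Bad) ∧ (∀ i, B.Filler (F i)) ∧ (∀ i j, i ≠ j → Disjoint (F i) (F j)) ∧
    B.δ (F 0) ≠ -a₂ ∧ B.δ (F 0) ≠ -a₃ ∧ B.δ (F 1) ≠ s - a₂ ∧ B.δ (F 1) ≠ s + a₃ - a₂ - a₂ ∧
    B.δ (F 3) ≠ a₃ - a₂ + B.δ (F 2)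

theorem exists_four_disjoint {C : Finset G} {κ : ℕ} (hC : κ < C.card) {Bad : Finset G}
    (h0 : (0 : G) ∈ Bad) (h : Bad.card + 50 ≤ κ) (s a₂ a₃ : G) :
    ∃ F : Fin 4 → Finset G, (∀ i, F i ⊆ C \ Bad) ∧ (∀ i, B.Filler (F i)) ∧
      (∀ i j, i ≠ j → Disjoint (F i) (F j)) ∧ (3 < B.k → B.FourFillers C Bad s a₂ a₃ F) := by
  obtain ⟨F0, hF0, hf0, hδ0⟩ := B.exists_filler_sdiff hC Bad {-a₂, -a₃} h0
    (by have := Finset.card_le_two (a := -a₂) (b := -a₃); omega)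
  have c0 := B.card_filler_le hf0
  have u1 := Finset.card_union_le Bad F0
  obtain ⟨F1, hF1, hf1, hδ1⟩ := B.exists_filler_sdiff hC (Bad ∪ F0)
    {s - a₂, s + a₃ - a₂ - a₂} (by simp [h0])
    (by have := Finset.card_le_two (a := s - a₂) (b := s + a₃ - a₂ - a₂); omega)
  have c1 := B.card_filler_le hf1
  have u2 := Finset.card_union_le (Bad ∪ F0) F1
  obtain ⟨F2, hF2, hf2, -⟩ := B.exists_filler_sdiff hC (Bad ∪ F0 ∪ F1) ∅ (by simp [h0])
    (by rw [Finset.card_empty]; omega)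
  have c2 := B.card_filler_le hf2
  have u3 := Finset.card_union_le (Bad ∪ F0 ∪ F1) F2
  obtain ⟨F3, hF3, hf3, hδ3⟩ := B.exists_filler_sdiff hC (Bad ∪ F0 ∪ F1 ∪ F2)
    {a₃ - a₂ + B.δ F2} (by simp [h0]) (by rw [Finset.card_singleton]; omega)
  have hd : ∀ {A E E' : Finset G}, E ⊆ C \ A → E' ⊆ A → Disjoint E' E := by
    intro A E E' hE hE'
    exact (Finset.sdiff_disjoint.mono_left hE).symm.mono_left hE'
  have d01 : Disjoint F0 F1 := hd hF1 (by intro x; simp; tauto)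
  have d02 : Disjoint F0 F2 := hd hF2 (by intro x; simp; tauto)
  have d12 : Disjoint F1 F2 := hd hF2 (by intro x; simp; tauto)
  have d03 : Disjoint F0 F3 := hd hF3 (by intro x; simp; tauto)
  have d13 : Disjoint F1 F3 := hd hF3 (by intro x; simp; tauto)
  have d23 : Disjoint F2 F3 := hd hF3 (by intro x; simp; tauto)
  have hsub : ∀ i, (![F0, F1, F2, F3] : Fin 4 → Finset G) i ⊆ C \ Bad := by
    intro i
    fin_cases i
    · exact hF0
    · exact hF1.trans (Finset.sdiff_subset_sdiff subset_rfl (by intro x; simp; tauto))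
    · exact hF2.trans (Finset.sdiff_subset_sdiff subset_rfl (by intro x; simp; tauto))
    · exact hF3.trans (Finset.sdiff_subset_sdiff subset_rfl (by intro x; simp; tauto))
  have hfil : ∀ i, B.Filler ((![F0, F1, F2, F3] : Fin 4 → Finset G) i) := by
    intro i
    fin_cases i <;> assumption
  have hdis : ∀ i j, i ≠ j → Disjoint ((![F0, F1, F2, F3] : Fin 4 → Finset G) i)
      ((![F0, F1, F2, F3] : Fin 4 → Finset G) j) := by
    intro i j hij
    fin_cases i <;> fin_cases j <;>
      first
      | exact absurd rfl hij
      | assumption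
      | (apply Disjoint.symm; assumption)
  refine ⟨![F0, F1, F2, F3], hsub, hfil, hdis, fun hk => ⟨hsub, hfil, hdis, ?_⟩⟩
  have h0 := hδ0 hk
  have h1 := hδ1 hk
  have h3 := hδ3 hk
  simp only [Finset.mem_insert, Finset.mem_singleton, not_or] at h0 h1 h3
  exact ⟨h0.1, h0.2, h1.1, h1.2, h3⟩

theorem exists_fourFillers {C : Finset G} {κ : ℕ} (hC : κ < C.card) {Bad : Finset G}
    (h0 : (0 : G) ∈ Bad) (h : Bad.card + 50 ≤ κ) {s a₂ a₃ : G} (ha₂ : a₂ ≠ 0) (ha₃ : a₃ ≠ 0)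
    (hb₂ : s - a₂ ≠ 0) (hb₃ : s - a₃ ≠ 0) (hne : a₃ ≠ s - a₃) (h23 : a₂ ≠ a₃)
    (h23' : a₂ ≠ s - a₃) :
    ∃ a₃' F, (a₃' = a₃ ∨ a₃' = s - a₃) ∧ B.FourFillers C Bad s a₂ a₃' F := by
  rcases B.three_le.lt_or_eq with hk | hk
  · obtain ⟨F, -, -, -, hF⟩ := B.exists_four_disjoint hC h0 h s a₂ a₃
    exact ⟨a₃, F, Or.inl rfl, hF hk⟩
  · obtain ⟨F, hF1, hF2, hF3, -⟩ := B.exists_four_disjoint hC h0 h s a₂ a₃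
    have hδ : ∀ i, B.δ (F i) = 0 := fun i => B.δ_eq_zero hk.symm (hF2 i)
    by_cases he : s + a₃ - a₂ - a₂ = 0
    · refine ⟨s - a₃, F, Or.inr rfl, hF1, hF2, hF3, ?_⟩
      simp only [hδ]
      refine ⟨(neg_ne_zero.2 ha₂).symm, (neg_ne_zero.2 hb₃).symm, hb₂.symm, ?_, ?_⟩
      · intro h'
        apply hne
        have : s + (s - a₃) - a₂ - a₂ - (s + a₃ - a₂ - a₂) = 0 := by rw [he, ← h', sub_zero]
        rw [← sub_eq_zero, ← neg_eq_zero, ← this]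
        abel
      · intro h'
        apply h23'
        rw [add_zero] at h'
        exact (sub_eq_zero.1 h'.symm).symm
    · refine ⟨a₃, F, Or.inl rfl, hF1, hF2, hF3, ?_⟩
      simp only [hδ]
      refine ⟨(neg_ne_zero.2 ha₂).symm, (neg_ne_zero.2 ha₃).symm, hb₂.symm, Ne.symm he, ?_⟩
      intro h'
      rw [add_zero] at h'
      exact h23 (sub_eq_zero.1 h'.symm).symm

theorem _root_.injective_vec4 {α : Type*} {a b c d : α} (h1 : a ≠ b) (h2 : a ≠ c) (h3 : a ≠ d)
    (h4 : b ≠ c) (h5 : b ≠ d) (h6 : c ≠ d) : Function.Injective ![a, b, c, d] := by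
  intro i j hij
  fin_cases i <;> fin_cases j <;> simp_all [Ne.symm]

theorem _root_.Finset.card_union_le_add {α : Type*} [DecidableEq α] {s t : Finset α} {a b : ℕ}
    (hs : s.card ≤ a) (ht : t.card ≤ b) : (s ∪ t).card ≤ a + b :=
  (Finset.card_union_le s t).trans (Nat.add_le_add hs ht)

theorem _root_.image_vec4 {α : Type*} [DecidableEq α] (a b c d : α) :
    Finset.univ.image ![a, b, c, d] = {a, b, c, d} := by
  ext g
  simp [Fin.exists_fin_succ, eq_comm]

theorem _root_.Finset.union_pairs {α : Type*} [DecidableEq α] (Y Z W : Finset α) (a b u v : α) :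
    {a, b, u, v} ∪ Y ∪ Z ∪ W = Y ∪ Z ∪ W ∪ {u, v} ∪ {a, b} := by
  ext g
  simp only [Finset.mem_union, Finset.mem_insert, Finset.mem_singleton]
  tauto

theorem card_biUnion_filler_le {F : Fin 4 → Finset G} (hF : ∀ i, B.Filler (F i)) :
    (Finset.univ.biUnion F).card ≤ 24 := by
  refine Finset.card_biUnion_le.trans ((Finset.sum_le_sum (g := fun _ => 6)
    fun i _ => B.card_filler_le (hF i)).trans ?_)
  simp

theorem card_biUnion_bad_le (X : Finset G) (F : Fin 4 → Finset G) :
    (X.biUnion fun x => Finset.univ.biUnion fun i => B.bad x (F i)).card ≤ X.card * 80 := by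
  refine Finset.card_biUnion_le_card_mul _ _ _ fun x _ => Finset.card_biUnion_le.trans
    ((Finset.sum_le_sum (g := fun _ => 20) fun i _ => B.card_bad _ _).trans ?_)
  simp

/-- The data from which the absorbing gadget is assembled, and the resulting tilings. -/
theorem gadget_tiles {s a₁ a₂ a₃ u t : G} {F : Fin 4 → Finset G} {C₂ Bad : Finset G}
    {α β : Fin 4 → G}
    (hα : α = ![B.δ (F 0), a₂ - (s - a₁) + B.δ (F 1), a₃ - u + B.δ (F 2), a₂ - u + B.δ (F 3)])
    (hβ : β = ![-a₁, -a₂, -a₃, -a₂ + (s - a₁) - (s - a₃)])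
    (hF : ∀ i, B.Filler (F i)) (hFF : ∀ i j, i ≠ j → Disjoint (F i) (F j))
    {X : Finset G} (hX : X = {a₁, s - a₁, a₂, s - a₂, a₃, s - a₃, u, u + (a₁ - a₃)})
    (hX0 : ∀ x ∈ X, x ≠ 0) (hXF : ∀ x ∈ X, ∀ i, x ∉ F i)
    (h1 : a₁ ≠ s - a₁) (h2 : a₂ ≠ s - a₂) (h3 : a₃ ≠ s - a₃) (h13 : a₁ ≠ a₃)
    (hu : u ∉ ({a₁, s - a₁, a₂, s - a₂, a₃, s - a₃} : Finset G))
    (hv : u + (a₁ - a₃) ∉ ({a₁, s - a₁, a₂, s - a₂, a₃, s - a₃} : Finset G))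
    (hαi : Function.Injective α) (hβi : Function.Injective β)
    (hne : ∀ i j, t + α i ≠ β j - t)
    (hBadX : X ⊆ Bad) (hBadF : ∀ i, F i ⊆ Bad) (hBad0 : 0 ∈ Bad)
    (hBad : ∀ x ∈ X, ∀ i, B.bad x (F i) ⊆ Bad)
    (hy : ∀ i, t + α i ∈ C₂ \ Bad) (hz : ∀ j, β j - t ∈ C₂ \ Bad)
    {a : G} (ha : a = a₁ ∨ a = a₂ ∨ a = a₃) :
    Tiles B.OK ((Finset.univ.image (fun i => t + α i) ∪ Finset.univ.image (fun j => β j - t) ∪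
      Finset.univ.biUnion F ∪ {u, u + (a₁ - a₃)}) ∪ {a, s - a}) := by
  have hy' : ∀ i, t + α i ∉ Bad := fun i => (Finset.mem_sdiff.1 (hy i)).2
  have hz' : ∀ i, β i - t ∉ Bad := fun i => (Finset.mem_sdiff.1 (hz i)).2
  have huv : u ≠ u + (a₁ - a₃) := by
    intro h
    exact h13 (sub_eq_zero.1 (left_eq_add.1 h))
  set Y := Finset.univ.image (fun i => t + α i)
  set Z := Finset.univ.image (fun j => β j - t) with hZ
  set FF := Finset.univ.biUnion F
  have key : ∀ (x : Fin 4 → G) (σ : Fin 4 → Fin 4), Function.Bijective σ → Function.Injective x →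
      (∀ i, x i ∈ X) → (∀ i, x i + (t + α i) + (β (σ i) - t) = B.δ (F i)) →
      Tiles B.OK (Finset.univ.image x ∪ Y ∪ Z ∪ FF) := by
    intro x σ hσ hx hxX hsum
    have him : Z = Finset.univ.image (fun i => β (σ i) - t) := by
      ext g
      simp only [hZ, Finset.mem_image, Finset.mem_univ, true_and]
      exact hσ.surjective.exists
    rw [him]
    apply B.tiles_family hF (fun i => hX0 _ (hxX i)) (fun i h => hy' i (by rwa [h]))
      (fun i h => hz' (σ i) (by rwa [h])) (fun i h => hy' i (hBad _ (hxX i) i h)) hsum hx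
      (fun i j h => hαi (add_left_cancel h))
      (fun i j h => hσ.injective (hβi (sub_left_injective h)))
      (fun i j h => hy' j (h ▸ hBadX (hxX i))) (fun i j h => hz' (σ j) (h ▸ hBadX (hxX i)))
      (fun i j => hne i (σ j)) (fun i j => hXF _ (hxX i) j)
      (fun i j h => hy' i (hBadF j h)) (fun i j h => hz' (σ i) (hBadF j h)) hFF
  simp only [Finset.mem_insert, Finset.mem_singleton, not_or] at hu hv
  obtain ⟨u1, u2, u3, u4, u5, u6⟩ := hu
  obtain ⟨v1, v2, v3, v4, v5, v6⟩ := hv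
  rcases ha with rfl | rfl | rfl
  · convert key ![a, s - a, u, u + (a - a₃)] id Function.bijective_id
      (injective_vec4 h1 (Ne.symm u1) (Ne.symm v1) (Ne.symm u2) (Ne.symm v2) huv)
      (by intro i; fin_cases i <;> simp [hX]) ?_ using 1
    · rw [image_vec4, Finset.union_pairs]
    · subst hα hβ
      intro i
      fin_cases i <;> simp <;> abel
  · convert key ![a, s - a, u, u + (a₁ - a₃)] ![1, 0, 2, 3] (by decide)
      (injective_vec4 h2 (Ne.symm u3) (Ne.symm v3) (Ne.symm u4) (Ne.symm v4) huv)
      (by intro i; fin_cases i <;> simp [hX]) ?_ using 1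
    · rw [image_vec4, Finset.union_pairs]
    · subst hα hβ
      intro i
      fin_cases i <;> simp <;> abel
  · convert key ![a, s - a, u + (a₁ - a), u] ![2, 3, 0, 1] (by decide)
      (injective_vec4 h3 (Ne.symm v5) (Ne.symm u5) (Ne.symm v6) (Ne.symm u6) huv.symm)
      (by intro i; fin_cases i <;> simp [hX]) ?_ using 1
    · rw [image_vec4, Finset.union_pairs, Finset.pair_comm (u + (a₁ - a)) u]
    · subst hα hβ
      intro i
      fin_cases i <;> simp <;> abel

end BlockSystem

namespace BlockSystem

variable {G : Type} [AddCommGroup G] [DecidableEq G] (B : BlockSystem G)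

theorem exists_gadget_of_fourFillers {C₁ C₂ : Finset G} {κ : ℕ} (hC₁ : Supply C₁ κ)
    (hC₂ : Supply C₂ κ) {s : G} (hs : s ≠ 0) {Bad : Finset G} (h0 : (0 : G) ∈ Bad)
    (h : Bad.card + 1000 ≤ κ) {a₂ a₃ : G} (ha₂ : a₂ ∈ Bad) (hb₂ : s - a₂ ∈ Bad) (ha₃ : a₃ ∈ Bad)
    (hb₃ : s - a₃ ∈ Bad) (hX0 : ∀ x ∈ ({a₂, s - a₂, a₃, s - a₃} : Finset G), x ≠ 0)
    (h2 : a₂ ≠ s - a₂) (h3 : a₃ ≠ s - a₃) (h23 : a₂ ≠ a₃) {F : Fin 4 → Finset G}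
    (hF : B.FourFillers C₂ Bad s a₂ a₃ F) :
    ∃ a₁ ∈ C₁ \ Bad, s - a₁ ∈ C₁ \ Bad ∧ a₁ ≠ s - a₁ ∧ ∃ Q ⊆ C₂ \ Bad, a₁ ∉ Q ∧ s - a₁ ∉ Q ∧
      Q.card ≤ 34 ∧ ∀ a, (a = a₁ ∨ a = a₂ ∨ a = a₃) → Tiles B.OK (Q ∪ {a, s - a}) := by
  obtain ⟨hFC, hfil, hdis, f1, f2, f3, f4, f5⟩ := hF
  set FF := Finset.univ.biUnion F with hFF
  have cFF : FF.card ≤ 24 := B.card_biUnion_filler_le hfil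
  have hFsub : ∀ i, F i ⊆ FF := fun i => Finset.subset_biUnion_of_mem F (Finset.mem_univ i)
  set d0 := B.δ (F 0)
  set d1 := B.δ (F 1)
  set d2 := B.δ (F 2)
  set d3 := B.δ (F 3)
  -- the fresh pair
  set E₁ : Finset G := [-d0, a₂ + (s - a₃) - a₃, a₂ + d1 - d0, d0 + a₂ + (s - a₃), a₂ + a₂ + d1,
    a₂ + d1 + a₃].toFinset with hE₁
  have cE₁ : E₁.card ≤ 6 := List.toFinset_card_le _
  have cBad₁ : (Bad ∪ FF ∪ E₁).card ≤ Bad.card + 24 + 6 :=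
    Finset.card_union_le_add (Finset.card_union_le_add le_rfl cFF) cE₁
  set Bad₁ := Bad ∪ FF ∪ E₁ with hBad₁
  obtain ⟨a₁, ha₁, hb₁, h1, he0, he1⟩ := hC₁.exists_pair hs (e₀ := s - a₂ - d1)
    (e₁ := s + a₃ - a₂ - a₂ - d1) (Or.inl (fun h' => f3 (sub_eq_zero.1 h').symm))
    (Or.inl (fun h' => f4 (sub_eq_zero.1 h').symm)) (Bad := Bad₁) (by omega)
  rw [Finset.mem_sdiff] at ha₁ hb₁
  have ha₁' : a₁ ∉ Bad ∧ a₁ ∉ FF ∧ a₁ ∉ E₁ := by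
    simpa only [hBad₁, Finset.mem_union, not_or, and_assoc] using ha₁.2
  have hb₁' : s - a₁ ∉ Bad ∧ s - a₁ ∉ FF ∧ s - a₁ ∉ E₁ := by
    simpa only [hBad₁, Finset.mem_union, not_or, and_assoc] using hb₁.2
  have hne : ∀ x ∈ Bad, a₁ ≠ x ∧ s - a₁ ≠ x := fun x hx =>
    ⟨fun h' => ha₁'.1 (h' ▸ hx), fun h' => hb₁'.1 (h' ▸ hx)⟩
  obtain ⟨x1, -, -, -, -, -⟩ : a₁ ≠ -d0 ∧ _ ∧ _ ∧ _ ∧ _ ∧ _ := by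
    simpa [hE₁, not_or] using ha₁'.2.2
  obtain ⟨-, y2, y3, y4, y5, y6⟩ : _ ∧ s - a₁ ≠ a₂ + (s - a₃) - a₃ ∧ s - a₁ ≠ a₂ + d1 - d0 ∧
      s - a₁ ≠ d0 + a₂ + (s - a₃) ∧ s - a₁ ≠ a₂ + a₂ + d1 ∧ s - a₁ ≠ a₂ + d1 + a₃ := by
    simpa only [hE₁, List.mem_toFinset, List.mem_cons, List.not_mem_nil, or_false, not_or]
      using hb₁'.2.2
  set β : Fin 4 → G := ![-a₁, -a₂, -a₃, -a₂ + (s - a₁) - (s - a₃)] with hβ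
  set p := a₂ - (s - a₁) + d1 with hp
  -- the fresh translate
  set E₂ : Finset G := [a₃ + d2 - d0, a₂ + d3 - d0, a₃ + d2 - p, a₂ + d3 - p].toFinset ∪
    (Finset.univ.image (fun j => a₃ + d2 - β j) ∪ Finset.univ.image (fun j => a₂ + d3 - β j))
    with hE₂
  have cE₂ : E₂.card ≤ 4 + (4 + 4) := Finset.card_union_le_add (List.toFinset_card_le _)
    (Finset.card_union_le_add (Finset.card_image_le.trans (by simp))
      (Finset.card_image_le.trans (by simp)))
  have cBad₂ : (Bad₁ ∪ {a₁, s - a₁} ∪ E₂).card ≤ Bad.card + 24 + 6 + 2 + (4 + (4 + 4)) :=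
    Finset.card_union_le_add (Finset.card_union_le_add cBad₁ Finset.card_le_two) cE₂
  set Bad₂ := Bad₁ ∪ {a₁, s - a₁} ∪ E₂ with hBad₂
  obtain ⟨u, hu, hv⟩ := hC₂.exists_two hs (a₁ - a₃) (Bad := Bad₂) (by omega) (by omega)
  rw [Finset.mem_sdiff] at hu hv
  have hsub12 : Bad₁ ⊆ Bad₂ := by
    rw [hBad₂, Finset.union_assoc]; exact Finset.subset_union_left
  have hsub1 : Bad ⊆ Bad₁ := by
    rw [hBad₁, Finset.union_assoc]; exact Finset.subset_union_left
  have hsubF : FF ⊆ Bad₁ := by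
    rw [hBad₁]
    exact Finset.subset_union_right.trans Finset.subset_union_left
  have haB : a₁ ∈ Bad₂ ∧ s - a₁ ∈ Bad₂ := by simp [hBad₂]
  have huE : u ∉ E₂ := fun h' => hu.2 (Finset.mem_union_right _ h')
  obtain ⟨⟨u1, u2, u3, u4⟩, u5, u6⟩ : (u ≠ a₃ + d2 - d0 ∧ u ≠ a₂ + d3 - d0 ∧ u ≠ a₃ + d2 - p ∧
      u ≠ a₂ + d3 - p) ∧ (∀ j, a₃ + d2 - β j ≠ u) ∧ ∀ j, a₂ + d3 - β j ≠ u := by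
    simpa only [hE₂, Finset.mem_union, Finset.mem_image, Finset.mem_univ, true_and,
      List.mem_toFinset, List.mem_cons, List.not_mem_nil, or_false, not_or, not_exists] using huE
  -- the final translate
  set X : Finset G := {a₁, s - a₁, a₂, s - a₂, a₃, s - a₃, u, u + (a₁ - a₃)} with hX
  have cX : X.card ≤ 8 := by
    have : X = [a₁, s - a₁, a₂, s - a₂, a₃, s - a₃, u, u + (a₁ - a₃)].toFinset := by simp [hX]
    rw [this]
    exact List.toFinset_card_le _
  set W := X.biUnion fun x => Finset.univ.biUnion fun i => B.bad x (F i) with hW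
  have cW : W.card ≤ 8 * 80 := (B.card_biUnion_bad_le X F).trans (Nat.mul_le_mul_right _ cX)
  have cBad₃ : (Bad₂ ∪ {u, u + (a₁ - a₃)} ∪ W).card ≤
      Bad.card + 24 + 6 + 2 + (4 + (4 + 4)) + 2 + 8 * 80 :=
    Finset.card_union_le_add (Finset.card_union_le_add cBad₂ Finset.card_le_two) cW
  set Bad₃ := Bad₂ ∪ {u, u + (a₁ - a₃)} ∪ W with hBad₃
  set α : Fin 4 → G := ![d0, p, a₃ - u + d2, a₂ - u + d3] with hα
  have hne2 : ∀ i j, α i ≠ β j := by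
    intro i j
    fin_cases i
    · change d0 ≠ β j
      fin_cases j
      · exact fun h' => x1 (by rw [h']; simp [hβ])
      · exact f1
      · exact f2
      · intro h'
        replace h' := sub_eq_zero.2 h'
        simp [hβ] at h'
        refine y4 (sub_eq_zero.1 ?_)
        rw [← neg_eq_zero, ← h']
        abel
    · change p ≠ β j
      fin_cases j <;> intro h' <;> replace h' := sub_eq_zero.2 h' <;> simp [hβ, hp] at h'
      · refine he0 (sub_eq_zero.1 ?_)
        rw [← h']; abel
      · refine y5 (sub_eq_zero.1 ?_)
        rw [← neg_eq_zero, ← h']; abel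
      · refine y6 (sub_eq_zero.1 ?_)
        rw [← neg_eq_zero, ← h']; abel
      · refine he1 (sub_eq_zero.1 ?_)
        rw [← h']; abel
    · change a₃ - u + d2 ≠ β j
      intro h'
      apply u5 j
      rw [← h']
      abel
    · change a₂ - u + d3 ≠ β j
      intro h'
      apply u6 j
      rw [← h']
      abel
  obtain ⟨t, ht, -, hy, hz⟩ := hC₂ α β (fun _ => s) (fun i j => Or.inl (hne2 i j))
    (fun _ => Or.inl hs) Bad₃ (by omega)
  have hsub23 : Bad₂ ⊆ Bad₃ := by
    rw [hBad₃, Finset.union_assoc]; exact Finset.subset_union_left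
  have hB3 : Bad ⊆ Bad₃ := hsub1.trans (hsub12.trans hsub23)
  have hB2 : Bad ⊆ Bad₂ := hsub1.trans hsub12
  have hu6 : ({a₁, s - a₁, a₂, s - a₂, a₃, s - a₃} : Finset G) ⊆ Bad₂ := by
    intro x hx
    simp only [Finset.mem_insert, Finset.mem_singleton] at hx
    rcases hx with rfl | rfl | rfl | rfl | rfl | rfl
    exacts [haB.1, haB.2, hB2 ha₂, hB2 hb₂, hB2 ha₃, hB2 hb₃]
  have hXB : X ⊆ Bad₃ := by
    intro x hx
    simp only [hX, Finset.mem_insert, Finset.mem_singleton] at hx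
    rcases hx with rfl | rfl | rfl | rfl | rfl | rfl | rfl | rfl
    exacts [hsub23 haB.1, hsub23 haB.2, hB3 ha₂, hB3 hb₂, hB3 ha₃, hB3 hb₃, by simp [hBad₃],
      by simp [hBad₃]]
  have hXnF : ∀ x ∈ X, x ≠ 0 ∧ ∀ i, x ∉ F i := by
    have hFB : ∀ x ∈ Bad, ∀ i, x ∉ F i := fun x hx i hxF =>
      (Finset.mem_sdiff.1 (hFC i hxF)).2 hx
    intro x hx
    simp only [hX, Finset.mem_insert, Finset.mem_singleton] at hx
    rcases hx with rfl | rfl | rfl | rfl | rfl | rfl | rfl | rfl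
    · exact ⟨fun h' => ha₁'.1 (by rwa [h']), fun i hi => ha₁'.2.1 (hFsub i hi)⟩
    · exact ⟨fun h' => hb₁'.1 (by rwa [h']), fun i hi => hb₁'.2.1 (hFsub i hi)⟩
    · exact ⟨hX0 _ (by simp), hFB _ ha₂⟩
    · exact ⟨hX0 _ (by simp), hFB _ hb₂⟩
    · exact ⟨hX0 _ (by simp), hFB _ ha₃⟩
    · exact ⟨hX0 _ (by simp), hFB _ hb₃⟩
    · exact ⟨fun h' => hu.2 (hB2 (by rwa [h'])), fun i hi => hu.2 (hsub12 (hsubF (hFsub i hi)))⟩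
    · exact ⟨fun h' => hv.2 (hB2 (by rwa [h'])), fun i hi => hv.2 (hsub12 (hsubF (hFsub i hi)))⟩
  have hαi : Function.Injective α := by
    apply injective_vec4
    · intro h'
      apply y3
      rw [h', hp]
      abel
    · intro h'
      apply u1
      rw [h']
      abel
    · intro h'
      apply u2
      rw [h']
      abel
    · intro h'
      apply u3
      rw [h']
      abel
    · intro h'
      apply u4
      rw [h']
      abel
    · intro h'
      apply f5
      have := sub_eq_zero.2 h'
      refine sub_eq_zero.1 ?_
      rw [← neg_eq_zero, ← this]
      abel
  have hβi : Function.Injective β := by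
    apply injective_vec4
    · exact fun h' => (hne _ ha₂).1 (neg_injective h')
    · exact fun h' => (hne _ ha₃).1 (neg_injective h')
    · intro h'
      apply h23
      have := sub_eq_zero.2 h'
      refine sub_eq_zero.1 ?_
      rw [← this]
      abel
    · exact fun h' => h23 (neg_injective h')
    · intro h'
      apply (hne _ hb₃).2
      have := sub_eq_zero.2 h'
      refine sub_eq_zero.1 ?_
      rw [← neg_eq_zero, ← this]
      abel
    · intro h'
      apply y2
      have := sub_eq_zero.2 h'
      refine sub_eq_zero.1 ?_
      rw [← neg_eq_zero, ← this]
      abel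
  have hsd : C₂ \ Bad₃ ⊆ C₂ \ Bad := Finset.sdiff_subset_sdiff subset_rfl hB3
  have hnQ : ∀ x ∈ Bad₂, x ∉ FF → x ∉ Finset.univ.image (fun i => t + α i) ∪
      Finset.univ.image (fun j => β j - t) ∪ FF ∪ {u, u + (a₁ - a₃)} := by
    intro x hx hxF hxQ
    simp only [Finset.mem_union, Finset.mem_image, Finset.mem_univ, true_and, Finset.mem_insert,
      Finset.mem_singleton] at hxQ
    rcases hxQ with ((⟨i, rfl⟩ | ⟨i, rfl⟩) | hxQ) | (rfl | rfl)
    · exact (Finset.mem_sdiff.1 (hy i)).2 (hsub23 hx)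
    · exact (Finset.mem_sdiff.1 (hz i)).2 (hsub23 hx)
    · exact hxF hxQ
    · exact hu.2 hx
    · exact hv.2 hx
  refine ⟨a₁, Finset.mem_sdiff.2 ⟨ha₁.1, ha₁'.1⟩, Finset.mem_sdiff.2 ⟨hb₁.1, hb₁'.1⟩, h1,
    Finset.univ.image (fun i => t + α i) ∪ Finset.univ.image (fun j => β j - t) ∪
      FF ∪ {u, u + (a₁ - a₃)}, ?_, ?_, ?_, ?_, ?_⟩
  · refine Finset.union_subset (Finset.union_subset (Finset.union_subset ?_ ?_) ?_) ?_
    · intro x hx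
      obtain ⟨i, -, rfl⟩ := Finset.mem_image.1 hx
      exact hsd (hy i)
    · intro x hx
      obtain ⟨i, -, rfl⟩ := Finset.mem_image.1 hx
      exact hsd (hz i)
    · exact Finset.biUnion_subset.2 fun i _ => hFC i
    · intro x hx
      simp only [Finset.mem_insert, Finset.mem_singleton] at hx
      rcases hx with rfl | rfl
      · exact Finset.mem_sdiff.2 ⟨hu.1, fun h' => hu.2 (hB2 h')⟩
      · exact Finset.mem_sdiff.2 ⟨hv.1, fun h' => hv.2 (hB2 h')⟩
  · exact hnQ a₁ haB.1 ha₁'.2.1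
  · exact hnQ _ haB.2 hb₁'.2.1
  · refine (Finset.card_union_le_add (a := 4 + 4 + 24) (b := 2) (Finset.card_union_le_add
      (Finset.card_union_le_add (Finset.card_image_le.trans (by simp))
      (Finset.card_image_le.trans (by simp))) cFF) Finset.card_le_two).trans (by norm_num)
  · intro a ha
    exact B.gadget_tiles hα hβ hfil hdis hX (fun x hx => (hXnF x hx).1)
      (fun x hx => (hXnF x hx).2) h1 h2 h3 (hne _ ha₃).1 (fun h' => hu.2 (hu6 h'))
      (fun h' => hv.2 (hu6 h')) hαi hβi ht hXB
      (fun i => (hFsub i).trans (hsubF.trans (hsub12.trans hsub23))) (hB3 h0)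
      (fun x hx i => (Finset.subset_biUnion_of_mem (fun i => B.bad x (F i))
        (Finset.mem_univ i)).trans ((Finset.subset_biUnion_of_mem (fun x =>
        Finset.univ.biUnion fun i => B.bad x (F i)) hx).trans Finset.subset_union_right)) hy hz ha

end BlockSystem

/-! ### The absorber -/

theorem exists_seq_of_extends {α : Type} [Nonempty α] (P : ℕ → (ℕ → α) → α → Prop)
    (hP : ∀ k f g x, (∀ j < k, f j = g j) → P k f x → P k g x)
    (h : ∀ k f, (∀ j < k, P j f (f j)) → ∃ x, P k f x) : ∃ f : ℕ → α, ∀ k, P k f (f k) := by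
  let step : ℕ → (ℕ → α) → α := fun k f =>
    if h : ∃ x, P k f x then h.choose else Classical.arbitrary α
  let F : ℕ → ℕ → α := fun n => Nat.rec (fun _ => Classical.arbitrary α)
    (fun k f => Function.update f k (step k f)) n
  have hF : ∀ n, F (n + 1) = Function.update (F n) n (step n (F n)) := fun n => rfl
  let f : ℕ → α := fun k => step k (F k)
  have hFf : ∀ n, ∀ j < n, F n j = f j := by
    intro n
    induction n with
    | zero => simp
    | succ n ih =>
      intro j hj
      rw [hF]
      rcases Nat.lt_succ_iff_lt_or_eq.1 hj with hj | rfl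
      · rw [Function.update_of_ne hj.ne, ih j hj]
      · rw [Function.update_self]
  refine ⟨f, fun k => ?_⟩
  induction k using Nat.strong_induction_on with
  | _ k ih =>
    have h1 : ∃ x, P k (F k) x := by
      obtain ⟨x, hx⟩ := h k f ih
      exact ⟨x, hP k f _ x (fun j hj => (hFf k j hj).symm) hx⟩
    refine hP k (F k) f _ (hFf k) ?_
    change P k (F k) (step k (F k))
    simp only [step, dif_pos h1]
    exact h1.choose_spec

/-- The pair consisting of `x` and its mirror image. -/
def mirrorPair {G : Type} [AddCommGroup G] [DecidableEq G] (s x : G) : Finset G := {x, s - x}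

section

variable {G : Type} [AddCommGroup G] [DecidableEq G]

theorem mem_mirrorPair {s x y : G} : y ∈ mirrorPair s x ↔ y = x ∨ y = s - x := by
  simp [mirrorPair]

theorem left_mem_mirrorPair (s x : G) : x ∈ mirrorPair s x := by simp [mirrorPair]

theorem right_mem_mirrorPair (s x : G) : s - x ∈ mirrorPair s x := by simp [mirrorPair]

theorem card_mirrorPair_le (s x : G) : (mirrorPair s x).card ≤ 2 := Finset.card_le_two

theorem mirrorPair_sub (s x : G) : mirrorPair s (s - x) = mirrorPair s x := by
  simp [mirrorPair, Finset.pair_comm]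

theorem mirrorPair_subset {s x : G} {S : Finset G} (hx : x ∈ S) (hy : s - x ∈ S) :
    mirrorPair s x ⊆ S := by
  intro y hy'
  rcases mem_mirrorPair.1 hy' with rfl | rfl <;> assumption

theorem mem_of_mirrorPair_inter {s x y : G} (h : ¬Disjoint (mirrorPair s x) (mirrorPair s y)) :
    x = y ∨ x = s - y := by
  rw [Finset.not_disjoint_iff] at h
  obtain ⟨z, h1, h2⟩ := h
  rcases mem_mirrorPair.1 h1 with rfl | rfl <;> rcases mem_mirrorPair.1 h2 with h | h
  · exact Or.inl h
  · exact Or.inr h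
  · right; rw [← h]; abel
  · left; exact sub_right_injective h

end

namespace BlockSystem

variable {G : Type} [AddCommGroup G] [DecidableEq G] (B : BlockSystem G)

/-- The tiling property of a gadget with a fresh pair `v.1` and a set `v.2` switching between
three pairs. -/
def IsGadget (C₁ C₂ : Finset G) (s : G) (Bad : Finset G) (v : G × Finset G) : Prop :=
  v.1 ∈ C₁ \ Bad ∧ s - v.1 ∈ C₁ \ Bad ∧ v.1 ≠ s - v.1 ∧ v.2 ⊆ C₂ \ Bad ∧
    Disjoint v.2 (mirrorPair s v.1) ∧ v.2.card ≤ 34 ∧ Tiles B.OK (v.2 ∪ mirrorPair s v.1)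

theorem exists_gadget {C₁ C₂ : Finset G} {κ : ℕ} (hC₁ : Supply C₁ κ)
    (hC₂ : Supply C₂ κ) {s : G} (hs : s ≠ 0) {Bad : Finset G} (h0 : (0 : G) ∈ Bad)
    (h : Bad.card + 1000 ≤ κ) {a₂ a₃ : G} (hB₂ : mirrorPair s a₂ ⊆ Bad)
    (hB₃ : mirrorPair s a₃ ⊆ Bad) (hn₂ : 0 ∉ mirrorPair s a₂) (hn₃ : 0 ∉ mirrorPair s a₃)
    (h2 : a₂ ≠ s - a₂) (h3 : a₃ ≠ s - a₃) (h23 : Disjoint (mirrorPair s a₂) (mirrorPair s a₃)) :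
    ∃ v, B.IsGadget C₁ C₂ s Bad v ∧ Tiles B.OK (v.2 ∪ mirrorPair s a₂) ∧
      Tiles B.OK (v.2 ∪ mirrorPair s a₃) := by
  have hd : ∀ x ∈ mirrorPair s a₂, ∀ y ∈ mirrorPair s a₃, x ≠ y := fun x hx y hy h' =>
    Finset.disjoint_left.1 h23 hx (h' ▸ hy)
  have key : ∀ a₃', mirrorPair s a₃' = mirrorPair s a₃ → ∀ F, B.FourFillers C₂ Bad s a₂ a₃' F →
      ∃ v, B.IsGadget C₁ C₂ s Bad v ∧ Tiles B.OK (v.2 ∪ mirrorPair s a₂) ∧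
      Tiles B.OK (v.2 ∪ mirrorPair s a₃) := by
    intro a₃' he F hF
    rw [← he] at hB₃ hn₃ hd ⊢
    have hne : a₃' ≠ s - a₃' := by
      have : a₃' = a₃ ∨ a₃' = s - a₃ := by
        rw [← mem_mirrorPair, ← he]
        exact left_mem_mirrorPair _ _
      rcases this with rfl | rfl
      · exact h3
      · rw [sub_sub_cancel]; exact h3.symm
    obtain ⟨a₁, h1, h1', hne1, Q, hQ, hq1, hq2, hQc, hQt⟩ :=
      B.exists_gadget_of_fourFillers hC₁ hC₂ hs h0 h (hB₂ (left_mem_mirrorPair _ _))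
      (hB₂ (right_mem_mirrorPair _ _)) (hB₃ (left_mem_mirrorPair _ _))
      (hB₃ (right_mem_mirrorPair _ _)) (by
        intro x hx h'
        subst h'
        simp only [Finset.mem_insert, Finset.mem_singleton] at hx
        simp only [mem_mirrorPair, not_or] at hn₂ hn₃
        rcases hx with h | h | h | h
        exacts [hn₂.1 h, hn₂.2 h, hn₃.1 h, hn₃.2 h]) h2 hne
      (hd _ (left_mem_mirrorPair _ _) _ (left_mem_mirrorPair _ _)) hF
    refine ⟨(a₁, Q), ⟨h1, h1', hne1, hQ, ?_, hQc, hQt _ (Or.inl rfl)⟩,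
      hQt _ (Or.inr (Or.inl rfl)), hQt _ (Or.inr (Or.inr rfl))⟩
    rw [Finset.disjoint_right]
    intro x hx
    rcases mem_mirrorPair.1 hx with rfl | rfl <;> assumption
  simp only [mem_mirrorPair, not_or] at hn₂ hn₃
  obtain ⟨a₃', F, h', hF⟩ := B.exists_fourFillers ((hC₂.lt_card hs)) h0 (by omega)
    (Ne.symm hn₂.1) (Ne.symm hn₃.1) (Ne.symm hn₂.2) (Ne.symm hn₃.2) h3
    (hd _ (left_mem_mirrorPair _ _) _ (left_mem_mirrorPair _ _))
    (hd _ (left_mem_mirrorPair _ _) _ (right_mem_mirrorPair _ _))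
  rcases h' with rfl | rfl
  · exact key _ rfl F hF
  · exact key _ (mirrorPair_sub _ _) F hF

theorem IsGadget.mono {C₁ C₂ : Finset G} {s : G} {Bad Bad' : Finset G} {v : G × Finset G}
    (h : B.IsGadget C₁ C₂ s Bad' v) (hB : Bad ⊆ Bad') : B.IsGadget C₁ C₂ s Bad v := by
  have hB' : ∀ C : Finset G, C \ Bad' ⊆ C \ Bad := fun C =>
    Finset.sdiff_subset_sdiff subset_rfl hB
  obtain ⟨h1, h2, h3, h4, h5, h6⟩ := h
  exact ⟨hB' _ h1, hB' _ h2, h3, h4.trans (hB' _), h5, h6⟩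

theorem exists_gadget_single {C₁ C₂ : Finset G} {κ : ℕ} (hC₁ : Supply C₁ κ)
    (hC₂ : Supply C₂ κ) {s : G} (hs : s ≠ 0) {Bad : Finset G} (h0 : (0 : G) ∈ Bad)
    (h : Bad.card + 1002 ≤ κ) {a₂ : G} (hB₂ : mirrorPair s a₂ ⊆ Bad)
    (hn₂ : 0 ∉ mirrorPair s a₂) (h2 : a₂ ≠ s - a₂) :
    ∃ v, B.IsGadget C₁ C₂ s Bad v ∧ Tiles B.OK (v.2 ∪ mirrorPair s a₂) := by
  obtain ⟨x, hx, hx', hxx, -, -⟩ := hC₁.exists_pair hs (Or.inl hs) (Or.inl hs) (Bad := Bad)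
    (by omega)
  rw [Finset.mem_sdiff] at hx hx'
  have hdis : Disjoint Bad (mirrorPair s x) := by
    rw [Finset.disjoint_right]
    intro y hy
    rcases mem_mirrorPair.1 hy with rfl | rfl
    exacts [hx.2, hx'.2]
  obtain ⟨v, hv, hv', -⟩ := B.exists_gadget hC₁ hC₂ hs (Bad := Bad ∪ mirrorPair s x)
    (Finset.mem_union_left _ h0) (by
      have := Finset.card_union_le Bad (mirrorPair s x)
      have := card_mirrorPair_le s x
      omega) (hB₂.trans Finset.subset_union_left) Finset.subset_union_right hn₂
    (fun h' => Finset.disjoint_left.1 hdis h0 h') h2 hxx (hdis.mono_left hB₂)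
  exact ⟨v, IsGadget.mono B hv Finset.subset_union_left, hv'⟩

end BlockSystem

namespace BlockSystem

variable {G : Type} [AddCommGroup G] [DecidableEq G] (B : BlockSystem G)

/-- The pairs of the network: `M` given ones followed by the fresh pairs of the gadgets. -/
def node (p : ℕ → G) (M : ℕ) (f : ℕ → G × Finset G) (x : ℕ) : G :=
  if x < M then p x else (f (x - M)).1

/-- The elements in use before the `k`-th gadget is chosen. -/
def used (s : G) (Bad : Finset G) (p : ℕ → G) (M : ℕ) (f : ℕ → G × Finset G) (k : ℕ) : Finset G :=
  Bad ∪ (Finset.range (M + k)).biUnion (fun x => mirrorPair s (node p M f x)) ∪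
    (Finset.range k).biUnion fun w => (f w).2

/-- The pairs `{p x, s - p x}`, `x < M`, are nondegenerate and disjoint. -/
def IsPairFamily (s : G) (p : ℕ → G) (M : ℕ) : Prop :=
  (∀ x < M, 0 ∉ mirrorPair s (p x) ∧ p x ≠ s - p x) ∧
    ∀ x < M, ∀ y < M, x ≠ y → Disjoint (mirrorPair s (p x)) (mirrorPair s (p y))

variable {s : G} {Bad : Finset G} {p : ℕ → G} {M : ℕ} {f : ℕ → G × Finset G} {C₁ C₂ : Finset G}

theorem node_of_lt {G : Type} {p : ℕ → G} {M : ℕ} {f : ℕ → G × Finset G} {x : ℕ} (hx : x < M) :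
    node p M f x = p x := if_pos hx

theorem node_add {G : Type} {p : ℕ → G} {M : ℕ} {f : ℕ → G × Finset G} (w : ℕ) :
    node p M f (M + w) = (f w).1 := by
  simp [node]

theorem used_congr {f g : ℕ → G × Finset G} {k : ℕ} (h : ∀ j < k, f j = g j) :
    used s Bad p M f k = used s Bad p M g k ∧ ∀ x < M + k, node p M f x = node p M g x := by
  have hn : ∀ x < M + k, node p M f x = node p M g x := by
    intro x hx
    by_cases hxM : x < M
    · rw [node_of_lt hxM, node_of_lt hxM]
    · obtain ⟨w, rfl⟩ := Nat.exists_eq_add_of_le (not_lt.1 hxM)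
      rw [node_add, node_add, h w (by omega)]
  refine ⟨?_, hn⟩
  unfold used
  congr 1
  · congr 1
    refine Finset.biUnion_congr rfl fun x hx => ?_
    rw [hn x (Finset.mem_range.1 hx)]
  · refine Finset.biUnion_congr rfl fun x hx => ?_
    rw [h x (Finset.mem_range.1 hx)]

theorem subset_used (k : ℕ) : Bad ⊆ used s Bad p M f k := by
  unfold used
  exact Finset.subset_union_left.trans Finset.subset_union_left

theorem pair_subset_used {k x : ℕ} (hx : x < M + k) :
    mirrorPair s (node p M f x) ⊆ used s Bad p M f k := by
  unfold used
  exact (Finset.subset_biUnion_of_mem (fun x => mirrorPair s (node p M f x))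
    (Finset.mem_range.2 hx)).trans (Finset.subset_union_right.trans Finset.subset_union_left)

theorem snd_subset_used {k w : ℕ} (hw : w < k) : (f w).2 ⊆ used s Bad p M f k := by
  unfold used
  exact (Finset.subset_biUnion_of_mem (fun w => (f w).2)
    (Finset.mem_range.2 hw)).trans Finset.subset_union_right

theorem card_used_le {k : ℕ} (h : ∀ w < k, (f w).2.card ≤ 34) :
    (used s Bad p M f k).card ≤ Bad.card + 2 * M + 36 * k := by
  have h1 : ((Finset.range (M + k)).biUnion (fun x => mirrorPair s (node p M f x))).card ≤
      (M + k) * 2 := by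
    have := Finset.card_biUnion_le_card_mul (Finset.range (M + k))
      (fun x => mirrorPair s (node p M f x)) 2 (fun x _ => card_mirrorPair_le _ _)
    simpa using this
  have h2 : ((Finset.range k).biUnion fun w => (f w).2).card ≤ k * 34 := by
    have := Finset.card_biUnion_le_card_mul (Finset.range k)
      (fun w => (f w).2) 34 (fun x hx => h x (Finset.mem_range.1 hx))
    simpa using this
  have h3 : (used s Bad p M f k).card ≤ Bad.card + (M + k) * 2 + k * 34 :=
    Finset.card_union_le_add (Finset.card_union_le_add le_rfl h1) h2
  omega

theorem node_good (h0 : (0 : G) ∈ Bad) (hp : IsPairFamily s p M) {k : ℕ}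
    (h : ∀ j < k, B.IsGadget C₁ C₂ s (used s Bad p M f j) (f j)) :
    (∀ x < M + k, 0 ∉ mirrorPair s (node p M f x) ∧ node p M f x ≠ s - node p M f x) ∧
      ∀ x < M + k, ∀ y < M + k, x ≠ y →
        Disjoint (mirrorPair s (node p M f x)) (mirrorPair s (node p M f y)) := by
  have hdis : ∀ j < k, Disjoint (used s Bad p M f j) (mirrorPair s (f j).1) := by
    intro j hj
    obtain ⟨h1, h2, -⟩ := h j hj
    rw [Finset.disjoint_right]
    intro y hy
    rcases mem_mirrorPair.1 hy with rfl | rfl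
    exacts [(Finset.mem_sdiff.1 h1).2, (Finset.mem_sdiff.1 h2).2]
  constructor
  · intro x hx
    by_cases hxM : x < M
    · rw [node_of_lt hxM]
      exact hp.1 x hxM
    · obtain ⟨w, rfl⟩ := Nat.exists_eq_add_of_le (not_lt.1 hxM)
      rw [node_add]
      exact ⟨fun h' => Finset.disjoint_left.1 (hdis w (by omega)) (subset_used _ h0) h',
        (h w (by omega)).2.2.1⟩
  · have key : ∀ x < M + k, ∀ y < M + k, x < y →
        Disjoint (mirrorPair s (node p M f x)) (mirrorPair s (node p M f y)) := by
      intro x hx y hy hxy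
      by_cases hyM : y < M
      · rw [node_of_lt hyM, node_of_lt (hxy.trans hyM)]
        exact hp.2 x (hxy.trans hyM) y hyM hxy.ne
      · obtain ⟨w, rfl⟩ := Nat.exists_eq_add_of_le (not_lt.1 hyM)
        rw [node_add]
        exact (hdis w (by omega)).mono_left (pair_subset_used hxy)
    intro x hx y hy hxy
    rcases hxy.lt_or_gt with h' | h'
    exacts [key x hx y hy h', (key y hy x hx h').symm]

theorem exists_gadget_seq {κ : ℕ} (hC₁ : Supply C₁ κ)
    (hC₂ : Supply C₂ κ) (hs : s ≠ 0) (h0 : (0 : G) ∈ Bad) (hp : IsPairFamily s p M) {m : ℕ}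
    (h : Bad.card + 2 * M + 36 * (m * M) + 1002 ≤ κ) :
    ∃ f : ℕ → G × Finset G, ∀ k < m * M, B.IsGadget C₁ C₂ s (used s Bad p M f k) (f k) ∧
      Tiles B.OK ((f k).2 ∪ mirrorPair s (node p M f k)) ∧ (k % M + 2 ^ (k / M) < M →
        Tiles B.OK ((f k).2 ∪ mirrorPair s (node p M f (k + 2 ^ (k / M))))) := by
  refine exists_seq_of_extends (α := G × Finset G) (fun k f v => k < m * M →
    B.IsGadget C₁ C₂ s (used s Bad p M f k) v ∧
      Tiles B.OK (v.2 ∪ mirrorPair s (node p M f k)) ∧ (k % M + 2 ^ (k / M) < M →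
        Tiles B.OK (v.2 ∪ mirrorPair s (node p M f (k + 2 ^ (k / M)))))) ?_ ?_
  · intro k f g v hfg hv hk
    have hM : 0 < M := Nat.pos_of_ne_zero (by rintro rfl; simp at hk)
    obtain ⟨e1, e2⟩ := used_congr (s := s) (Bad := Bad) (p := p) (M := M) hfg
    obtain ⟨h1, h2, h3⟩ := hv hk
    rw [e1] at h1
    rw [e2 k (by omega)] at h2
    refine ⟨h1, h2, fun hlt => ?_⟩
    have := Nat.mod_le k M
    have h4 := h3 hlt
    rwa [e2 _ (by omega)] at h4
  · intro k f ih
    by_cases hk : k < m * M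
    swap
    · exact ⟨(0, ∅), fun h' => absurd h' hk⟩
    have hM : 0 < M := Nat.pos_of_ne_zero (by rintro rfl; simp at hk)
    have ih' : ∀ j < k, B.IsGadget C₁ C₂ s (used s Bad p M f j) (f j) :=
      fun j hj => (ih j hj (hj.trans hk)).1
    obtain ⟨n1, n2⟩ := B.node_good h0 hp ih'
    have hc := card_used_le (s := s) (Bad := Bad) (p := p) (M := M) (f := f) (k := k)
      (fun w hw => (ih' w hw).2.2.2.2.2.1)
    by_cases hlt : k % M + 2 ^ (k / M) < M
    · have hl : k + 2 ^ (k / M) < M + k := by omega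
      have hpos : 0 < 2 ^ (k / M) := by positivity
      obtain ⟨v, hv1, hv2, hv3⟩ := B.exists_gadget hC₁ hC₂ hs
        (subset_used (s := s) (p := p) (M := M) (f := f) k h0)
        (by omega) (pair_subset_used (by omega : k < M + k)) (pair_subset_used hl)
        (n1 _ (by omega)).1 (n1 _ hl).1 (n1 _ (by omega)).2 (n1 _ hl).2
        (n2 _ (by omega) _ hl (by omega))
      exact ⟨v, fun _ => ⟨hv1, hv2, fun _ => hv3⟩⟩
    · obtain ⟨v, hv1, hv2⟩ := B.exists_gadget_single hC₁ hC₂ hs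
        (subset_used (s := s) (p := p) (M := M) (f := f) k h0)
        (by omega) (pair_subset_used (by omega : k < M + k))
        (n1 _ (by omega)).1 (n1 _ (by omega)).2
      exact ⟨v, fun _ => ⟨hv1, hv2, fun h' => absurd h' hlt⟩⟩

theorem exists_absorber {κ : ℕ} (hC₁ : Supply C₁ κ)
    (hC₂ : Supply C₂ κ) (hs : s ≠ 0) (h0 : (0 : G) ∈ Bad) (hp : IsPairFamily s p M)
    {m u : ℕ} (hm : 1 ≤ m) (hMm : M ≤ 2 ^ m)
    (h : Bad.card + 2 * M + 36 * (m * M) + 1002 ≤ κ) :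
    ∃ A ⊆ (C₁ ∪ C₂) \ Bad, A.card ≤ 36 * (m * M) ∧ ∀ F ⊆ Finset.range M, F.card = u →
      Tiles B.OK (A ∪ F.biUnion fun x => mirrorPair s (p x)) := by
  obtain ⟨f, hf⟩ := B.exists_gadget_seq hC₁ hC₂ hs h0 hp h
  have hf1 : ∀ k < m * M, B.IsGadget C₁ C₂ s (used s Bad p M f k) (f k) := fun k hk => (hf k hk).1
  obtain ⟨-, n2⟩ := B.node_good h0 hp hf1
  set a := node p M f with ha
  set lin : ℕ × ℕ → ℕ := fun w => w.1 * M + w.2 with hlin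
  set W := Finset.range m ×ˢ Finset.range M with hW
  set T := (Finset.Ioc 0 m ×ˢ Finset.range M) \ ({m} ×ˢ Finset.range u) with hT
  have hWlt : ∀ w ∈ W, lin w < m * M := by
    intro w hw
    simp only [hW, Finset.mem_product, Finset.mem_range] at hw
    have : (w.1 + 1) * M ≤ m * M := Nat.mul_le_mul_right _ hw.1
    simp only [hlin]
    linarith
  have hinj : ∀ w w' : ℕ × ℕ, w.2 < M → w'.2 < M → lin w = lin w' → w = w' := by
    intro w w' h1 h2 h3
    have e1 := congrArg (· % M) h3
    have e2 := congrArg (· / M) h3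
    simp only [hlin] at e1 e2
    have hM : 0 < M := by omega
    rw [Nat.mul_add_mod_of_lt h1, Nat.mul_add_mod_of_lt h2] at e1
    rw [mul_comm, Nat.mul_add_div hM, Nat.div_eq_of_lt h1, mul_comm, Nat.mul_add_div hM,
      Nat.div_eq_of_lt h2] at e2
    ext
    · simpa using e2
    · exact e1
  have hQd : ∀ w ∈ W, ∀ w' ∈ W, w ≠ w' → Disjoint (f (lin w)).2 (f (lin w')).2 := by
    have key : ∀ i < m * M, ∀ j < m * M, i < j → Disjoint (f i).2 (f j).2 := by
      intro i hi j hj hij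
      refine Disjoint.mono_left (snd_subset_used (s := s) (Bad := Bad) (p := p) (M := M) hij) ?_
      exact Finset.disjoint_sdiff.mono_right (hf1 j hj).2.2.2.1
    intro w hw w' hw' hne
    have h1 : lin w ≠ lin w' := fun h' => hne (hinj w w'
      (Finset.mem_range.1 (Finset.mem_product.1 hw).2)
      (Finset.mem_range.1 (Finset.mem_product.1 hw').2) h')
    rcases h1.lt_or_gt with h' | h'
    exacts [key _ (hWlt w hw) _ (hWlt w' hw') h', (key _ (hWlt w' hw') _ (hWlt w hw) h').symm]
  have hQa : ∀ i < m * M, ∀ x < M + m * M, Disjoint (f i).2 (mirrorPair s (a x)) := by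
    intro i hi x hx
    rcases lt_trichotomy x (M + i) with hxi | rfl | hxi
    · exact (Finset.sdiff_disjoint.mono_left (hf1 i hi).2.2.2.1).mono_right (pair_subset_used hxi)
    · rw [ha, node_add]
      exact (hf1 i hi).2.2.2.2.1
    · obtain ⟨j, rfl⟩ := Nat.exists_eq_add_of_le (show M ≤ x by omega)
      rw [ha, node_add]
      refine Disjoint.mono_left (snd_subset_used (s := s) (Bad := Bad) (p := p) (M := M)
        (show i < j by omega)) (Finset.disjoint_sdiff.mono_right
        (mirrorPair_subset (hf1 j (by omega)).1 (hf1 j (by omega)).2.1))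
  have hTlin : ∀ w ∈ T, ∃ j < m * M, lin w = M + j := by
    intro w hw
    simp only [hT, Finset.mem_sdiff, Finset.mem_product, Finset.mem_Ioc, Finset.mem_range] at hw
    obtain ⟨⟨⟨h1, h2⟩, h3⟩, -⟩ := hw
    obtain ⟨b, hb⟩ := Nat.exists_eq_add_of_le (show 1 ≤ w.1 by omega)
    refine ⟨b * M + w.2, ?_, ?_⟩
    · have : (b + 1) * M ≤ m * M := Nat.mul_le_mul_right _ (by omega)
      linarith
    · simp only [hlin, hb]
      ring
  refine ⟨W.biUnion (fun w => (f (lin w)).2) ∪ T.biUnion (fun w => mirrorPair s (a (lin w))),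
    ?_, ?_, ?_⟩
  · refine Finset.union_subset (Finset.biUnion_subset.2 fun w hw => ?_)
      (Finset.biUnion_subset.2 fun w hw => ?_)
    · exact (hf1 _ (hWlt w hw)).2.2.2.1.trans
        (Finset.sdiff_subset_sdiff Finset.subset_union_right (subset_used _))
    · obtain ⟨j, hj, hj'⟩ := hTlin w hw
      rw [hj', ha, node_add]
      exact (mirrorPair_subset (hf1 j hj).1 (hf1 j hj).2.1).trans
        (Finset.sdiff_subset_sdiff Finset.subset_union_left (subset_used _))
  · have h1 : (W.biUnion (fun w => (f (lin w)).2)).card ≤ m * M * 34 := by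
      have := Finset.card_biUnion_le_card_mul W (fun w => (f (lin w)).2) 34
        (fun w hw => (hf1 _ (hWlt w hw)).2.2.2.2.2.1)
      simpa [hW] using this
    have h2 : (T.biUnion (fun w => mirrorPair s (a (lin w)))).card ≤ m * M * 2 := by
      have := Finset.card_biUnion_le_card_mul T (fun w => mirrorPair s (a (lin w))) 2
        (fun w hw => card_mirrorPair_le _ _)
      have hT' : T.card ≤ m * M := (Finset.card_le_card Finset.sdiff_subset).trans (by simp)
      exact this.trans (Nat.mul_le_mul_right _ hT')
    have := Finset.card_union_le (W.biUnion (fun w => (f (lin w)).2))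
      (T.biUnion (fun w => mirrorPair s (a (lin w))))
    omega
  · intro F hF hFu
    obtain ⟨φ, hφ, hφi, hφim⟩ := Compaction.exists_assignment hm hMm hF hFu
    have hφmem : ∀ w ∈ W, φ w ∈ ({0} ×ˢ F) ∪ T := fun w hw => by
      rw [← hφim]; exact Finset.mem_image_of_mem _ hw
    have hφlt : ∀ w ∈ W, (φ w).2 < M ∧ lin (φ w) < M + m * M := by
      intro w hw
      rcases Finset.mem_union.1 (hφmem w hw) with h' | h'
      · have h2 := Finset.mem_product.1 h'
        have h3 := Finset.mem_range.1 (hF h2.2)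
        have h4 : (φ w).1 = 0 := Finset.mem_singleton.1 h2.1
        refine ⟨h3, ?_⟩
        simp only [hlin, h4]
        omega
      · refine ⟨?_, ?_⟩
        · exact Finset.mem_range.1 (Finset.mem_product.1 (Finset.mem_sdiff.1 h').1).2
        · obtain ⟨j, hj, hj'⟩ := hTlin _ h'
          omega
    have htile : Tiles B.OK (W.biUnion fun w => (f (lin w)).2 ∪ mirrorPair s (a (lin (φ w)))) := by
      apply Tiles.biUnion
      · intro w hw
        have hw' := hw
        simp only [hW, Finset.mem_product, Finset.mem_range] at hw'
        have hM : 0 < M := by omega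
        have hmod : lin w % M = w.2 := by
          simp only [hlin]; exact Nat.mul_add_mod_of_lt hw'.2
        have hdiv : lin w / M = w.1 := by
          simp only [hlin]
          rw [mul_comm, Nat.mul_add_div hM, Nat.div_eq_of_lt hw'.2, add_zero]
        obtain ⟨g1, g2, g3⟩ := hf _ (hWlt w hw)
        rcases hφ w hw with h' | h' | h'
        · have : lin (φ w) = M + lin w := by rw [h']; simp only [hlin]; ring
          rw [this, ha, node_add]
          exact g1.2.2.2.2.2.2
        · have : lin (φ w) = lin w := by rw [h']
          rw [this]
          exact g2
        · have e : lin (φ w) = lin w + 2 ^ (lin w / M) := by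
            rw [hdiv, h']; simp only [hlin]; ring
          rw [e]
          refine g3 ?_
          rw [hmod, hdiv]
          have := (hφlt w hw).1
          rwa [h'] at this
      · intro w hw w' hw' hne
        have hne' : lin (φ w) ≠ lin (φ w') := fun h' => hne (hφi hw hw'
          (hinj _ _ (hφlt w hw).1 (hφlt w' hw').1 h'))
        rw [Finset.disjoint_union_left, Finset.disjoint_union_right, Finset.disjoint_union_right]
        exact ⟨⟨hQd w hw w' hw' hne, hQa _ (hWlt w hw) _ (hφlt w' hw').2⟩,
          (hQa _ (hWlt w' hw') _ (hφlt w hw).2).symm,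
          n2 _ (hφlt w hw).2 _ (hφlt w' hw').2 hne'⟩
    convert htile using 1
    rw [Finset.biUnion_union, ← Finset.image_biUnion (f := φ)
      (t := fun v => mirrorPair s (a (lin v))), hφim, Finset.union_biUnion, Finset.union_assoc]
    congr 1
    rw [Finset.union_comm]
    congr 1
    ext g
    simp only [Finset.mem_biUnion, Finset.mem_product, Finset.mem_singleton, Prod.exists]
    constructor
    · rintro ⟨x, hx, hg⟩
      refine ⟨0, x, ⟨rfl, hx⟩, ?_⟩
      simp only [hlin, zero_mul, zero_add]
      rwa [ha, node_of_lt (Finset.mem_range.1 (hF hx))]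
    · rintro ⟨b, x, ⟨rfl, hx⟩, hg⟩
      refine ⟨x, hx, ?_⟩
      simp only [hlin, zero_mul, zero_add] at hg
      rwa [ha, node_of_lt (Finset.mem_range.1 (hF hx))] at hg

end BlockSystem

/-! ### Covering a small leftover set with mirror pairs -/

theorem Supply.exists_mirrored {G : Type} [AddCommGroup G] [DecidableEq G] {C : Finset G} {κ : ℕ}
    (h : Supply C κ) {s : G} (hs : s ≠ 0) (hs2 : (∀ x, x + x ≠ s) ∨ DoublingInjective G)
    {a : Fin 4 → G} (ha : ∀ i j, i ≠ j → Disjoint (mirrorPair s (a i)) (mirrorPair s (a j)))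
    {Bad : Finset G} (hBad : Bad.card ≤ κ) :
    ∃ t, (∀ i, t + a i ∈ C \ Bad ∧ s - (t + a i) ∈ C \ Bad) ∧
      (∀ i j, i ≠ j → t + a i ≠ t + a j ∧ s - (t + a i) ≠ s - (t + a j)) ∧
      ∀ i j, t + a i ≠ s - (t + a j) := by
  obtain ⟨t, h1, -, h3, h4⟩ := h a (fun j => s - a j) (fun _ => s) (by
    intro i j
    rcases eq_or_ne i j with rfl | hij
    · rcases hs2 with hs2 | hs2
      · left
        intro h'
        apply hs2 (a i)
        nth_rw 1 [h']
        abel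
      · exact Or.inr hs2
    · left
      intro h'
      exact Finset.disjoint_left.1 (ha i j hij) (left_mem_mirrorPair _ _)
        (by rw [h']; exact right_mem_mirrorPair _ _)) (fun _ => Or.inl hs) Bad hBad
  have e : ∀ j, s - (t + a j) = s - a j - t := fun j => by abel
  have hne : ∀ i j, i ≠ j → a i ≠ a j := fun i j hij h' =>
    Finset.disjoint_left.1 (ha i j hij) (left_mem_mirrorPair _ _)
        (by rw [h']; exact left_mem_mirrorPair _ _)
  refine ⟨t, fun i => ⟨h3 i, by rw [e]; exact h4 i⟩, fun i j hij =>
    ⟨fun h' => hne i j hij (add_left_cancel h'), fun h' => hne i j hij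
      (add_left_cancel (sub_right_injective h'))⟩, fun i j => by rw [e]; exact h1 i j⟩

theorem Finset.union_sdiff_of_exchange {α : Type} [DecidableEq α] {U : Finset α}
    {x y z a a' b b' c c' d d' : α} (hx : x ∈ U) (hy : y ∈ U) (hz : z ∈ U) (hxz : x ≠ z)
    (hyz : y ≠ z) (hU : ∀ v ∈ ({a, a', b, b', c, c', d, d'} : Finset α), v ∉ U)
    (hc : ∀ v ∈ ({a, a', b, b', c', d} : Finset α), v ≠ c)
    (hd : ∀ v ∈ ({a, a', b, b', c', d} : Finset α), v ≠ d') :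
    (U ∪ {a, a', b, b', c, c', d, d'}) \ {z, c, d'} =
      (U \ {x, y, z}) ∪ ({x, y} ∪ {a, a', b, b', c', d}) := by
  ext v
  simp only [Finset.mem_insert, Finset.mem_singleton] at hU hc hd
  simp only [Finset.mem_union, Finset.mem_sdiff, Finset.mem_insert, Finset.mem_singleton]
  by_cases hv : v ∈ U
  · have h1 : v ≠ c := fun h' => hU c (by tauto) (h' ▸ hv)
    have h2 : v ≠ d' := fun h' => hU d' (by tauto) (h' ▸ hv)
    have h3 : ¬(v = a ∨ v = a' ∨ v = b ∨ v = b' ∨ v = c' ∨ v = d) :=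
      fun h' => hU v (by tauto) hv
    have h4 : v = x → v ≠ z := fun h' => h' ▸ hxz
    have h5 : v = y → v ≠ z := fun h' => h' ▸ hyz
    simp only [hv, h1, h2, h3, true_or, true_and, or_false]
    tauto
  · have h1 : v ≠ x := fun h' => hv (h' ▸ hx)
    have h2 : v ≠ y := fun h' => hv (h' ▸ hy)
    have h3 : v ≠ z := fun h' => hv (h' ▸ hz)
    have h4 := hc v
    have h5 := hd v
    simp only [hv, h1, h2, h3, false_or, false_and]
    tauto

namespace BlockSystem

variable {G : Type} [AddCommGroup G] [DecidableEq G] (B : BlockSystem G)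

/-- A partial cover: the elements `T` have been tiled using the mirror-closed set `U`, of which
only `x`, `y`, `z` remain. -/
structure PartialCover (C Bad : Finset G) (s : G) (T U : Finset G) (x y z : G) : Prop where
  subset : U ⊆ C \ Bad
  mirror : ∀ v ∈ U, s - v ∈ U ∧ v ≠ s - v
  hx : x ∈ U
  hy : y ∈ U
  hz : z ∈ U
  hxy : x ≠ y
  hxz : x ≠ z
  hyz : y ≠ z
  tiles : Tiles B.OK (T ∪ U \ {x, y, z})

variable {C Bad : Finset G} {s : G}

theorem _root_.Finset.six_subset_eight {α : Type} [DecidableEq α] {a a' b b' c c' d d' : α} :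
    ({a, a', b, b', c', d} : Finset α) ⊆ {a, a', b, b', c, c', d, d'} := by
  intro v hv
  simp only [Finset.mem_insert, Finset.mem_singleton] at hv ⊢
  tauto

theorem _root_.Finset.pair_subset_triple {α : Type} [DecidableEq α] {x y z : α} :
    ({x, y} : Finset α) ⊆ {x, y, z} := by
  intro v hv
  simp only [Finset.mem_insert, Finset.mem_singleton] at hv ⊢
  tauto

theorem tiles_three_blocks {l x y a b d : G} {f₁ f₂ f₃ : Finset G} (h0 : (0 : G) ∈ Bad)
    (hl : l ∈ Bad) (hl0 : l ≠ 0) (hf₁ : f₁ ⊆ Bad) (hf₂ : f₂ ⊆ Bad) (hf₃ : f₃ ⊆ Bad)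
    (F₁ : B.Filler f₁) (F₂ : B.Filler f₂) (F₃ : B.Filler f₃)
    (hlf₁ : l ∉ f₁) (hlf₂ : l ∉ f₂) (hlf₃ : l ∉ f₃)
    (h12 : Disjoint f₁ f₂) (h13 : Disjoint f₁ f₃) (h23 : Disjoint f₂ f₃)
    {U Bad' : Finset G} (hUB : ∀ v ∈ U, v ∉ Bad)
    (hx : x ∈ U) (hy : y ∈ U) (hxy : x ≠ y)
    (hB : Bad ⊆ Bad') (hBU : U ⊆ Bad') (hb₁ : B.bad l f₁ ⊆ Bad') (hb₂ : B.bad x f₂ ⊆ Bad')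
    (hb₃ : B.bad y f₃ ⊆ Bad') {a' b' c' : G}
    (hnew : ∀ v ∈ ({a, a', b, b', c', d} : Finset G), v ∉ Bad')
    (hnd : [a, a', b, b', c', d].Nodup)
    (e₁ : l + a' + b = B.δ f₁) (e₂ : x + a + c' = B.δ f₂) (e₃ : y + b' + d = B.δ f₃) :
    Tiles B.OK (insert l (f₁ ∪ f₂ ∪ f₃) ∪ ({x, y} ∪ {a, a', b, b', c', d})) := by
  have hnB : ∀ v ∈ ({a, a', b, b', c', d} : Finset G), v ∉ Bad := fun v hv h' => hnew v hv (hB h')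
  have hn0 : ∀ v ∈ ({a, a', b, b', c', d} : Finset G), v ≠ 0 :=
    fun v hv h' => hnB v hv (h' ▸ h0)
  have hnU : ∀ v ∈ ({a, a', b, b', c', d} : Finset G), v ∉ U := fun v hv h' => hnew v hv (hBU h')
  have hnl : ∀ v ∈ ({a, a', b, b', c', d} : Finset G), l ≠ v :=
    fun v hv h' => hnB v hv (h' ▸ hl)
  have hnx : ∀ v ∈ ({a, a', b, b', c', d} : Finset G), x ≠ v :=
    fun v hv h' => hnU v hv (h' ▸ hx)
  have hny : ∀ v ∈ ({a, a', b, b', c', d} : Finset G), y ≠ v :=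
    fun v hv h' => hnU v hv (h' ▸ hy)
  have hxB := hUB x hx
  have hyB := hUB y hy
  have hlx : l ≠ x := fun h' => hxB (h' ▸ hl)
  have hly : l ≠ y := fun h' => hyB (h' ▸ hl)
  simp only [Finset.mem_insert, Finset.mem_singleton, forall_eq_or_imp, forall_eq] at hnew hnB hn0
  simp only [Finset.mem_insert, Finset.mem_singleton, forall_eq_or_imp, forall_eq] at hnl hnx hny
  simp only [List.nodup_cons, List.mem_cons, List.not_mem_nil, or_false, not_or, not_false_eq_true,
    List.nodup_nil, and_true] at hnd
  obtain ⟨⟨n1, n2, n3, n4, n5⟩, ⟨n6, n7, n8, n9⟩, ⟨n10, n11, n12⟩, ⟨n13, n14⟩, n15⟩ := hnd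
  obtain ⟨w1, w2, w3, w4, w5, w6⟩ := hnew
  obtain ⟨b1, b2, b3, b4, b5, b6⟩ := hnB
  obtain ⟨z1, z2, z3, z4, z5, z6⟩ := hn0
  obtain ⟨l1, l2, l3, l4, l5, l6⟩ := hnl
  obtain ⟨x1, x2, x3, x4, x5, x6⟩ := hnx
  obtain ⟨y1, y2, y3, y4, y5, y6⟩ := hny
  have hF : ∀ v, v ∉ Bad → v ∉ f₁ ∧ v ∉ f₂ ∧ v ∉ f₃ := fun v hv =>
    ⟨fun h' => hv (hf₁ h'), fun h' => hv (hf₂ h'), fun h' => hv (hf₃ h')⟩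
  have hx0 : x ≠ 0 := fun h' => hxB (h' ▸ h0)
  have hy0 : y ≠ 0 := fun h' => hyB (h' ▸ h0)
  have B₁ := B.ok_block F₁ hl0 z2 z3 (fun h' => w2 (hb₁ h')) e₁ l2 l3 n6 hlf₁ (hF _ b2).1
    (hF _ b3).1
  have B₂ := B.ok_block F₂ hx0 z1 z5 (fun h' => w1 (hb₂ h')) e₂ x1 x5 n4 (hF _ hxB).2.1
    (hF _ b1).2.1 (hF _ b5).2.1
  have B₃ := B.ok_block F₃ hy0 z4 z6 (fun h' => w4 (hb₃ h')) e₃ y4 y6 n14 (hF _ hyB).2.2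
    (hF _ b4).2.2 (hF _ b6).2.2
  have hdis : Tiles B.OK (insert l (insert a' (insert b f₁)) ∪ insert x (insert a (insert c' f₂)) ∪
      insert y (insert b' (insert d f₃))) := by
    refine (Tiles.union (Tiles.of_ok B₁) (Tiles.of_ok B₂) ?_).union (Tiles.of_ok B₃) ?_
    · simp only [Finset.disjoint_insert_left, Finset.disjoint_insert_right, Finset.mem_insert,
        not_or]
      exact ⟨⟨hlx.symm, x2, x3, (hF _ hxB).1⟩, ⟨l1.symm, n1, n2, (hF _ b1).1⟩,
        ⟨l5.symm, Ne.symm n8, Ne.symm n11, (hF _ b5).1⟩, hlf₂, (hF _ b2).2.1, (hF _ b3).2.1, h12⟩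
    · simp only [Finset.disjoint_insert_left, Finset.disjoint_insert_right, Finset.mem_insert,
        Finset.mem_union, Finset.disjoint_union_left, not_or]
      exact ⟨⟨⟨hly.symm, y2, y3, (hF _ hyB).1⟩, hxy.symm, y1, y5, (hF _ hyB).2.1⟩,
        ⟨⟨l4.symm, Ne.symm n7, Ne.symm n10, (hF _ b4).1⟩, x4.symm, Ne.symm n3, n13, (hF _ b4).2.1⟩,
        ⟨⟨l6.symm, Ne.symm n9, Ne.symm n12, (hF _ b6).1⟩, x6.symm, Ne.symm n5, Ne.symm n15,
          (hF _ b6).2.1⟩,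
        ⟨hlf₃, (hF _ b2).2.2, (hF _ b3).2.2, h13⟩, (hF _ hxB).2.2, (hF _ b1).2.2, (hF _ b5).2.2,
          h23⟩
  convert hdis using 1
  ext v
  simp only [Finset.mem_union, Finset.mem_insert, Finset.mem_singleton]
  clear * -
  tauto

theorem nodup_mirrored {G : Type} [AddCommGroup G] {s : G} {w : Fin 4 → G}
    (h₁ : ∀ i j, i ≠ j → w i ≠ w j ∧ s - w i ≠ s - w j) (h₂ : ∀ i j, w i ≠ s - w j) :
    [w 0, s - w 0, w 1, s - w 1, w 2, s - w 2, w 3, s - w 3].Nodup := by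
  have h₃ : ∀ i j, s - w i ≠ w j := fun i j => (h₂ j i).symm
  simp only [List.nodup_cons, List.mem_cons, List.not_mem_nil, or_false, not_or, not_false_eq_true,
    List.nodup_nil, and_true]
  refine ⟨⟨?_, ?_, ?_, ?_, ?_, ?_, ?_⟩, ⟨?_, ?_, ?_, ?_, ?_, ?_⟩, ⟨?_, ?_, ?_, ?_, ?_⟩,
    ⟨?_, ?_, ?_, ?_⟩, ⟨?_, ?_, ?_⟩, ⟨?_, ?_⟩, ?_⟩ <;>
  first
  | exact h₂ _ _
  | exact h₃ _ _
  | exact (h₁ _ _ (by decide)).1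
  | exact (h₁ _ _ (by decide)).2

theorem PartialCover.step {κ : ℕ} (hC : Supply C κ) (hs : s ≠ 0)
    (hs2 : (∀ x, x + x ≠ s) ∨ DoublingInjective G) (h0 : (0 : G) ∈ Bad) {T U : Finset G}
    {x y z : G} (hT : T ⊆ Bad) (h : B.PartialCover C Bad s T U x y z) {l : G}
    {f₁ f₂ f₃ : Finset G} (hl : l ∈ Bad) (hl0 : l ≠ 0) (hf₁ : f₁ ⊆ Bad) (hf₂ : f₂ ⊆ Bad)
    (hf₃ : f₃ ⊆ Bad) (F₁ : B.Filler f₁) (F₂ : B.Filler f₂) (F₃ : B.Filler f₃)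
    (hlf₁ : l ∉ f₁) (hlf₂ : l ∉ f₂) (hlf₃ : l ∉ f₃)
    (h12 : Disjoint f₁ f₂) (h13 : Disjoint f₁ f₃) (h23 : Disjoint f₂ f₃)
    (hTd : Disjoint T (insert l (f₁ ∪ f₂ ∪ f₃))) {κ₂ κ₃ κ₄ : G}
    (hκ₂ : κ₂ = l + s + s - B.δ f₁) (hκ₃ : κ₃ = x + s - B.δ f₂)
    (hκ₄ : κ₄ = κ₂ + y + s - B.δ f₃)
    (hκ : ∀ i j : Fin 4, i ≠ j → Disjoint (mirrorPair s ((![0, κ₂, κ₃, κ₄] : Fin 4 → G) i))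
      (mirrorPair s ((![0, κ₂, κ₃, κ₄] : Fin 4 → G) j)))
    {Bad' : Finset G} (hB : Bad ⊆ Bad') (hBU : U ⊆ Bad') (hb₁ : B.bad l f₁ ⊆ Bad')
    (hb₂ : B.bad x f₂ ⊆ Bad') (hb₃ : B.bad y f₃ ⊆ Bad') (hcard : Bad'.card ≤ κ) :
    ∃ U' c d, B.PartialCover C Bad s (T ∪ insert l (f₁ ∪ f₂ ∪ f₃)) U' z c d ∧
      U'.card = U.card + 8 ∧ c ∉ Bad' ∧ d ∉ Bad' := by
  have hα : ∀ i, mirrorPair s ((![0, s - κ₂, κ₃, s - κ₄] : Fin 4 → G) i) =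
      mirrorPair s ((![0, κ₂, κ₃, κ₄] : Fin 4 → G) i) := by
    intro i
    fin_cases i
    · rfl
    · exact mirrorPair_sub _ _
    · rfl
    · exact mirrorPair_sub _ _
  obtain ⟨t, m1, m2, m3⟩ := hC.exists_mirrored hs hs2 (a := ![0, s - κ₂, κ₃, s - κ₄])
    (fun i j hij => by rw [hα, hα]; exact hκ i j hij) hcard
  have hnod := nodup_mirrored m2 m3
  have ea : t + (![0, s - κ₂, κ₃, s - κ₄] : Fin 4 → G) 0 = t := by simp
  have eb : t + (![0, s - κ₂, κ₃, s - κ₄] : Fin 4 → G) 1 = t + (s - κ₂) := by simp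
  have ec : t + (![0, s - κ₂, κ₃, s - κ₄] : Fin 4 → G) 2 = t + κ₃ := by simp
  have ed : t + (![0, s - κ₂, κ₃, s - κ₄] : Fin 4 → G) 3 = t + (s - κ₄) := by simp
  have ma := m1 0
  have mb := m1 1
  have mc := m1 2
  have md := m1 3
  rw [ea, eb, ec, ed] at hnod
  rw [ea] at ma
  rw [eb] at mb
  rw [ec] at mc
  rw [ed] at md
  obtain ⟨b, hb⟩ : ∃ b, b = t + (s - κ₂) := ⟨_, rfl⟩
  obtain ⟨c, hc⟩ : ∃ c, c = t + κ₃ := ⟨_, rfl⟩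
  obtain ⟨d, hd⟩ : ∃ d, d = t + (s - κ₄) := ⟨_, rfl⟩
  have e₁ : l + (s - t) + b = B.δ f₁ := by rw [hb, hκ₂]; abel
  have e₂ : x + t + (s - c) = B.δ f₂ := by rw [hc, hκ₃]; abel
  have e₃ : y + (s - b) + d = B.δ f₃ := by rw [hd, hκ₄, hb]; abel
  rw [← hb, ← hc, ← hd] at hnod
  rw [← hb] at mb
  rw [← hc] at mc
  rw [← hd] at md
  clear hb hc hd ea eb ec ed m1 m2 m3 hα hκ
  set E : Finset G := {t, s - t, b, s - b, c, s - c, d, s - d} with hE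
  have hEl : E = [t, s - t, b, s - b, c, s - c, d, s - d].toFinset := by simp [hE]
  have hEB : ∀ v ∈ E, v ∈ C \ Bad' := by
    intro v hv
    simp only [hE, Finset.mem_insert, Finset.mem_singleton] at hv
    rcases hv with rfl | rfl | rfl | rfl | rfl | rfl | rfl | rfl
    exacts [ma.1, ma.2, mb.1, mb.2, mc.1, mc.2, md.1, md.2]
  have hEU : ∀ v ∈ E, v ∉ U := fun v hv h' => (Finset.mem_sdiff.1 (hEB v hv)).2 (hBU h')
  have hUE : Disjoint U E := by
    rw [Finset.disjoint_right]; exact hEU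
  have hEcard : E.card = 8 := by
    rw [hEl, List.toFinset_card_of_nodup hnod]; rfl
  have hsub6 : ∀ v ∈ ({t, s - t, b, s - b, s - c, d} : Finset G), v ∈ E := by
    exact fun v hv => Finset.six_subset_eight hv
  have hnod6 : [t, s - t, b, s - b, s - c, d].Nodup := by
    refine List.Nodup.sublist ?_ hnod
    refine List.Sublist.cons_cons _ (List.Sublist.cons_cons _ (List.Sublist.cons_cons _
      (List.Sublist.cons_cons _ (List.Sublist.cons _ (List.Sublist.cons_cons _
      (List.Sublist.cons_cons _ (List.Sublist.cons _ (List.Sublist.refl _))))))))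
  have hne : (∀ v ∈ ({t, s - t, b, s - b, s - c, d} : Finset G), v ≠ c) ∧
      (∀ v ∈ ({t, s - t, b, s - b, s - c, d} : Finset G), v ≠ s - d) ∧ c ≠ s - d := by
    simp only [List.nodup_cons, List.mem_cons, List.not_mem_nil, or_false, not_or,
      not_false_eq_true, List.nodup_nil, and_true] at hnod
    obtain ⟨⟨n1, n2, n3, n4, n5, n6, n7⟩, ⟨n8, n9, n10, n11, n12, n13⟩, ⟨n14, n15, n16, n17, n18⟩,
      ⟨n19, n20, n21, n22⟩, ⟨n23, n24, n25⟩, ⟨n26, n27⟩, n28⟩ := hnod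
    simp only [Finset.mem_insert, Finset.mem_singleton, forall_eq_or_imp, forall_eq]
    exact ⟨⟨n4, n10, n15, n19, Ne.symm n23, Ne.symm n24⟩, ⟨n7, n13, n18, n22, n27, n28⟩, n25⟩
  have hUB : ∀ v ∈ U, v ∉ Bad := fun v hv => (Finset.mem_sdiff.1 (h.subset hv)).2
  have htile := B.tiles_three_blocks h0 hl hl0 hf₁ hf₂ hf₃ F₁ F₂ F₃ hlf₁ hlf₂ hlf₃ h12 h13 h23
    hUB h.hx h.hy h.hxy hB hBU hb₁ hb₂ hb₃
    (fun v hv => (Finset.mem_sdiff.1 (hEB v (hsub6 v hv))).2) hnod6 e₁ e₂ e₃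
  have hexch := Finset.union_sdiff_of_exchange h.hx h.hy h.hz h.hxz h.hyz hEU hne.1 hne.2.1
  have hcE : c ∈ E := by simp [hE]
  have hdE : s - d ∈ E := by simp [hE]
  refine ⟨U ∪ E, c, s - d, ⟨?_, ?_, Finset.mem_union_left _ h.hz, Finset.mem_union_right _ hcE,
    Finset.mem_union_right _ hdE, ?_, ?_, hne.2.2, ?_⟩, ?_, (Finset.mem_sdiff.1 (hEB _ hcE)).2,
    (Finset.mem_sdiff.1 (hEB _ hdE)).2⟩
  · refine Finset.union_subset h.subset fun v hv => ?_
    have := Finset.mem_sdiff.1 (hEB v hv)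
    exact Finset.mem_sdiff.2 ⟨this.1, fun h' => this.2 (hB h')⟩
  · intro v hv
    rcases Finset.mem_union.1 hv with hv | hv
    · exact ⟨Finset.mem_union_left _ (h.mirror v hv).1, (h.mirror v hv).2⟩
    · have hn : ∀ w : G, w ≠ s - w → s - w ≠ s - (s - w) := fun w hw h' =>
        hw (by rw [sub_sub_cancel] at h'; exact h'.symm)
      simp only [List.nodup_cons, List.mem_cons, not_or] at hnod
      have n1 := hnod.1.1
      have n2 := hnod.2.2.1.1
      have n3 := hnod.2.2.2.2.1.1
      have n4 := hnod.2.2.2.2.2.2.1.1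
      simp only [hE, Finset.mem_insert, Finset.mem_singleton] at hv
      rcases hv with rfl | rfl | rfl | rfl | rfl | rfl | rfl | rfl
      · exact ⟨Finset.mem_union_right _ (by simp [hE]), n1⟩
      · exact ⟨Finset.mem_union_right _ (by simp [hE]), hn _ n1⟩
      · exact ⟨Finset.mem_union_right _ (by simp [hE]), n2⟩
      · exact ⟨Finset.mem_union_right _ (by simp [hE]), hn _ n2⟩
      · exact ⟨Finset.mem_union_right _ (by simp [hE]), n3⟩
      · exact ⟨Finset.mem_union_right _ (by simp [hE]), hn _ n3⟩
      · exact ⟨Finset.mem_union_right _ (by simp [hE]), n4⟩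
      · exact ⟨Finset.mem_union_right _ (by simp [hE]), hn _ n4⟩
  · exact fun h' => hEU c hcE (h' ▸ h.hz)
  · exact fun h' => hEU _ hdE (h' ▸ h.hz)
  · rw [hexch]
    have := h.tiles.union htile ?_
    · rw [Finset.union_assoc, Finset.union_left_comm (U \ {x, y, z}), ← Finset.union_assoc] at this
      rwa [Finset.union_assoc] at this ⊢
    · have hUd : ∀ v ∈ U, v ∉ insert l (f₁ ∪ f₂ ∪ f₃) := by
        intro v hv h'
        apply hUB v hv
        rcases Finset.mem_insert.1 h' with rfl | h'
        · exact hl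
        · rcases Finset.mem_union.1 h' with h' | h'
          · rcases Finset.mem_union.1 h' with h' | h'
            exacts [hf₁ h', hf₂ h']
          · exact hf₃ h'
      rw [Finset.disjoint_union_left, Finset.disjoint_union_right, Finset.disjoint_union_right,
        Finset.disjoint_union_right, Finset.disjoint_union_right]
      refine ⟨⟨hTd, ?_, ?_⟩, ?_, ?_, ?_⟩
      · rw [Finset.disjoint_right]
        intro v hv hvT
        simp only [Finset.mem_insert, Finset.mem_singleton] at hv
        rcases hv with rfl | rfl
        exacts [hUB _ h.hx (hT hvT), hUB _ h.hy (hT hvT)]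
      · rw [Finset.disjoint_right]
        exact fun v hv hvT => (Finset.mem_sdiff.1 (hEB v (hsub6 v hv))).2 (hB (hT hvT))
      · rw [Finset.disjoint_left]
        exact fun v hv => hUd v (Finset.mem_sdiff.1 hv).1
      · rw [Finset.disjoint_left]
        intro v hv hv'
        apply (Finset.mem_sdiff.1 hv).2
        exact Finset.pair_subset_triple hv'
      · rw [Finset.disjoint_left]
        exact fun v hv hv' => hEU v (hsub6 v hv') (Finset.mem_sdiff.1 hv).1
  · rw [Finset.card_union_of_disjoint hUE, hEcard]

end BlockSystem

namespace BlockSystem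

variable {G : Type} [AddCommGroup G] [DecidableEq G] (B : BlockSystem G)

theorem _root_.Supply.exists_two_mirrored {C : Finset G} {κ : ℕ}
    (h : Supply C κ) {s : G} (hs : s ≠ 0) (hs2 : (∀ x, x + x ≠ s) ∨ DoublingInjective G)
    {q : G} (hq : q ≠ 0) (hqs : q ≠ s) {Bad : Finset G} (hBad : Bad.card ≤ κ) :
    ∃ y z, y + z = q ∧ (∀ v ∈ ({y, s - y, z, s - z} : Finset G), v ∈ C \ Bad) ∧
      y ≠ s - y ∧ y ≠ z ∧ y ≠ s - z ∧ s - y ≠ z ∧ s - y ≠ s - z ∧ z ≠ s - z := by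
  have e : ∀ i, s - (![0, s - q, 0, 0] : Fin 4 → G) i = (![s, q, s, s] : Fin 4 → G) i := by
    intro i
    fin_cases i <;> simp
  obtain ⟨t, h1, -, h3, h4⟩ := h ![0, s - q, 0, 0] ![s, q, s, s] (fun _ => s) (by
    intro i j
    fin_cases i <;> fin_cases j <;> simp [hs.symm, hq, hq.symm]
    rcases hs2 with hs2 | hs2
    · left
      intro h'
      apply hs2 q
      nth_rw 1 [← h']
      abel
    · exact Or.inr hs2) (fun _ => Or.inl hs) Bad hBad
  have a0 := h3 0
  have a1 := h3 1
  have b0 := h4 0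
  have b1 := h4 1
  have c00 := h1 0 0
  have c01 := h1 0 1
  have c10 := h1 1 0
  have c11 := h1 1 1
  simp only [Matrix.cons_val_zero, Matrix.cons_val_one, add_zero] at a0 a1 b0 b1 c00 c01 c10 c11
  have e1 : t + (s - q) = s - (q - t) := by abel
  rw [e1] at a1 c10 c11
  refine ⟨t, q - t, by abel, ?_, c00, c01, ?_, ?_, c10.symm, c11.symm⟩
  · intro v hv
    simp only [Finset.mem_insert, Finset.mem_singleton] at hv
    rcases hv with rfl | rfl | rfl | rfl <;> assumption
  · intro h'
    apply hqs
    have := sub_eq_zero.2 h'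
    refine sub_eq_zero.1 ?_
    rw [← this]
    abel
  · intro h'
    apply hqs
    have := sub_eq_zero.2 h'
    refine sub_eq_zero.1 ?_
    rw [← neg_eq_zero, ← this]
    abel

section

variable (s : G) (l : ℕ → G) (F : ℕ → Fin 3 → Finset G)

/-- The part to be tiled in the `j`-th step of the cover. -/
def coverPart (j : ℕ) : Finset G := insert (l j) (F j 0 ∪ F j 1 ∪ F j 2)

/-- The shift of the `j`-th step of the cover. -/
def coverShift (j : ℕ) : G := l j + s + s - B.δ (F j 0)

/-- Values that the oldest remaining element must avoid. -/
def coverAvoid₁ (j : ℕ) : Finset G :=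
  (mirrorPair s 0 ∪ mirrorPair s (B.coverShift s l F j)).image fun v => v - s + B.δ (F j 1)

/-- Values that the second oldest remaining element must avoid. -/
def coverAvoid₂ (j : ℕ) (x : G) : Finset G :=
  (mirrorPair s 0 ∪ mirrorPair s (B.coverShift s l F j) ∪
    mirrorPair s (x + s - B.δ (F j 1))).image
    fun v => v - B.coverShift s l F j - s + B.δ (F j 2)

theorem card_coverAvoid₁_le (j : ℕ) : (B.coverAvoid₁ s l F j).card ≤ 2 + 2 :=
  Finset.card_image_le.trans
    (Finset.card_union_le_add (card_mirrorPair_le _ _) (card_mirrorPair_le _ _))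

theorem card_coverAvoid₂_le (j : ℕ) (x : G) : (B.coverAvoid₂ s l F j x).card ≤ 2 + 2 + 2 :=
  Finset.card_image_le.trans (Finset.card_union_le_add
    (Finset.card_union_le_add (card_mirrorPair_le _ _) (card_mirrorPair_le _ _))
    (card_mirrorPair_le _ _))

/-- Compatibility conditions for the data of a cover. -/
structure CoverData (Bad : Finset G) (J : ℕ) (F₀ F₁ : Finset G) : Prop where
  l_mem : ∀ j < J, l j ∈ Bad
  l_ne : ∀ j < J, l j ≠ 0
  filler : ∀ j < J, ∀ i, B.Filler (F j i)
  subset : ∀ j < J, ∀ i, F j i ⊆ Bad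
  l_notMem : ∀ j < J, ∀ i, l j ∉ F j i
  disjoint : ∀ j < J, ∀ i i', i ≠ i' → Disjoint (F j i) (F j i')
  disjoint_part : ∀ j < J, ∀ j' < j, Disjoint (coverPart l F j') (coverPart l F j)
  disjoint₀ : ∀ j < J, Disjoint F₀ (coverPart l F j)
  filler₀ : B.Filler F₀
  subset₀ : F₀ ⊆ Bad
  shift : ∀ j < J, B.coverShift s l F j ∉ mirrorPair s 0

end

variable {C Bad : Finset G} {s : G} {l : ℕ → G} {F : ℕ → Fin 3 → Finset G} {F₀ F₁ : Finset G}
  {κ J : ℕ}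

theorem exists_cover_start (hC : Supply C κ) (hs : s ≠ 0)
    (hs2 : (∀ x, x + x ≠ s) ∨ DoublingInjective G) (h0 : (0 : G) ∈ Bad) (hF₀ : B.Filler F₀)
    (hF₀B : F₀ ⊆ Bad) (X₀ X₁ : Finset G) (cX₀ : X₀.card ≤ 4) (cX₁ : X₁.card ≤ 4)
    (Y : G → Finset G) (cY : ∀ x, (Y x).card ≤ 26) (hκ : Bad.card + 100 ≤ κ) :
    ∃ U x y z, B.PartialCover C Bad s F₀ U x y z ∧ U.card = 6 ∧ x ∉ X₀ ∧ z ∉ X₁ ∧ y ∉ Y x := by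
  obtain ⟨x, hx, hx', hxx, -, -⟩ := hC.exists_pair hs (Or.inl hs) (Or.inl hs)
    (Bad := Bad ∪ X₀ ∪ {s + s + s - B.δ F₀, s + s - B.δ F₀}) (by
      have : (Bad ∪ X₀ ∪ {s + s + s - B.δ F₀, s + s - B.δ F₀}).card ≤ Bad.card + 4 + 2 :=
        Finset.card_union_le_add (Finset.card_union_le_add le_rfl cX₀) Finset.card_le_two
      omega)
  simp only [Finset.mem_sdiff, Finset.mem_union, Finset.mem_insert, Finset.mem_singleton, not_or]
    at hx hx'
  obtain ⟨hxC, ⟨hxB, hxX⟩, hx3, hx2⟩ := hx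
  obtain ⟨hxC', ⟨hxB', -⟩, -⟩ := hx'
  obtain ⟨y, z, hq, hyz, n1, n2, n3, n4, n5, n6⟩ := hC.exists_two_mirrored hs hs2
    (q := s + s + s - B.δ F₀ - x) (fun h' => hx3 (sub_eq_zero.1 h').symm) (by
      intro h'
      apply hx2
      have := sub_eq_zero.2 h'
      refine sub_eq_zero.1 ?_
      rw [← neg_eq_zero, ← this]
      abel) (Bad := Bad ∪ {x, s - x} ∪ B.bad (s - x) F₀ ∪ Y x ∪ X₁) (by
      have : (Bad ∪ {x, s - x} ∪ B.bad (s - x) F₀ ∪ Y x ∪ X₁).card ≤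
          Bad.card + 2 + 20 + 26 + 4 :=
        Finset.card_union_le_add (Finset.card_union_le_add (Finset.card_union_le_add
          (Finset.card_union_le_add le_rfl Finset.card_le_two) (B.card_bad _ _)) (cY x)) cX₁
      omega)
  simp only [Finset.mem_insert, Finset.mem_singleton, forall_eq_or_imp, forall_eq,
    Finset.mem_sdiff, Finset.mem_union, not_or] at hyz
  obtain ⟨⟨yC, ⟨⟨⟨yB, yx, yx'⟩, -⟩, yY⟩, yX₁⟩, ⟨yC', ⟨⟨⟨yB', yx1, yx1'⟩, ybad⟩, yY'⟩, yX₁'⟩,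
    ⟨zC, ⟨⟨⟨zB, zx, zx'⟩, -⟩, zY⟩, zX₁⟩, ⟨zC', ⟨⟨⟨zB', zx1, zx1'⟩, -⟩, zY'⟩, zX₁'⟩⟩ := hyz
  have hnF : ∀ v, v ∉ Bad → v ∉ F₀ := fun v hv h' => hv (hF₀B h')
  have hn0 : ∀ v, v ∉ Bad → v ≠ 0 := fun v hv h' => hv (h' ▸ h0)
  have hok := B.ok_block hF₀ (hn0 _ hxB') (hn0 _ yB') (hn0 _ zB') ybad (by
    have e : s - x + (s - y) + (s - z) = s + s + s - x - (y + z) := by abel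
    rw [e, hq]
    abel) (Ne.symm yx1') (Ne.symm zx1') n5 (hnF _ hxB') (hnF _ yB') (hnF _ zB')
  have hnod : [x, s - x, y, s - y, z, s - z].Nodup := by
    simp only [List.nodup_cons, List.mem_cons, List.not_mem_nil, or_false, not_or,
      not_false_eq_true, List.nodup_nil, and_true]
    exact ⟨⟨hxx, Ne.symm yx, Ne.symm yx1, Ne.symm zx, Ne.symm zx1⟩,
      ⟨Ne.symm yx', Ne.symm yx1', Ne.symm zx', Ne.symm zx1'⟩, ⟨n1, n2, n3⟩, ⟨n4, n5⟩, n6⟩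
  have hE : ({x, s - x, y, s - y, z, s - z} : Finset G) =
      [x, s - x, y, s - y, z, s - z].toFinset := by simp
  have hn : ∀ w : G, w ≠ s - w → s - w ≠ s - (s - w) := fun w hw h' =>
        hw (by rw [sub_sub_cancel] at h'; exact h'.symm)
  refine ⟨{x, s - x, y, s - y, z, s - z}, x, y, z, ⟨?_, ?_, by simp, by simp, by simp, Ne.symm yx,
    Ne.symm zx, n2, ?_⟩, ?_, hxX, zX₁, yY⟩
  · intro v hv
    simp only [Finset.mem_insert, Finset.mem_singleton] at hv
    rcases hv with rfl | rfl | rfl | rfl | rfl | rfl <;> rw [Finset.mem_sdiff] <;>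
      constructor <;> assumption
  · intro v hv
    simp only [Finset.mem_insert, Finset.mem_singleton] at hv
    rcases hv with rfl | rfl | rfl | rfl | rfl | rfl
    · exact ⟨by simp, hxx⟩
    · exact ⟨by simp, hn _ hxx⟩
    · exact ⟨by simp, n1⟩
    · exact ⟨by simp, hn _ n1⟩
    · exact ⟨by simp, n6⟩
    · exact ⟨by simp, hn _ n6⟩
  · convert Tiles.of_ok hok using 1
    ext v
    simp only [Finset.mem_union, Finset.mem_sdiff, Finset.mem_insert, Finset.mem_singleton]
    have v1 : v = s - x → v ≠ x ∧ v ≠ y ∧ v ≠ z := by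
      rintro rfl; exact ⟨hxx.symm, Ne.symm yx', Ne.symm zx'⟩
    have v2 : v = s - y → v ≠ x ∧ v ≠ y ∧ v ≠ z := by
      rintro rfl; exact ⟨yx1, n1.symm, n4⟩
    have v3 : v = s - z → v ≠ x ∧ v ≠ y ∧ v ≠ z := by
      rintro rfl; exact ⟨zx1, n3.symm, n6.symm⟩
    clear * - v1 v2 v3
    tauto
  · rw [hE, List.toFinset_card_of_nodup hnod]; rfl

theorem disjoint_four_mirrorPairs {a b c d : G}
    (hab : b ∉ mirrorPair s a) (hac : c ∉ mirrorPair s a)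
    (had : d ∉ mirrorPair s a) (hbc : c ∉ mirrorPair s b) (hbd : d ∉ mirrorPair s b)
    (hcd : d ∉ mirrorPair s c) (i j : Fin 4) (hij : i ≠ j) :
    Disjoint (mirrorPair s ((![a, b, c, d] : Fin 4 → G) i))
      (mirrorPair s ((![a, b, c, d] : Fin 4 → G) j)) := by
  have key : ∀ v w : G, w ∉ mirrorPair s v → Disjoint (mirrorPair s v) (mirrorPair s w) ∧
      Disjoint (mirrorPair s w) (mirrorPair s v) := by
    intro v w h
    rw [disjoint_comm (a := mirrorPair s w), and_self]
    by_contra h'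
    apply h
    rw [mem_mirrorPair]
    rcases mem_of_mirrorPair_inter h' with rfl | rfl
    · exact Or.inl rfl
    · right; rw [sub_sub_cancel]
  fin_cases i <;> fin_cases j <;> first | exact absurd rfl hij | skip
  exacts [(key _ _ hab).1, (key _ _ hac).1, (key _ _ had).1, (key _ _ hab).2, (key _ _ hbc).1,
    (key _ _ hbd).1, (key _ _ hac).2, (key _ _ hbc).2, (key _ _ hcd).1, (key _ _ had).2,
    (key _ _ hbd).2, (key _ _ hcd).2]

theorem exists_partialCover (hC : Supply C κ) (hs : s ≠ 0)
    (hs2 : (∀ x, x + x ≠ s) ∨ DoublingInjective G) (h0 : (0 : G) ∈ Bad)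
    (hD : B.CoverData s l F Bad J F₀ F₁) (hκ : Bad.card + 8 * J + 200 ≤ κ) :
    ∀ j ≤ J, ∃ U x y z,
      B.PartialCover C Bad s (F₀ ∪ (Finset.range j).biUnion (coverPart l F)) U x y z ∧
      U.card = 6 + 8 * j ∧ x ∉ B.coverAvoid₁ s l F j ∧ z ∉ B.coverAvoid₁ s l F (j + 1) ∧
      y ∉ B.coverAvoid₂ s l F j x ∪ B.bad x F₁ := by
  have cY : ∀ j x, (B.coverAvoid₂ s l F j x ∪ B.bad x F₁).card ≤ 26 := fun j x =>
    (Finset.card_union_le_add (B.card_coverAvoid₂_le s l F j x) (B.card_bad x F₁))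
  have hPart : ∀ j < J, coverPart l F j ⊆ Bad := by
    intro j hj
    refine Finset.insert_subset (hD.l_mem j hj) (Finset.union_subset (Finset.union_subset ?_ ?_) ?_)
    exacts [hD.subset j hj 0, hD.subset j hj 1, hD.subset j hj 2]
  intro j
  induction j with
  | zero =>
    intro _
    obtain ⟨U, x, y, z, h1, h2, h3, h4, h5⟩ := B.exists_cover_start hC hs hs2 h0 hD.filler₀
      hD.subset₀ _ _ (B.card_coverAvoid₁_le s l F 0) (B.card_coverAvoid₁_le s l F 1)
      (fun x => B.coverAvoid₂ s l F 0 x ∪ B.bad x F₁) (cY 0) (by omega)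
    exact ⟨U, x, y, z, by simpa using h1, h2, h3, h4, h5⟩
  | succ j ih =>
    intro hj
    obtain ⟨U, x, y, z, h1, h2, h3, h4, h5⟩ := ih (by omega)
    have hjJ : j < J := by omega
    set Bad' := Bad ∪ U ∪ B.bad (l j) (F j 0) ∪ B.bad x (F j 1) ∪ B.bad y (F j 2) ∪
      (B.coverAvoid₂ s l F (j + 1) z ∪ B.bad z F₁) ∪ B.coverAvoid₁ s l F (j + 2) with hBad'
    have cBad' : Bad'.card ≤ Bad.card + (6 + 8 * j) + 20 + 20 + 20 + 26 + 4 :=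
      Finset.card_union_le_add (Finset.card_union_le_add (Finset.card_union_le_add
        (Finset.card_union_le_add (Finset.card_union_le_add (Finset.card_union_le_add le_rfl h2.le)
        (B.card_bad _ _)) (B.card_bad _ _)) (B.card_bad _ _)) (cY _ _))
        (B.card_coverAvoid₁_le s l F (j + 2))
    have hk2 := hD.shift j hjJ
    have hk3 : x + s - B.δ (F j 1) ∉ mirrorPair s 0 ∪ mirrorPair s (B.coverShift s l F j) :=
      fun h' => h3 (Finset.mem_image.2 ⟨_, h', by abel⟩)
    have hk4 : B.coverShift s l F j + y + s - B.δ (F j 2) ∉ mirrorPair s 0 ∪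
        mirrorPair s (B.coverShift s l F j) ∪ mirrorPair s (x + s - B.δ (F j 1)) :=
      fun h' => h5 (Finset.mem_union_left _ (Finset.mem_image.2 ⟨_, h', by abel⟩))
    simp only [Finset.mem_union, not_or] at hk3 hk4
    obtain ⟨U', c, d, g1, g2, g3, g4⟩ := PartialCover.step B hC hs hs2 h0 (Finset.union_subset
      hD.subset₀ (Finset.biUnion_subset.2 fun i hi => hPart i (by
        have := Finset.mem_range.1 hi; omega))) h1 (hD.l_mem j hjJ) (hD.l_ne j hjJ)
      (hD.subset j hjJ 0) (hD.subset j hjJ 1) (hD.subset j hjJ 2) (hD.filler j hjJ 0)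
      (hD.filler j hjJ 1) (hD.filler j hjJ 2) (hD.l_notMem j hjJ 0) (hD.l_notMem j hjJ 1)
      (hD.l_notMem j hjJ 2) (hD.disjoint j hjJ 0 1 (by decide)) (hD.disjoint j hjJ 0 2 (by decide))
      (hD.disjoint j hjJ 1 2 (by decide)) (by
        rw [Finset.disjoint_union_left]
        refine ⟨hD.disjoint₀ j hjJ, (Finset.disjoint_biUnion_left _ _ _).2 fun i hi =>
          hD.disjoint_part j hjJ i (Finset.mem_range.1 hi)⟩)
      (κ₂ := B.coverShift s l F j) rfl rfl rfl
      (disjoint_four_mirrorPairs hk2 hk3.1 hk4.1.1 hk3.2 hk4.1.2 hk4.2) (Bad' := Bad')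
      (by intro v hv; simp [hBad', hv]) (by intro v hv; simp [hBad', hv])
      (by intro v hv; simp [hBad', hv]) (by intro v hv; simp [hBad', hv])
      (by intro v hv; simp [hBad', hv]) (by omega)
    refine ⟨U', z, c, d, ?_, by omega, h4, fun h' => g4 (Finset.mem_union_right _ h'), fun h' =>
      g3 (Finset.mem_union_left _ (Finset.mem_union_right _ h'))⟩
    rw [Finset.range_add_one, Finset.biUnion_insert, Finset.union_comm (coverPart l F j),
      ← Finset.union_assoc]
    exact g1

theorem exists_cover (hC : Supply C κ) (hs : s ≠ 0)
    (hs2 : (∀ x, x + x ≠ s) ∨ DoublingInjective G) (h0 : (0 : G) ∈ Bad)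
    (hD : B.CoverData s l F Bad J F₀ F₁) (hF₁ : B.Filler F₁) (hF₁B : F₁ ⊆ Bad)
    (hF₁₀ : Disjoint F₁ F₀) (hF₁d : ∀ j < J, Disjoint F₁ (coverPart l F j))
    (hκ : Bad.card + 8 * J + 200 ≤ κ) :
    ∃ U ⊆ C \ Bad, (∀ v ∈ U, s - v ∈ U ∧ v ≠ s - v) ∧ U.card = 6 + 8 * J ∧ ∀ t : ℕ,
      (∑ v ∈ F₀ ∪ (Finset.range J).biUnion (coverPart l F) ∪ F₁ ∪ U, v = t • B.τ) →
      (F₀ ∪ (Finset.range J).biUnion (coverPart l F) ∪ F₁ ∪ U).card = t * B.k →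
      Tiles B.OK (F₀ ∪ (Finset.range J).biUnion (coverPart l F) ∪ F₁ ∪ U) := by
  obtain ⟨U, x, y, z, h1, h2, -, -, h5⟩ := B.exists_partialCover hC hs hs2 h0 hD hκ J le_rfl
  refine ⟨U, h1.subset, h1.mirror, h2, fun t hsum hcard => ?_⟩
  set T := F₀ ∪ (Finset.range J).biUnion (coverPart l F) with hT
  have hTB : T ⊆ Bad := by
    refine Finset.union_subset hD.subset₀ (Finset.biUnion_subset.2 fun j hj => ?_)
    have hj := Finset.mem_range.1 hj
    refine Finset.insert_subset (hD.l_mem j hj) (Finset.union_subset (Finset.union_subset ?_ ?_) ?_)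
    exacts [hD.subset j hj 0, hD.subset j hj 1, hD.subset j hj 2]
  have hUB : ∀ v ∈ U, v ∉ Bad := fun v hv => (Finset.mem_sdiff.1 (h1.subset hv)).2
  have hTF : Disjoint F₁ T := by
    rw [hT, Finset.disjoint_union_right]
    exact ⟨hF₁₀, (Finset.disjoint_biUnion_right _ _ _).2 fun j hj => hF₁d j (Finset.mem_range.1 hj)⟩
  have hxyz : ∀ v ∈ ({x, y, z} : Finset G), v ∈ U := by
    intro v hv
    simp only [Finset.mem_insert, Finset.mem_singleton] at hv
    rcases hv with rfl | rfl | rfl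
    exacts [h1.hx, h1.hy, h1.hz]
  have hn0 : ∀ v ∈ U, v ≠ 0 := fun v hv h' => hUB v hv (h' ▸ h0)
  have hnF : ∀ v ∈ U, v ∉ F₁ := fun v hv h' => hUB v hv (hF₁B h')
  have hsplit : T ∪ F₁ ∪ U = (T ∪ U \ {x, y, z}) ∪ (insert x (insert y (insert z F₁))) := by
    have : U = U \ {x, y, z} ∪ {x, y, z} := (Finset.sdiff_union_of_subset hxyz).symm
    nth_rw 1 [this]
    ext v
    simp only [Finset.mem_union, Finset.mem_insert, Finset.mem_singleton]
    clear * -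
    tauto
  have hdisj : Disjoint (T ∪ U \ {x, y, z}) (insert x (insert y (insert z F₁))) := by
    have hUT : ∀ v ∈ U, v ∉ T := fun v hv h' => hUB v hv (hTB h')
    simp only [Finset.disjoint_insert_right, Finset.mem_union, Finset.mem_sdiff, Finset.mem_insert,
      Finset.mem_singleton, not_or, not_and, Finset.disjoint_union_left]
    refine ⟨⟨hUT x h1.hx, by simp⟩, ⟨hUT y h1.hy, by simp⟩, ⟨hUT z h1.hz, by simp⟩, hTF.symm, ?_⟩
    rw [Finset.disjoint_left]
    exact fun v hv => hnF v (Finset.mem_sdiff.1 hv).1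
  have hnx : x ∉ insert y (insert z F₁) := by
    simp [h1.hxy, h1.hxz, hnF x h1.hx]
  have hny : y ∉ insert z F₁ := by
    simp [h1.hyz, hnF y h1.hy]
  obtain ⟨q, hq, hqs⟩ := h1.tiles.card_sum (fun _ => B.card_of_ok) (fun _ => B.sum_of_ok)
  rw [hsplit]
  refine h1.tiles.union (Tiles.of_ok (B.ok_block hF₁ (hn0 _ h1.hx) (hn0 _ h1.hy) (hn0 _ h1.hz)
    (fun h' => h5 (Finset.mem_union_right _ h')) ?_ h1.hxy h1.hxz h1.hyz (hnF _ h1.hx)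
    (hnF _ h1.hy) (hnF _ h1.hz))) hdisj
  rw [hsplit, Finset.sum_union hdisj, Finset.sum_insert hnx, Finset.sum_insert hny,
    Finset.sum_insert (hnF z h1.hz), hqs] at hsum
  rw [hsplit, Finset.card_union_of_disjoint hdisj, Finset.card_insert_of_notMem hnx,
    Finset.card_insert_of_notMem hny, Finset.card_insert_of_notMem (hnF z h1.hz), hq,
    B.card_of_filler hF₁] at hcard
  have hk := B.three_le
  rw [mul_comm B.k q] at hcard
  have hkk : q * B.k + B.k = t * B.k := by omega
  have ht : t = q + 1 := by
    have : (q + 1) * B.k = t * B.k := by rw [← hkk]; ring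
    exact (Nat.eq_of_mul_eq_mul_right (by omega) this).symm
  rw [ht, succ_nsmul] at hsum
  have h3 := add_left_cancel hsum
  rw [δ, ← h3]
  abel

end BlockSystem

/-! ### Matchings with prescribed sums -/

/-- A matching of indices `i ∈ I` to elements `y ∈ Y` with `w i - y ∈ Z` and `y ∉ forb i`. -/
structure SumMatching {G : Type} [AddCommGroup G] {ι : Type} (I : Finset ι) (w : ι → G)
    (forb : ι → Finset G) (Y Z : Finset G) (M : Finset (ι × G)) : Prop where
  fst_mem : ∀ e ∈ M, e.1 ∈ I
  snd_mem : ∀ e ∈ M, e.2 ∈ Y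
  sub_mem : ∀ e ∈ M, w e.1 - e.2 ∈ Z
  notMem_forb : ∀ e ∈ M, e.2 ∉ forb e.1
  inj_fst : ∀ e ∈ M, ∀ e' ∈ M, e.1 = e'.1 → e = e'
  inj_snd : ∀ e ∈ M, ∀ e' ∈ M, e.2 = e'.2 → e = e'
  inj_sub : ∀ e ∈ M, ∀ e' ∈ M, w e.1 - e.2 = w e'.1 - e'.2 → e = e'

namespace SumMatching

variable {G : Type} [AddCommGroup G] {ι : Type} {I : Finset ι} {w : ι → G}
  {forb : ι → Finset G} {Y Z : Finset G} {M : Finset (ι × G)}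

theorem empty : SumMatching I w forb Y Z ∅ := by
  constructor <;> simp

theorem mono {M' : Finset (ι × G)} (h : SumMatching I w forb Y Z M) (h' : M' ⊆ M) :
    SumMatching I w forb Y Z M' :=
  ⟨fun e he => h.fst_mem e (h' he), fun e he => h.snd_mem e (h' he),
    fun e he => h.sub_mem e (h' he), fun e he => h.notMem_forb e (h' he),
    fun e he e' he' => h.inj_fst e (h' he) e' (h' he'),
    fun e he e' he' => h.inj_snd e (h' he) e' (h' he'),
    fun e he e' he' => h.inj_sub e (h' he) e' (h' he')⟩

theorem insert (h : SumMatching I w forb Y Z M) {i : ι} {y : G} (hi : i ∈ I) (hy : y ∈ Y)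
    (hz : w i - y ∈ Z) (hf : y ∉ forb i) (h1 : ∀ e ∈ M, e.1 ≠ i) (h2 : ∀ e ∈ M, e.2 ≠ y)
    (h3 : ∀ e ∈ M, w e.1 - e.2 ≠ w i - y) : SumMatching I w forb Y Z (insert (i, y) M) := by
  constructor
  · exact Finset.forall_mem_insert _ _ _ |>.2 ⟨hi, h.fst_mem⟩
  · exact Finset.forall_mem_insert _ _ _ |>.2 ⟨hy, h.snd_mem⟩
  · exact Finset.forall_mem_insert _ _ _ |>.2 ⟨hz, h.sub_mem⟩
  · exact Finset.forall_mem_insert _ _ _ |>.2 ⟨hf, h.notMem_forb⟩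
  · intro e he e' he' hee
    rcases Finset.mem_insert.1 he with rfl | he <;> rcases Finset.mem_insert.1 he' with rfl | he'
    exacts [rfl, absurd hee.symm (h1 _ he'), absurd hee (h1 _ he), h.inj_fst _ he _ he' hee]
  · intro e he e' he' hee
    rcases Finset.mem_insert.1 he with rfl | he <;> rcases Finset.mem_insert.1 he' with rfl | he'
    exacts [rfl, absurd hee.symm (h2 _ he'), absurd hee (h2 _ he), h.inj_snd _ he _ he' hee]
  · intro e he e' he' hee
    rcases Finset.mem_insert.1 he with rfl | he <;> rcases Finset.mem_insert.1 he' with rfl | he'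
    exacts [rfl, absurd hee.symm (h3 _ he'), absurd hee (h3 _ he), h.inj_sub _ he _ he' hee]

theorem card_snd (h : SumMatching I w forb Y Z M) : (M.image Prod.snd).card = M.card :=
  Finset.card_image_of_injOn fun e he e' he' => h.inj_snd e he e' he'

theorem card_sub (h : SumMatching I w forb Y Z M) :
    (M.image fun e => w e.1 - e.2).card = M.card :=
  Finset.card_image_of_injOn fun e he e' he' => h.inj_sub e he e' he'

theorem card_fst (h : SumMatching I w forb Y Z M) : (M.image Prod.fst).card = M.card :=
  Finset.card_image_of_injOn fun e he e' he' => h.inj_fst e he e' he'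

/-- The elements of `S` can be freed by switching along edges at the indices in `D`. -/
structure Freeable (I : Finset ι) (w : ι → G) (forb : ι → Finset G) (Y Z : Finset G)
    (M : Finset (ι × G)) (S : Finset G) (D : Finset ι) : Prop where
  subset : S ⊆ Z
  exists_switch : ∀ z ∈ S, ∃ M', SumMatching I w forb Y Z M' ∧ M'.card = M.card ∧
    (∀ e ∈ M', w e.1 - e.2 ≠ z) ∧ (∀ e ∈ M', e.2 ∈ M.image Prod.snd) ∧
    (∀ e ∈ M', e.1 ∈ M.image Prod.fst ∪ D) ∧ ∀ e ∈ M, w e.1 - e.2 ∉ S → e ∈ M'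

theorem Freeable.of_matching (h : SumMatching I w forb Y Z M) :
    Freeable I w forb Y Z M (Z \ M.image fun e => w e.1 - e.2) ∅ := by
  refine ⟨Finset.sdiff_subset, fun z hz => ⟨M, h, rfl, fun e he hez => ?_, fun e he =>
    Finset.mem_image_of_mem _ he, fun e he => ?_, fun e he _ => he⟩⟩
  · exact (Finset.mem_sdiff.1 hz).2 (Finset.mem_image.2 ⟨e, he, hez⟩)
  · exact Finset.mem_union_left _ (Finset.mem_image_of_mem _ he)

theorem Freeable.step [Nonempty ι] (h : SumMatching I w forb Y Z M)
    (hmax : ∀ M', SumMatching I w forb Y Z M' → M'.card ≤ M.card) {S : Finset G} {D B : Finset ι}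
    (hF : Freeable I w forb Y Z M S D) (hB : B ⊆ I) (hBM : Disjoint B (M.image Prod.fst))
    (hBD : Disjoint B D) (hZS : ∀ z ∈ Z \ M.image fun e => w e.1 - e.2, z ∈ S) :
    ∃ S', Freeable I w forb Y Z M S' (D ∪ B) ∧
      (Y.filter fun y => ∃ i ∈ B, w i - y ∈ S ∧ y ∉ forb i).card +
        (Z \ M.image fun e => w e.1 - e.2).card ≤ S'.card ∧ S ⊆ S' := by
  set U := Y.filter fun y => ∃ i ∈ B, w i - y ∈ S ∧ y ∉ forb i with hU
  have hUM : ∀ y ∈ U, ∃ e ∈ M, e.2 = y := by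
    intro y hy
    by_contra hne
    push Not at hne
    obtain ⟨hyY, i, hi, hz, hf⟩ := Finset.mem_filter.1 hy
    obtain ⟨M', g1, g2, g3, g4, g5, -⟩ := hF.exists_switch _ hz
    have h1 : ∀ e ∈ M', e.1 ≠ i := by
      rintro e he rfl
      rcases Finset.mem_union.1 (g5 e he) with h' | h'
      exacts [Finset.disjoint_left.1 hBM hi h', Finset.disjoint_left.1 hBD hi h']
    have h2 : ∀ e ∈ M', e.2 ≠ y := by
      intro e he hey
      obtain ⟨e', he', h'⟩ := Finset.mem_image.1 (g4 e he)
      exact hne e' he' (h'.trans hey)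
    have := hmax _ (g1.insert (hB hi) hyY (hF.subset hz) hf h1 h2 g3)
    rw [Finset.card_insert_of_notMem fun h' => h1 _ h' rfl] at this
    omega
  choose! e he hey using hUM
  set V := U.image fun y => w (e y).1 - (e y).2 with hV
  refine ⟨S ∪ V, ⟨?_, ?_⟩, ?_, Finset.subset_union_left⟩
  · refine Finset.union_subset hF.subset (Finset.image_subset_iff.2 fun y hy => ?_)
    exact h.sub_mem _ (he y hy)
  · intro z hz
    by_cases hzS : z ∈ S
    · obtain ⟨M', g1, g2, g3, g4, g5, g6⟩ := hF.exists_switch _ hzS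
      refine ⟨M', g1, g2, g3, g4, fun e he => ?_, fun e he hes => g6 e he fun h' =>
        hes (Finset.mem_union_left _ h')⟩
      rw [← Finset.union_assoc]
      exact Finset.mem_union_left _ (g5 e he)
    · obtain ⟨y, hy, rfl⟩ := Finset.mem_image.1 ((Finset.mem_union.1 hz).resolve_left hzS)
      obtain ⟨hyY, i, hi, hz', hf⟩ := Finset.mem_filter.1 hy
      obtain ⟨M', g1, g2, g3, g4, g5, g6⟩ := hF.exists_switch _ hz'
      have heM := g6 _ (he y hy) hzS
      have h1 : ∀ e ∈ M', e.1 ≠ i := by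
        rintro e he rfl
        rcases Finset.mem_union.1 (g5 e he) with h' | h'
        exacts [Finset.disjoint_left.1 hBM hi h', Finset.disjoint_left.1 hBD hi h']
      refine ⟨Insert.insert (i, y) (M'.erase (e y)),
        (g1.mono (Finset.erase_subset _ _)).insert (hB hi) hyY (hF.subset hz') hf
          (fun e' he' => h1 e' (Finset.mem_of_mem_erase he')) ?_
          (fun e' he' => g3 e' (Finset.mem_of_mem_erase he')), ?_, ?_, ?_, ?_, ?_⟩
      · intro e' he' hey'
        obtain ⟨hne, he'⟩ := Finset.mem_erase.1 he'
        exact hne (g1.inj_snd _ he' _ heM (hey'.trans (hey y hy).symm))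
      · rw [Finset.card_insert_of_notMem fun h' => h1 _ (Finset.mem_of_mem_erase h') rfl,
          Finset.card_erase_add_one heM, g2]
      · rw [Finset.forall_mem_insert]
        refine ⟨fun h' => hzS (h' ▸ hz'), fun e' he' h' => ?_⟩
        obtain ⟨hne, he'⟩ := Finset.mem_erase.1 he'
        exact hne (g1.inj_sub _ he' _ heM h')
      · rw [Finset.forall_mem_insert]
        exact ⟨Finset.mem_image.2 ⟨e y, he y hy, hey y hy⟩, fun e' he' =>
          g4 e' (Finset.mem_of_mem_erase he')⟩
      · rw [Finset.forall_mem_insert]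
        refine ⟨Finset.mem_union_right _ (Finset.mem_union_right _ hi), fun e' he' => ?_⟩
        rw [← Finset.union_assoc]
        exact Finset.mem_union_left _ (g5 e' (Finset.mem_of_mem_erase he'))
      · intro e' he' hes
        refine Finset.mem_insert_of_mem (Finset.mem_erase.2 ⟨?_, g6 e' he' fun h' =>
          hes (Finset.mem_union_left _ h')⟩)
        rintro rfl
        exact hes hz
  · have hVc : V.card = U.card := by
      refine Finset.card_image_of_injOn fun y hy y' hy' hyy => ?_
      have := h.inj_sub _ (he y hy) _ (he y' hy') hyy
      rw [← hey y hy, this, hey y' hy']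
    rw [← hVc, ← Finset.card_union_of_disjoint]
    · refine Finset.card_le_card (Finset.union_subset Finset.subset_union_right fun z hz => ?_)
      exact Finset.mem_union_left _ (hZS z hz)
    · rw [Finset.disjoint_right]
      intro z hz hzV
      obtain ⟨y, hy, rfl⟩ := Finset.mem_image.1 hzV
      exact (Finset.mem_sdiff.1 hz).2 (Finset.mem_image.2 ⟨e y, he y hy, rfl⟩)

/-- If every batch of `b` indices expands every set up to an error `h`, then a maximum matching
leaves few indices or few elements uncovered. -/
theorem card_sdiff_lt [Nonempty ι] (h : SumMatching I w forb Y Z M)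
    (hmax : ∀ M', SumMatching I w forb Y Z M' → M'.card ≤ M.card) {b N e g : ℕ}
    (hexp : ∀ B ⊆ I, B.card = b → ∀ S ⊆ Z,
      S.card ≤ (Y.filter fun y => ∃ i ∈ B, w i - y ∈ S ∧ y ∉ forb i).card + e)
    (hI : N * b + M.card ≤ I.card) (hN : Z.card < N * g) : Z.card < M.card + e + g := by
  by_contra hlt
  push Not at hlt
  have hZ0 : (Z \ M.image fun e => w e.1 - e.2).card + M.card = Z.card := by
    rw [← h.card_sub]
    exact Finset.card_sdiff_add_card_eq_card
      (Finset.image_subset_iff.2 fun e he => h.sub_mem e he)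
  have key : ∀ j ≤ N, ∃ S D, Freeable I w forb Y Z M S D ∧ D ⊆ I ∧
      Disjoint D (M.image Prod.fst) ∧ D.card = j * b ∧
      (∀ z ∈ Z \ M.image fun e => w e.1 - e.2, z ∈ S) ∧ j * g ≤ S.card := by
    intro j
    induction j with
    | zero => exact fun _ => ⟨_, ∅, Freeable.of_matching h, by simp, by simp, by simp, by simp,
        by simp⟩
    | succ j ih =>
      intro hj
      obtain ⟨S, D, h1, h2, h3, h4, h5, h6⟩ := ih (by omega)
      have hjb : (j + 1) * b ≤ N * b := Nat.mul_le_mul_right _ hj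
      rw [Nat.succ_mul] at hjb ⊢
      rw [Nat.succ_mul]
      have hle : b ≤ (I \ (M.image Prod.fst ∪ D)).card := by
        have hsub : M.image Prod.fst ∪ D ⊆ I :=
          Finset.union_subset (Finset.image_subset_iff.2 fun e he => h.fst_mem e he) h2
        have := Finset.card_sdiff_add_card_eq_card hsub
        rw [Finset.card_union_of_disjoint h3.symm, h.card_fst, h4] at this
        omega
      obtain ⟨B, hBs, hBc⟩ := Finset.exists_subset_card_eq hle
      have hBI : B ⊆ I := hBs.trans Finset.sdiff_subset
      have hBM : Disjoint B (M.image Prod.fst) := Finset.disjoint_left.2 fun i hi h' =>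
        (Finset.mem_sdiff.1 (hBs hi)).2 (Finset.mem_union_left _ h')
      have hBD : Disjoint B D := Finset.disjoint_left.2 fun i hi h' =>
        (Finset.mem_sdiff.1 (hBs hi)).2 (Finset.mem_union_right _ h')
      obtain ⟨S', g1, g2, g3⟩ := h1.step h hmax hBI hBM hBD h5
      have := hexp B hBI hBc S h1.subset
      refine ⟨S', D ∪ B, g1, Finset.union_subset h2 hBI, Finset.disjoint_union_left.2 ⟨h3, hBM⟩,
        ?_, fun z hz => g3 (h5 z hz), by omega⟩
      rw [Finset.card_union_of_disjoint hBD.symm, h4, hBc]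
  obtain ⟨S, D, h1, -, -, -, -, h6⟩ := key N le_rfl
  have := Finset.card_le_card h1.subset
  omega

theorem exists_maximum (I : Finset ι) (w : ι → G) (forb : ι → Finset G) (Y Z : Finset G) :
    ∃ M, SumMatching I w forb Y Z M ∧ ∀ M', SumMatching I w forb Y Z M' → M'.card ≤ M.card := by
  obtain ⟨M, hM, hmax⟩ := Finset.exists_max_image
    ((I ×ˢ Y).powerset.filter fun M => SumMatching I w forb Y Z M) Finset.card
    ⟨∅, by simp [SumMatching.empty]⟩
  refine ⟨M, (Finset.mem_filter.1 hM).2, fun M' hM' => hmax M' (Finset.mem_filter.2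
    ⟨Finset.mem_powerset.2 fun e he => ?_, hM'⟩)⟩
  exact Finset.mem_product.2 ⟨hM'.fst_mem e he, hM'.snd_mem e he⟩

end SumMatching

section Expansion

variable {G : Type} [AddCommGroup G] [Fintype G] {ι : Type}

/-- The indicator function of a finset. -/
noncomputable def ind (Y : Finset G) (g : G) : ℝ := if g ∈ Y then 1 else 0

theorem ind_nonneg {G : Type} (Y : Finset G) (g : G) : 0 ≤ ind Y g := by
  unfold ind; split_ifs <;> norm_num

theorem ind_le_one {G : Type} (Y : Finset G) (g : G) : ind Y g ≤ 1 := by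
  unfold ind; split_ifs <;> norm_num

theorem sum_ind {G : Type} [Fintype G] (Y : Finset G) : ∑ g, ind Y g = Y.card := by
  simp [ind]

/-- The number of representations of `d` as a difference in `Y`. -/
noncomputable def diffCount (Y : Finset G) (d : G) : ℝ := ∑ g, ind Y g * ind Y (g + d)

/-- The total squared deviation of the difference counts from those of a random set of density
`ρ`. -/
noncomputable def diffDev (Y : Finset G) (ρ : ℝ) : ℝ :=
  ∑ d ∈ Finset.univ.filter (fun d : G => d ≠ 0), (diffCount Y d - ρ ^ 2 * Fintype.card G) ^ 2

theorem diffDev_nonneg (Y : Finset G) (ρ : ℝ) : 0 ≤ diffDev Y ρ :=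
  Finset.sum_nonneg fun _ _ => sq_nonneg _

/-- The number of `i ∈ B` with `w i - g ∈ Y`. -/
noncomputable def sumDegree (B : Finset ι) (w : ι → G) (Y : Finset G) (g : G) : ℝ :=
  ∑ i ∈ B, ind Y (w i - g)

theorem sum_sumDegree (B : Finset ι) (w : ι → G) (Y : Finset G) :
    ∑ g, sumDegree B w Y g = B.card * Y.card := by
  unfold sumDegree
  rw [Finset.sum_comm, Finset.sum_congr rfl fun i _ => ?_, Finset.sum_const, nsmul_eq_mul]
  rw [← sum_ind Y]
  exact (Equiv.subLeft (w i)).sum_comp fun g => ind Y g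

theorem sum_sumDegree_sq (B : Finset ι) (w : ι → G) (Y : Finset G) :
    ∑ g, sumDegree B w Y g ^ 2 = ∑ i ∈ B, ∑ j ∈ B, diffCount Y (w i - w j) := by
  unfold sumDegree
  simp only [sq, Finset.sum_mul_sum]
  rw [Finset.sum_comm]
  refine Finset.sum_congr rfl fun i _ => ?_
  rw [Finset.sum_comm]
  refine Finset.sum_congr rfl fun j _ => ?_
  unfold diffCount
  rw [← (Equiv.subLeft (w j)).sum_comp]
  refine Finset.sum_congr rfl fun g _ => ?_
  have e : w i - (w j - g) = g + (w i - w j) := by abel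
  rw [mul_comm, Equiv.subLeft_apply, sub_sub_cancel, e]

variable {B : Finset ι} {w : ι → G} {Y Z : Finset G} {ρ μ : ℝ}

theorem sum_sumDegree_sub_sq_le (hμ : ∀ v, ((B.filter fun i => w i = v).card : ℝ) ≤ μ) :
    ∑ g, (sumDegree B w Y g - ρ * B.card) ^ 2 ≤
      2 * ρ * B.card ^ 2 * (ρ * Fintype.card G - Y.card) + B.card * μ * Fintype.card G +
        B.card * √(B.card * μ * diffDev Y ρ) := by
  set n : ℝ := (Fintype.card G : ℝ)
  set b : ℝ := (B.card : ℝ)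
  have hb0 : 0 ≤ b := Nat.cast_nonneg _
  have hn0 : 0 ≤ n := Nat.cast_nonneg _
  set D : G → ℝ := fun d => diffCount Y d - ρ ^ 2 * n with hD
  have e1 : ∑ g, (sumDegree B w Y g - ρ * b) ^ 2 =
      ∑ i ∈ B, ∑ j ∈ B, D (w i - w j) + 2 * ρ * b ^ 2 * (ρ * n - Y.card) := by
    have : ∀ g, (sumDegree B w Y g - ρ * b) ^ 2 =
      sumDegree B w Y g ^ 2 - 2 * ρ * b * sumDegree B w Y g + (ρ * b) ^ 2 := fun g => by ring
    simp only [this, Finset.sum_add_distrib, Finset.sum_sub_distrib, ← Finset.mul_sum,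
      sum_sumDegree, sum_sumDegree_sq, hD, Finset.sum_const, nsmul_eq_mul, Finset.card_univ]
    ring
  have hD0 : ∀ i j, w i = w j → D (w i - w j) ≤ n := by
    intro i j h
    have : diffCount Y (w i - w j) ≤ ∑ g : G, 1 :=
      Finset.sum_le_sum fun g _ => mul_le_one₀ (ind_le_one _ _) (ind_nonneg _ _) (ind_le_one _ _)
    simp only [Finset.sum_const, nsmul_eq_mul, mul_one, Finset.card_univ] at this
    have h2 : 0 ≤ ρ ^ 2 * n := by positivity
    simp only [hD]
    linarith
  have e2 : ∑ i ∈ B, ∑ j ∈ B, D (w i - w j) ≤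
      ∑ i ∈ B, ∑ j ∈ B, (if w i = w j then n else 0) +
        ∑ i ∈ B, ∑ j ∈ B, (if w i = w j then 0 else D (w i - w j)) := by
    simp only [← Finset.sum_add_distrib]
    refine Finset.sum_le_sum fun i _ => Finset.sum_le_sum fun j _ => ?_
    split_ifs with h
    · simpa using hD0 i j h
    · simp
  have e3 : ∑ i ∈ B, ∑ j ∈ B, (if w i = w j then n else 0) ≤ b * μ * n := by
    have : ∀ i ∈ B, ∑ j ∈ B, (if w i = w j then n else 0) ≤ μ * n := by
      intro i _
      rw [← Finset.sum_filter, Finset.sum_const, nsmul_eq_mul]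
      refine mul_le_mul_of_nonneg_right (le_trans (le_of_eq ?_) (hμ (w i))) hn0
      congr 2
      ext j
      simp [eq_comm]
    calc _ ≤ ∑ i ∈ B, μ * n := Finset.sum_le_sum this
      _ = b * μ * n := by rw [Finset.sum_const, nsmul_eq_mul]; ring
  have e4 : ∑ i ∈ B, ∑ j ∈ B, (if w i = w j then 0 else D (w i - w j)) ≤
      b * √(b * μ * diffDev Y ρ) := by
    have cs : (∑ i ∈ B, ∑ j ∈ B, (if w i = w j then 0 else D (w i - w j))) ^ 2 ≤
        b ^ 2 * (b * μ * diffDev Y ρ) := by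
      have hrow : ∀ i ∈ B, ∑ j ∈ B, (if w i = w j then 0 else D (w i - w j)) ^ 2 ≤
          μ * diffDev Y ρ := by
        intro i _
        have hfib := Finset.sum_fiberwise_of_maps_to (s := B) (t := Finset.univ) (g := w)
          (fun _ _ => Finset.mem_univ _) (fun j => (if w i = w j then 0 else D (w i - w j)) ^ 2)
        rw [← hfib]
        have : ∀ v, ∑ j ∈ B with w j = v, (if w i = w j then 0 else D (w i - w j)) ^ 2 ≤
            μ * (if w i - v = 0 then 0 else D (w i - v) ^ 2) := by
          intro v
          rw [Finset.sum_congr rfl (g := fun _ => if w i - v = 0 then 0 else D (w i - v) ^ 2),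
            Finset.sum_const, nsmul_eq_mul]
          · refine mul_le_mul_of_nonneg_right (hμ v) ?_
            split_ifs
            exacts [le_rfl, sq_nonneg _]
          · intro j hj
            rw [(Finset.mem_filter.1 hj).2, sub_eq_zero]
            split_ifs <;> simp
        refine (Finset.sum_le_sum fun v _ => this v).trans (le_of_eq ?_)
        have hshift := (Equiv.subLeft (w i)).sum_comp fun d => if d = 0 then 0 else D d ^ 2
        simp only [Equiv.subLeft_apply] at hshift
        rw [← Finset.mul_sum, hshift, diffDev, Finset.sum_filter]
        simp only [ne_eq, ite_not, hD, n]
      have h1 := sq_sum_le_card_mul_sum_sq (s := B)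
        (f := fun i => ∑ j ∈ B, (if w i = w j then 0 else D (w i - w j)))
      have h2 : ∀ i ∈ B, (∑ j ∈ B, (if w i = w j then 0 else D (w i - w j))) ^ 2 ≤
          b * (μ * diffDev Y ρ) := fun i hi =>
        (sq_sum_le_card_mul_sum_sq (s := B)).trans (mul_le_mul_of_nonneg_left (hrow i hi) hb0)
      calc _ ≤ _ := h1
        _ ≤ b * ∑ i ∈ B, b * (μ * diffDev Y ρ) :=
          mul_le_mul_of_nonneg_left (Finset.sum_le_sum h2) hb0
        _ = _ := by rw [Finset.sum_const, nsmul_eq_mul]; ring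
    calc _ ≤ √(b ^ 2 * (b * μ * diffDev Y ρ)) := Real.le_sqrt_of_sq_le cs
      _ = _ := by rw [Real.sqrt_mul (sq_nonneg _), Real.sqrt_sq hb0]
  rw [e1]
  linarith

theorem abs_sum_sumDegree_sub_le (S : Finset G) {Q : ℝ}
    (hQ : ∑ g, (sumDegree B w Y g - ρ * B.card) ^ 2 ≤ Q) :
    |∑ z ∈ S, sumDegree B w Y z - ρ * B.card * S.card| ≤ √(Fintype.card G * Q) := by
  refine Real.abs_le_sqrt ?_
  have e : ∑ z ∈ S, sumDegree B w Y z - ρ * B.card * S.card =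
      ∑ z ∈ S, (sumDegree B w Y z - ρ * B.card) := by
    rw [Finset.sum_sub_distrib, Finset.sum_const, nsmul_eq_mul]
    ring
  rw [e]
  refine (sq_sum_le_card_mul_sum_sq (s := S)).trans (mul_le_mul ?_ ?_ ?_ (Nat.cast_nonneg _))
  · exact_mod_cast Finset.card_le_univ S
  · exact (Finset.sum_le_univ_sum_of_nonneg fun _ => sq_nonneg _).trans hQ
  · exact Finset.sum_nonneg fun _ _ => sq_nonneg _

theorem expansion_le {Q : ℝ} {Y' : Finset G} (hY' : Y' ⊆ Y) {forb : ι → Finset G}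
    (hforb : ∀ i, (forb i).card ≤ 20) {S : Finset G} (hS : S ⊆ Z)
    (hQY : ∑ g, (sumDegree B w Y g - ρ * B.card) ^ 2 ≤ Q)
    (hQZ : ∑ g, (sumDegree B w Z g - ρ * B.card) ^ 2 ≤ Q) :
    ρ * B.card * S.card ≤
      ρ * B.card * (Y'.filter fun y => ∃ i ∈ B, w i - y ∈ S ∧ y ∉ forb i).card +
        2 * √(Fintype.card G * Q) + B.card * ((Y.card - Y'.card) + 20) := by
  set U := Y'.filter fun y => ∃ i ∈ B, w i - y ∈ S ∧ y ∉ forb i with hU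
  have h1 := (abs_le.1 (abs_sum_sumDegree_sub_le S hQY)).1
  have h2 := (abs_le.1 (abs_sum_sumDegree_sub_le U hQZ)).2
  have key : ∑ z ∈ S, sumDegree B w Y z ≤
      ∑ y ∈ U, sumDegree B w Z y + B.card * ((Y.card - Y'.card) + 20) := by
    unfold sumDegree
    rw [Finset.sum_comm, Finset.sum_comm (s := U), ← nsmul_eq_mul, ← Finset.sum_const,
      ← Finset.sum_add_distrib]
    refine Finset.sum_le_sum fun i hi => ?_
    have c1 : ∑ z ∈ S, ind Y (w i - z) = ((S.filter fun z => w i - z ∈ Y).card : ℝ) := by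
      simp [ind]
    have c2 : ∑ y ∈ U, ind Z (w i - y) = ((U.filter fun y => w i - y ∈ Z).card : ℝ) := by
      simp [ind]
    have c3 : (S.filter fun z => w i - z ∈ Y).card ≤
        (U.filter fun y => w i - y ∈ Z).card + (Y \ Y').card + (forb i).card := by
      rw [← Finset.card_image_of_injective (S.filter fun z => w i - z ∈ Y)
        (sub_right_injective (b := w i))]
      refine (Finset.card_le_card (t := U.filter (fun y => w i - y ∈ Z) ∪ Y \ Y' ∪ forb i) ?_).trans
        (Finset.card_union_le_add (Finset.card_union_le _ _) le_rfl)
      intro y hy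
      obtain ⟨z, hz, rfl⟩ := Finset.mem_image.1 hy
      obtain ⟨hzS, hzY⟩ := Finset.mem_filter.1 hz
      simp only [Finset.mem_union, Finset.mem_filter, Finset.mem_sdiff, hU, sub_sub_cancel]
      by_cases hf : w i - z ∈ forb i
      · exact Or.inr hf
      by_cases hy' : w i - z ∈ Y'
      · exact Or.inl (Or.inl ⟨⟨hy', i, hi, by rwa [sub_sub_cancel], hf⟩, hS hzS⟩)
      · exact Or.inl (Or.inr ⟨hzY, hy'⟩)
    have c4 : ((Y \ Y').card : ℝ) = Y.card - Y'.card := by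
      rw [Finset.cast_card_sdiff hY']
    have c5 : ((forb i).card : ℝ) ≤ 20 := by exact_mod_cast hforb i
    have c6 : ((S.filter fun z => w i - z ∈ Y).card : ℝ) ≤
        (U.filter fun y => w i - y ∈ Z).card + (Y \ Y').card + (forb i).card := by
      exact_mod_cast c3
    rw [c1, c2]
    linarith
  linarith

end Expansion

theorem exists_isPairFamily {G : Type} [AddCommGroup G] [DecidableEq G] {s : G} (P : Finset G)
    (h0 : (0 : G) ∉ P) (hP : ∀ v ∈ P, s - v ∈ P ∧ v ≠ s - v) :
    ∃ (p : ℕ → G) (M : ℕ), BlockSystem.IsPairFamily s p M ∧ P.card = 2 * M ∧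
      ∀ P' ⊆ P, (∀ v ∈ P', s - v ∈ P') →
        ∃ F ⊆ Finset.range M, P' = F.biUnion (fun x => mirrorPair s (p x)) ∧
          P'.card = 2 * F.card := by
  induction P using Finset.strongInduction with
  | H P ih =>
    rcases P.eq_empty_or_nonempty with rfl | ⟨v, hv⟩
    · refine ⟨fun _ => 0, 0, ⟨by simp, by simp⟩, by simp, fun P' hP' _ => ⟨∅, by simp, ?_⟩⟩
      rw [Finset.subset_empty.1 hP']
      simp
    obtain ⟨hv', hvv⟩ := hP v hv
    have hvs : mirrorPair s v ⊆ P := mirrorPair_subset hv hv'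
    have hcv : (mirrorPair s v).card = 2 := Finset.card_pair hvv
    have hmir : ∀ w, w ∉ mirrorPair s v → s - w ∉ mirrorPair s v := by
      intro w hw hw'
      apply hw
      rw [mem_mirrorPair] at hw' ⊢
      rcases hw' with h | h
      · right; rw [← h, sub_sub_cancel]
      · left; exact sub_right_injective h
    obtain ⟨p, M, ⟨h1, h2⟩, h3, h4⟩ := ih (P \ mirrorPair s v)
      (Finset.sdiff_ssubset hvs ⟨v, left_mem_mirrorPair s v⟩)
      (fun h' => h0 (Finset.mem_sdiff.1 h').1) (by
        intro w hw
        obtain ⟨hw1, hw2⟩ := Finset.mem_sdiff.1 hw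
        exact ⟨Finset.mem_sdiff.2 ⟨(hP w hw1).1, hmir w hw2⟩, (hP w hw1).2⟩)
    have hsub : ∀ x < M, mirrorPair s (p x) ⊆ P \ mirrorPair s v := by
      obtain ⟨F, hF, hPF, hc⟩ := h4 _ subset_rfl (by
        intro w hw
        obtain ⟨hw1, hw2⟩ := Finset.mem_sdiff.1 hw
        exact Finset.mem_sdiff.2 ⟨(hP w hw1).1, hmir w hw2⟩)
      have hFM : F = Finset.range M :=
        Finset.eq_of_subset_of_card_le hF (by rw [Finset.card_range]; omega)
      rw [hPF, hFM]
      intro x hx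
      exact Finset.subset_biUnion_of_mem (fun x => mirrorPair s (p x)) (Finset.mem_range.2 hx)
    have hdv : ∀ x < M, Disjoint (mirrorPair s (p x)) (mirrorPair s v) := fun x hx =>
      Finset.disjoint_of_subset_left (hsub x hx) Finset.sdiff_disjoint
    set p' : ℕ → G := fun x => if x < M then p x else v with hp'
    have e1 : ∀ x < M, p' x = p x := fun x hx => if_pos hx
    have e2 : p' M = v := if_neg (lt_irrefl _)
    have cases : ∀ x < M + 1, x < M ∨ x = M := fun x hx => by omega
    refine ⟨p', M + 1, ⟨?_, ?_⟩, ?_, ?_⟩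
    · intro x hx
      rcases cases x hx with hx | rfl
      · rw [e1 x hx]; exact h1 x hx
      · rw [e2]; exact ⟨fun h' => h0 (hvs h'), hvv⟩
    · intro x hx y hy hxy
      rcases cases x hx with hx | rfl <;> rcases cases y hy with hy | rfl
      · rw [e1 x hx, e1 y hy]; exact h2 x hx y hy hxy
      · rw [e1 x hx, e2]; exact hdv x hx
      · rw [e1 y hy, e2]; exact (hdv y hy).symm
      · exact absurd rfl hxy
    · have := Finset.card_sdiff_add_card_eq_card hvs
      omega
    · intro P' hP' hm
      obtain ⟨F, hF, hPF, hc⟩ := h4 (P' \ mirrorPair s v) (Finset.sdiff_subset_sdiff hP' subset_rfl)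
        (by
          intro w hw
          obtain ⟨hw1, hw2⟩ := Finset.mem_sdiff.1 hw
          exact Finset.mem_sdiff.2 ⟨hm w hw1, hmir w hw2⟩)
      have eF : F.biUnion (fun x => mirrorPair s (p' x)) =
          F.biUnion (fun x => mirrorPair s (p x)) :=
        Finset.biUnion_congr rfl fun x hx => by rw [e1 x (Finset.mem_range.1 (hF hx))]
      have hMF : M ∉ F := fun h' => absurd (Finset.mem_range.1 (hF h')) (lt_irrefl _)
      by_cases hvP : v ∈ P'
      · have hvs' : mirrorPair s v ⊆ P' := mirrorPair_subset hvP (hm v hvP)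
        refine ⟨insert M F, ?_, ?_, ?_⟩
        · intro x hx
          rcases Finset.mem_insert.1 hx with rfl | hx
          · simp
          · have := Finset.mem_range.1 (hF hx)
            simp; omega
        · rw [Finset.biUnion_insert, eF, ← hPF, e2, Finset.union_sdiff_of_subset hvs']
        · have := Finset.card_sdiff_add_card_eq_card hvs'
          rw [Finset.card_insert_of_notMem hMF]
          omega
      · have hvd : P' \ mirrorPair s v = P' := by
          refine Finset.sdiff_eq_self_of_disjoint (Finset.disjoint_right.2 fun w hw hw' => ?_)
          rcases mem_mirrorPair.1 hw with rfl | rfl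
          · exact hvP hw'
          · exact hvP (by simpa using hm _ hw')
        rw [hvd] at hPF hc
        exact ⟨F, hF.trans (Finset.range_mono (Nat.le_succ M)), by rw [eF, hPF], hc⟩

namespace BlockSystem

variable {G : Type} [AddCommGroup G] [DecidableEq G] (B : BlockSystem G) {C Bad : Finset G}
  {κ : ℕ}

theorem exists_block_through (hC : Supply C κ) (h0 : (0 : G) ∈ Bad) {l : G} (hl : l ≠ 0)
    (h : Bad.card + 60 ≤ κ) :
    ∃ S ⊆ C \ Bad, l ∉ S ∧ S.card + 1 = B.k ∧ B.OK (insert l S) := by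
  have c1 : (insert l Bad).card ≤ Bad.card + 1 := Finset.card_insert_le _ _
  obtain ⟨F, hF, hF', hδ⟩ := B.exists_filler_sdiff (hC.lt_card hl) (insert l Bad) {l}
    (Finset.mem_insert_of_mem h0) (by rw [Finset.card_singleton]; omega)
  have hd : B.δ F - l ≠ 0 := by
    intro h'
    rcases B.three_le.lt_or_eq with hk | hk
    · exact hδ hk (by rw [Finset.mem_singleton]; exact sub_eq_zero.1 h')
    · rw [B.δ_eq_zero hk.symm hF', zero_sub, neg_eq_zero] at h'
      exact hl h'
  have c2 : (insert l Bad ∪ F ∪ B.bad l F).card ≤ Bad.card + 1 + 6 + 20 :=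
    Finset.card_union_le_add (Finset.card_union_le_add c1 (B.card_filler_le hF')) (B.card_bad l F)
  obtain ⟨y, hy, hz, hyz, -, -⟩ := hC.exists_pair hd (Or.inl hd) (Or.inl hd)
    (Bad := insert l Bad ∪ F ∪ B.bad l F) (by omega)
  set z := B.δ F - l - y with hzd
  simp only [Finset.mem_sdiff, Finset.mem_union, Finset.mem_insert, not_or] at hy hz
  obtain ⟨hyC, ⟨⟨hyl, hyB⟩, hyF⟩, hyb⟩ := hy
  obtain ⟨hzC, ⟨⟨hzl, hzB⟩, hzF⟩, -⟩ := hz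
  have hlF : l ∉ F := fun h' => (Finset.mem_sdiff.1 (hF h')).2 (Finset.mem_insert_self _ _)
  refine ⟨insert y (insert z F), ?_, ?_, ?_, ?_⟩
  · refine Finset.insert_subset (Finset.mem_sdiff.2 ⟨hyC, hyB⟩) (Finset.insert_subset
      (Finset.mem_sdiff.2 ⟨hzC, hzB⟩) (hF.trans (Finset.sdiff_subset_sdiff subset_rfl
        (Finset.subset_insert _ _))))
  · simp [Ne.symm hyl, Ne.symm hzl, hlF]
  · have := B.three_le
    rw [Finset.card_insert_of_notMem (by simp [hyz, hyF]), Finset.card_insert_of_notMem hzF,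
      B.card_of_filler hF']
    omega
  · exact B.ok_block hF' hl (fun h' => hyB (h' ▸ h0)) (fun h' => hzB (h' ▸ h0)) hyb
      (by rw [hzd]; abel) (Ne.symm hyl) (Ne.symm hzl) hyz hlF hyF hzF

theorem exists_tiles_through (hC : Supply C κ) (h0 : (0 : G) ∈ Bad) (L : Finset G)
    (hL : L ⊆ Bad) (hL0 : (0 : G) ∉ L) (h : Bad.card + 9 * L.card + 60 ≤ κ) :
    ∃ S ⊆ C \ Bad, (L ∪ S).card = B.k * L.card ∧ Tiles B.OK (L ∪ S) := by
  induction L using Finset.induction_on with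
  | empty => exact ⟨∅, by simp, by simp, by simpa using Tiles.empty⟩
  | insert l L hl ih =>
    rw [Finset.card_insert_of_notMem hl] at h ⊢
    obtain ⟨S, hS, hc, hT⟩ := ih ((Finset.subset_insert _ _).trans hL)
      (fun h' => hL0 (Finset.mem_insert_of_mem h')) (by omega)
    have hk := B.le_nine
    have cS : S.card ≤ 9 * L.card := by
      have h1 : S.card ≤ (L ∪ S).card := Finset.card_le_card Finset.subset_union_right
      have h2 : B.k * L.card ≤ 9 * L.card := Nat.mul_le_mul_right _ hk
      omega
    have hlB : l ∈ Bad := hL (Finset.mem_insert_self _ _)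
    have hl0 : l ≠ 0 := fun h' => hL0 (h' ▸ Finset.mem_insert_self _ _)
    have hc' := Finset.card_union_le Bad S
    obtain ⟨S', hS', hlS', hcS', hok⟩ := B.exists_block_through hC (Bad := Bad ∪ S)
      (Finset.mem_union_left _ h0) hl0 (by omega)
    have hdisj : Disjoint (L ∪ S) (insert l S') := by
      rw [Finset.disjoint_insert_right, Finset.mem_union, not_or]
      refine ⟨⟨hl, fun h' => (Finset.mem_sdiff.1 (hS h')).2 hlB⟩, ?_⟩
      refine Finset.disjoint_right.2 fun v hv hv' => (Finset.mem_sdiff.1 (hS' hv)).2 ?_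
      rcases Finset.mem_union.1 hv' with h' | h'
      · exact Finset.mem_union_left _ (hL (Finset.mem_insert_of_mem h'))
      · exact Finset.mem_union_right _ h'
    have e : insert l L ∪ (S ∪ S') = (L ∪ S) ∪ insert l S' := by
      ext v
      simp only [Finset.mem_union, Finset.mem_insert]
      clear * -
      tauto
    refine ⟨S ∪ S', Finset.union_subset hS (hS'.trans (Finset.sdiff_subset_sdiff subset_rfl
      Finset.subset_union_left)), ?_, ?_⟩
    · rw [e, Finset.card_union_of_disjoint hdisj, hc, Finset.card_insert_of_notMem hlS', hcS']
      ring
    · rw [e]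
      exact hT.union (Tiles.of_ok hok) hdisj

theorem exists_tiles_card (hC : Supply C κ) (h0 : (0 : G) ∈ Bad) {s : G} (hs : s ≠ 0) (T : ℕ)
    (h : Bad.card + 10 * T + 60 ≤ κ) :
    ∃ S ⊆ C \ Bad, S.card = B.k * T ∧ Tiles B.OK S := by
  have hlt := hC.lt_card hs
  have h1 := Finset.le_card_sdiff Bad C
  obtain ⟨L, hL, hLc⟩ := Finset.exists_subset_card_eq (n := T) (s := C \ Bad) (by omega)
  have hc := Finset.card_union_le Bad L
  obtain ⟨S, hS, hSc, hT⟩ := B.exists_tiles_through hC (Bad := Bad ∪ L)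
    (Finset.mem_union_left _ h0) L Finset.subset_union_right
    (fun h' => (Finset.mem_sdiff.1 (hL h')).2 h0) (by omega)
  exact ⟨L ∪ S, Finset.union_subset hL (hS.trans (Finset.sdiff_subset_sdiff subset_rfl
    Finset.subset_union_left)), by rw [hSc, hLc], hT⟩

theorem exists_filler_seq (hC : κ < C.card) (h0 : (0 : G) ∈ Bad) (N : ℕ)
    (h : Bad.card + 7 * N + 19 ≤ κ) :
    ∃ f : ℕ → Finset G, ∀ n < N, f n ⊆ C \ Bad ∧ B.Filler (f n) ∧
      ∀ m < n, Disjoint (f m) (f n) ∧ (3 < B.k → B.δ (f n) ≠ B.δ (f m)) := by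
  obtain ⟨f, hf⟩ := exists_seq_of_extends (α := Finset G) (fun n f F => n < N →
    F ⊆ C \ Bad ∧ B.Filler F ∧ ∀ m < n, Disjoint (f m) F ∧ (3 < B.k → B.δ F ≠ B.δ (f m)))
    (by
      intro n f g F hfg hF hn
      obtain ⟨h1, h2, h3⟩ := hF hn
      refine ⟨h1, h2, fun m hm => ?_⟩
      rw [← hfg m hm]
      exact h3 m hm)
    (by
      intro n f ih
      by_cases hn : n < N
      swap
      · exact ⟨∅, fun h' => absurd h' hn⟩
      have c1 : ((Finset.range n).biUnion f).card ≤ n * 6 := by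
        refine (Finset.card_biUnion_le_card_mul _ _ 6 fun m hm => ?_).trans
          (by rw [Finset.card_range])
        have hm := Finset.mem_range.1 hm
        exact B.card_filler_le (ih m hm (hm.trans hn)).2.1
      have c2 : ((Finset.range n).image fun m => B.δ (f m)).card ≤ n :=
        Finset.card_image_le.trans (by rw [Finset.card_range])
      have c3 := Finset.card_union_le Bad ((Finset.range n).biUnion f)
      obtain ⟨F, h1, h2, h3⟩ := B.exists_filler_sdiff hC (Bad ∪ (Finset.range n).biUnion f)
        ((Finset.range n).image fun m => B.δ (f m)) (Finset.mem_union_left _ h0) (by omega)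
      refine ⟨F, fun _ => ⟨h1.trans (Finset.sdiff_subset_sdiff subset_rfl
        Finset.subset_union_left), h2, fun m hm => ⟨?_, fun hk h' => h3 hk ?_⟩⟩⟩
      · refine Finset.disjoint_right.2 fun v hv hv' => (Finset.mem_sdiff.1 (h1 hv)).2 ?_
        exact Finset.mem_union_right _ (Finset.mem_biUnion.2 ⟨m, Finset.mem_range.2 hm, hv'⟩)
      · exact Finset.mem_image.2 ⟨m, Finset.mem_range.2 hm, h'.symm⟩)
  exact ⟨f, hf⟩

end BlockSystem

namespace BlockSystem

variable {G : Type} [AddCommGroup G] [DecidableEq G] (B : BlockSystem G)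

/-- Disjoint groups, each consisting of an element of `X` and a filler in `X`, such that every
value is the required remaining sum of at most `μ` groups. -/
structure IsGrouping (X : Finset G) (μ : ℕ) (I : Finset (G × Finset G)) : Prop where
  subset : ∀ e ∈ I, insert e.1 e.2 ⊆ X
  notMem : ∀ e ∈ I, e.1 ∉ e.2
  filler : ∀ e ∈ I, B.Filler e.2
  disjoint : ∀ e ∈ I, ∀ e' ∈ I, e ≠ e' → Disjoint (insert e.1 e.2) (insert e'.1 e'.2)
  card_le : ∀ v, (I.filter fun e => B.δ e.2 - e.1 = v).card ≤ μ

variable {B} {X : Finset G} {μ : ℕ} {I : Finset (G × Finset G)}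

theorem IsGrouping.card_biUnion (h : B.IsGrouping X μ I) {I' : Finset (G × Finset G)}
    (hI : I' ⊆ I) : (I'.biUnion fun e => insert e.1 e.2).card = (B.k - 2) * I'.card := by
  rw [Finset.card_biUnion fun e he e' he' => h.disjoint e (hI he) e' (hI he')]
  rw [Finset.sum_congr rfl fun e he => ?_, Finset.sum_const, smul_eq_mul, mul_comm]
  have := B.three_le
  rw [Finset.card_insert_of_notMem (h.notMem e (hI he)), B.card_of_filler (h.filler e (hI he))]
  omega

variable (B)

theorem exists_isGrouping [Fintype G] (X : Finset G) (h0 : (0 : G) ∉ X) (hμ : 0 < μ) :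
    ∃ I, B.IsGrouping X μ I ∧
      X.card ≤ (B.k - 2) * I.card + Fintype.card G / μ + 40 := by
  obtain ⟨I, hI, hmax⟩ := Finset.exists_max_image
    ((X ×ˢ X.powerset).powerset.filter fun I => B.IsGrouping X μ I) Finset.card
    ⟨∅, by
      refine Finset.mem_filter.2 ⟨by simp, ?_⟩
      constructor <;> simp⟩
  have hg := (Finset.mem_filter.1 hI).2
  refine ⟨I, hg, ?_⟩
  by_contra hlt
  push Not at hlt
  have hq := Nat.zero_le (Fintype.card G / μ)
  set V := I.biUnion fun e => insert e.1 e.2 with hV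
  have hVc : V.card = (B.k - 2) * I.card := hg.card_biUnion subset_rfl
  have hVX : V ⊆ X := Finset.biUnion_subset.2 hg.subset
  have hXV := Finset.card_sdiff_add_card_eq_card hVX
  obtain ⟨F, hFX, hF, -⟩ := B.exists_filler (X \ V) ∅ (by simp; omega)
    (fun h' => h0 (Finset.mem_sdiff.1 h').1)
  have hFc := B.card_filler_le hF
  have hXF := Finset.card_sdiff_add_card_eq_card hFX
  set cnt : G → ℕ := fun v => (I.filter fun e => B.δ e.2 - e.1 = v).card with hcnt
  have hsat : (Finset.univ.filter fun v => μ ≤ cnt v).card ≤ Fintype.card G / μ := by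
    rw [Nat.le_div_iff_mul_le hμ, ← smul_eq_mul, ← Finset.sum_const]
    have h1 : ∑ v with μ ≤ cnt v, μ ≤ ∑ v with μ ≤ cnt v, cnt v :=
      Finset.sum_le_sum fun v hv => (Finset.mem_filter.1 hv).2
    have h2 : ∑ v with μ ≤ cnt v, cnt v ≤ ∑ v, cnt v :=
      Finset.sum_le_sum_of_subset (Finset.filter_subset _ _)
    have h3 : ∑ v, cnt v = I.card :=
      (Finset.card_eq_sum_card_fiberwise (fun _ _ => Finset.mem_univ _)).symm
    have h4 : I.card ≤ V.card := by
      rw [hVc]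
      have := B.three_le
      exact Nat.le_mul_of_pos_left _ (by omega)
    have h5 := Finset.card_le_univ V
    omega
  obtain ⟨v, hv, hvs⟩ := Finset.exists_mem_notMem_of_card_lt_card
    (s := Finset.univ.filter fun v => μ ≤ cnt v)
    (t := ((X \ V) \ F).image fun x => B.δ F - x) (by
      rw [Finset.card_image_of_injective _ sub_right_injective]
      omega)
  obtain ⟨x, hx, rfl⟩ := Finset.mem_image.1 hv
  obtain ⟨hxXV, hxF⟩ := Finset.mem_sdiff.1 hx
  obtain ⟨hxX, hxV⟩ := Finset.mem_sdiff.1 hxXV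
  simp only [Finset.mem_filter, Finset.mem_univ, true_and, not_le] at hvs
  have hdis : Disjoint (insert x F) V := by
    rw [Finset.disjoint_insert_left]
    exact ⟨hxV, Finset.disjoint_left.2 fun w hw => (Finset.mem_sdiff.1 (hFX hw)).2⟩
  have hsubV : ∀ e ∈ I, insert e.1 e.2 ⊆ V := fun e he =>
    Finset.subset_biUnion_of_mem (fun e : G × Finset G => insert e.1 e.2) he
  have hFX' : insert x F ⊆ X := Finset.insert_subset hxX (hFX.trans Finset.sdiff_subset)
  have hnew : (x, F) ∉ I := fun h' => hxV (hsubV _ h' (Finset.mem_insert_self _ _))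
  have hg' : B.IsGrouping X μ (insert (x, F) I) := by
    constructor
    · exact (Finset.forall_mem_insert _ _ _).2 ⟨hFX', hg.subset⟩
    · exact (Finset.forall_mem_insert _ _ _).2 ⟨hxF, hg.notMem⟩
    · exact (Finset.forall_mem_insert _ _ _).2 ⟨hF, hg.filler⟩
    · intro e he e' he' hee
      rcases Finset.mem_insert.1 he with rfl | he <;> rcases Finset.mem_insert.1 he' with rfl | he'
      · exact absurd rfl hee
      · exact hdis.mono_right (hsubV _ he')
      · exact (hdis.mono_right (hsubV _ he)).symm
      · exact hg.disjoint e he e' he' hee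
    · intro v
      rw [Finset.filter_insert]
      split_ifs with h'
      · rw [Finset.card_insert_of_notMem fun h' => hnew (Finset.mem_filter.1 h').1]
        subst h'
        exact hvs
      · exact hg.card_le v
  have := hmax _ (Finset.mem_filter.2 ⟨Finset.mem_powerset.2 fun e he => Finset.mem_product.2
    ⟨hg'.subset e he (Finset.mem_insert_self _ _), Finset.mem_powerset.2
      ((Finset.subset_insert _ _).trans (hg'.subset e he))⟩, hg'⟩)
  rw [Finset.card_insert_of_notMem hnew] at this
  omega

/-- The blocks of a matching between groups and two further classes tile. -/
theorem IsGrouping.tiles {Y Z : Finset G} (hg : B.IsGrouping X μ I) (h0X : (0 : G) ∉ X)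
    (h0Y : (0 : G) ∉ Y) (h0Z : (0 : G) ∉ Z) (hXY : Disjoint X Y) (hXZ : Disjoint X Z)
    (hYZ : Disjoint Y Z) {M : Finset ((G × Finset G) × G)}
    (hM : SumMatching I (fun e => B.δ e.2 - e.1) (fun e => B.bad e.1 e.2) Y Z M) :
    ∃ S ⊆ X ∪ Y ∪ Z, S.card = B.k * M.card ∧ Tiles B.OK S := by
  set f : (G × Finset G) × G → Finset G := fun e =>
    insert e.1.1 (insert e.2 (insert (B.δ e.1.2 - e.1.1 - e.2) e.1.2)) with hf
  have hX : ∀ e ∈ M, insert e.1.1 e.1.2 ⊆ X := fun e he => hg.subset _ (hM.fst_mem e he)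
  have hx : ∀ e ∈ M, e.1.1 ∈ X := fun e he => hX e he (Finset.mem_insert_self _ _)
  have hFX : ∀ e ∈ M, e.1.2 ⊆ X := fun e he => (Finset.subset_insert _ _).trans (hX e he)
  have hok : ∀ e ∈ M, B.OK (f e) := by
    intro e he
    have hy := hM.snd_mem e he
    have hz := hM.sub_mem e he
    refine B.ok_block (hg.filler _ (hM.fst_mem e he)) (fun h' => h0X (h' ▸ hx e he))
      (fun h' => h0Y (h' ▸ hy)) (fun h' => h0Z (h' ▸ hz)) (hM.notMem_forb e he) (by abel)
      ?_ ?_ ?_ (hg.notMem _ (hM.fst_mem e he)) ?_ ?_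
    · exact fun h' => Finset.disjoint_left.1 hXY (hx e he) (h' ▸ hy)
    · exact fun h' => Finset.disjoint_left.1 hXZ (hx e he) (h' ▸ hz)
    · exact fun h' => Finset.disjoint_left.1 hYZ hy (h' ▸ hz)
    · exact fun h' => Finset.disjoint_left.1 hXY (hFX e he h') hy
    · exact fun h' => Finset.disjoint_left.1 hXZ (hFX e he h') hz
  have hmem : ∀ e ∈ M, ∀ v ∈ f e, v ∈ insert e.1.1 e.1.2 ∨ v = e.2 ∨
      v = B.δ e.1.2 - e.1.1 - e.2 := by
    intro e _ v hv
    simp only [hf, Finset.mem_insert] at hv ⊢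
    clear * - hv
    tauto
  have hdisj : ∀ e ∈ M, ∀ e' ∈ M, e ≠ e' → Disjoint (f e) (f e') := by
    intro e he e' he' hee
    rw [Finset.disjoint_left]
    intro v hv hv'
    have hy := hM.snd_mem e he
    have hz := hM.sub_mem e he
    have hy' := hM.snd_mem e' he'
    have hz' := hM.sub_mem e' he'
    rcases hmem e he v hv with h | h | h <;> rcases hmem e' he' v hv' with h' | h' | h'
    · exact Finset.disjoint_left.1 (hg.disjoint _ (hM.fst_mem e he) _ (hM.fst_mem e' he')
        fun h'' => hee (hM.inj_fst e he e' he' h'')) h h'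
    · exact Finset.disjoint_left.1 hXY (hX e he h) (h' ▸ hy')
    · exact Finset.disjoint_left.1 hXZ (hX e he h) (h' ▸ hz')
    · exact Finset.disjoint_left.1 hXY (hX e' he' h') (h ▸ hy)
    · exact hee (hM.inj_snd e he e' he' (h.symm.trans h'))
    · exact Finset.disjoint_left.1 hYZ (h ▸ hy) (h' ▸ hz')
    · exact Finset.disjoint_left.1 hXZ (hX e' he' h') (h ▸ hz)
    · exact Finset.disjoint_left.1 hYZ (h' ▸ hy') (h ▸ hz)
    · exact hee (hM.inj_sub e he e' he' (h.symm.trans h'))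
  refine ⟨M.biUnion f, ?_, ?_, Tiles.biUnion (fun e he => Tiles.of_ok (hok e he)) hdisj⟩
  · refine Finset.biUnion_subset.2 fun e he => ?_
    intro v hv
    simp only [Finset.mem_union]
    rcases hmem e he v hv with h | rfl | rfl
    exacts [Or.inl (Or.inl (hX e he h)), Or.inl (Or.inr (hM.snd_mem e he)),
      Or.inr (hM.sub_mem e he)]
  · rw [Finset.card_biUnion hdisj, Finset.sum_congr rfl fun e he => B.card_of_ok (hok e he),
      Finset.sum_const, smul_eq_mul, mul_comm]

end BlockSystem

namespace BlockSystem

variable {G : Type} [AddCommGroup G] [DecidableEq G] (B : BlockSystem G)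

theorem exists_shift_notMem {s l : G} {φ : ℕ → Finset G} (hf : ∀ i < 3, B.Filler (φ i))
    (hd : 3 < B.k → ∀ i < 3, ∀ j < i, B.δ (φ i) ≠ B.δ (φ j))
    (h3 : B.k = 3 → l ≠ -s ∧ l ≠ -s - s) :
    ∃ i < 3, l + s + s - B.δ (φ i) ∉ mirrorPair s 0 := by
  by_contra hne
  push Not at hne
  have key : ∀ i < 3, B.δ (φ i) = l + s + s ∨ B.δ (φ i) = l + s := by
    intro i hi
    rcases mem_mirrorPair.1 (hne i hi) with h | h
    · exact Or.inl (sub_eq_zero.1 h).symm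
    · right
      rw [sub_zero] at h
      rw [eq_comm, ← sub_eq_zero]
      rw [← sub_eq_zero] at h
      rw [← h]
      abel
  rcases B.three_le.lt_or_eq with hk | hk
  · have d := hd hk
    rcases key 0 (by omega) with h0 | h0 <;> rcases key 1 (by omega) with h1 | h1 <;>
      rcases key 2 (by omega) with h2 | h2
    exacts [d 1 (by omega) 0 (by omega) (h1.trans h0.symm),
      d 1 (by omega) 0 (by omega) (h1.trans h0.symm),
      d 2 (by omega) 0 (by omega) (h2.trans h0.symm),
      d 2 (by omega) 1 (by omega) (h2.trans h1.symm),
      d 2 (by omega) 1 (by omega) (h2.trans h1.symm),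
      d 2 (by omega) 0 (by omega) (h2.trans h0.symm),
      d 1 (by omega) 0 (by omega) (h1.trans h0.symm),
      d 1 (by omega) 0 (by omega) (h1.trans h0.symm)]
  · obtain ⟨g1, g2⟩ := h3 hk.symm
    rcases key 0 (by omega) with h | h <;> rw [B.δ_eq_zero hk.symm (hf 0 (by omega))] at h
    · exact g2 (by rw [← sub_eq_zero, h]; abel)
    · exact g1 (by rw [← sub_eq_zero, h]; abel)

theorem exists_coverData {s : G} {Bad L : Finset G} {J : ℕ} {f : ℕ → Finset G}
    (hf : ∀ n < 3 * J + 2, f n ⊆ Bad ∧ B.Filler (f n) ∧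
      ∀ m < n, Disjoint (f m) (f n) ∧ (3 < B.k → B.δ (f n) ≠ B.δ (f m)))
    (hL : L ⊆ Bad) (hLc : L.card = J) (hL0 : (0 : G) ∉ L)
    (hLf : ∀ n < 3 * J + 2, Disjoint L (f n)) (h3 : B.k = 3 → -s ∉ L ∧ -s - s ∉ L) :
    ∃ l F, B.CoverData s l F Bad J (f 0) (f 1) ∧ (∀ j < J, Disjoint (f 1) (coverPart l F j)) ∧
      f 0 ∪ (Finset.range J).biUnion (coverPart l F) ∪ f 1 =
        L ∪ (Finset.range (3 * J + 2)).biUnion f := by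
  set e := Finset.equivFinOfCardEq hLc
  set l : ℕ → G := fun j => if h : j < J then (e.symm ⟨j, h⟩ : G) else 0 with hl
  have hlm : ∀ j < J, l j ∈ L := fun j hj => by simp [hl, hj]
  have hli : ∀ j < J, ∀ j' < J, l j = l j' → j = j' := by
    intro j hj j' hj' h
    simp only [hl, hj, hj', dif_pos] at h
    simpa using e.symm.injective (Subtype.ext h)
  have hls : ∀ v ∈ L, ∃ j < J, l j = v := by
    intro v hv
    refine ⟨e ⟨v, hv⟩, (e ⟨v, hv⟩).2, ?_⟩
    simp [hl]
  have hi : ∀ j, ∃ i < 3, j < J → l j + s + s - B.δ (f (3 * j + 2 + i)) ∉ mirrorPair s 0 := by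
    intro j
    by_cases hj : j < J
    · obtain ⟨i, h1, h2⟩ := B.exists_shift_notMem (s := s) (l := l j)
        (φ := fun i => f (3 * j + 2 + i)) (fun i hi => (hf _ (by omega)).2.1)
        (fun hk i hi i' hi' => ((hf _ (by omega)).2.2 _ (by omega)).2 hk) (fun hk =>
          ⟨fun h' => (h3 hk).1 (h' ▸ hlm j hj), fun h' => (h3 hk).2 (h' ▸ hlm j hj)⟩)
      exact ⟨i, h1, fun _ => h2⟩
    · exact ⟨0, by omega, fun h' => absurd h' hj⟩
  choose i₀ hi₀ hshift using hi
  set F : ℕ → Fin 3 → Finset G := fun j i => f (3 * j + 2 + (i₀ j + i) % 3) with hF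
  have hdis : ∀ n < 3 * J + 2, ∀ m < 3 * J + 2, n ≠ m → Disjoint (f n) (f m) := by
    intro n hn m hm hnm
    rcases lt_or_gt_of_ne hnm with h | h
    · exact ((hf m hm).2.2 n h).1
    · exact ((hf n hn).2.2 m h).1.symm
  have hidx : ∀ j < J, ∀ i : Fin 3, 3 * j + 2 + (i₀ j + i) % 3 < 3 * J + 2 := by
    intro j hj i
    have := Nat.mod_lt (i₀ j + i) (by omega : 0 < 3)
    omega
  have hmem : ∀ j < J, ∀ v ∈ coverPart l F j, v = l j ∨
      ∃ r < 3, v ∈ f (3 * j + 2 + r) := by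
    intro j _ v hv
    simp only [coverPart, Finset.mem_insert, Finset.mem_union] at hv
    rcases hv with h | (h | h) | h
    exacts [Or.inl h, Or.inr ⟨_, Nat.mod_lt _ (by omega), h⟩,
      Or.inr ⟨_, Nat.mod_lt _ (by omega), h⟩, Or.inr ⟨_, Nat.mod_lt _ (by omega), h⟩]
  have hlF : ∀ j < J, ∀ n < 3 * J + 2, l j ∉ f n := fun j hj n hn h' =>
    Finset.disjoint_left.1 (hLf n hn) (hlm j hj) h'
  have hdn : ∀ n < 2, ∀ j < J, Disjoint (f n) (coverPart l F j) := by
    intro n hn j hj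
    refine Finset.disjoint_right.2 fun v hv hv' => ?_
    rcases hmem j hj v hv with rfl | ⟨r, hr, h⟩
    · exact hlF j hj n (by omega) hv'
    · exact Finset.disjoint_left.1 (hdis n (by omega) _ (by omega) (by omega)) hv' h
  refine ⟨l, F, ⟨fun j hj => hL (hlm j hj), fun j hj h' => hL0 (h' ▸ hlm j hj),
    fun j hj i => (hf _ (hidx j hj i)).2.1, fun j hj i => (hf _ (hidx j hj i)).1,
    fun j hj i => hlF j hj _ (hidx j hj i), ?_, ?_, hdn 0 (by omega), (hf 0 (by omega)).2.1,
    (hf 0 (by omega)).1, ?_⟩, hdn 1 (by omega), ?_⟩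
  · intro j hj i i' hii
    refine hdis _ (hidx j hj i) _ (hidx j hj i') fun h' => hii ?_
    apply Fin.ext
    omega
  · intro j hj j' hj'
    refine Finset.disjoint_left.2 fun v hv hv' => ?_
    rcases hmem j' (by omega) v hv with h | ⟨r, hr, h⟩ <;>
      rcases hmem j hj v hv' with h' | ⟨r', hr', h'⟩
    · exact hj'.ne (hli j' (by omega) j hj (h.symm.trans h'))
    · exact hlF j' (by omega) _ (by omega) (h ▸ h')
    · exact hlF j hj _ (by omega) (h' ▸ h)
    · exact Finset.disjoint_left.1 (hdis _ (by omega) _ (by omega) (by omega)) h h'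
  · intro j hj
    have e : F j 0 = f (3 * j + 2 + i₀ j) := by
      simp only [hF, Fin.val_zero, add_zero, Nat.mod_eq_of_lt (hi₀ j)]
    rw [coverShift, e]
    exact hshift j hj
  · ext v
    simp only [Finset.mem_union, Finset.mem_biUnion, Finset.mem_range]
    constructor
    · rintro ((h | ⟨j, hj, h⟩) | h)
      · exact Or.inr ⟨0, by omega, h⟩
      · rcases hmem j hj v h with rfl | ⟨r, hr, h⟩
        · exact Or.inl (hlm j hj)
        · exact Or.inr ⟨_, by omega, h⟩
      · exact Or.inr ⟨1, by omega, h⟩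
    · rintro (h | ⟨n, hn, h⟩)
      · obtain ⟨j, hj, rfl⟩ := hls v h
        exact Or.inl (Or.inr ⟨j, hj, Finset.mem_insert_self _ _⟩)
      · rcases Nat.lt_or_ge n 2 with h2 | h2
        · interval_cases n
          · exact Or.inl (Or.inl h)
          · exact Or.inr h
        · refine Or.inl (Or.inr ⟨(n - 2) / 3, by omega, ?_⟩)
          have key : ∃ i : Fin 3, v ∈ F ((n - 2) / 3) i := by
            set j := (n - 2) / 3 with hj
            have := hi₀ j
            refine ⟨⟨((n - 2) % 3 + 3 - i₀ j) % 3, Nat.mod_lt _ (by omega)⟩, ?_⟩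
            have e : 3 * j + 2 + (i₀ j + ((n - 2) % 3 + 3 - i₀ j) % 3) % 3 = n := by omega
            simp only [hF, e]
            exact h
          obtain ⟨i, hi⟩ := key
          simp only [coverPart, Finset.mem_insert, Finset.mem_union]
          fin_cases i
          exacts [Or.inr (Or.inl (Or.inl hi)), Or.inr (Or.inl (Or.inr hi)), Or.inr (Or.inr hi)]

/-- A reserve of disjoint sets `P` and `Q` that together with any set `L` of size `J` can be
tiled whenever the sum is right. -/
theorem exists_reserve {C₁ C₂ Bad : Finset G} {s : G} {κ₁ κ₂ J m : ℕ} (hC₁ : Supply C₁ κ₁)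
    (hC₂ : Supply C₂ κ₂) (hs : s ≠ 0) (hs2 : (∀ x, x + x ≠ s) ∨ DoublingInjective G)
    (h0 : (0 : G) ∈ Bad) (hm : 1 ≤ m) (hmC : C₁.card ≤ 2 ^ m)
    (h1 : Bad.card + 27 * J + 300 ≤ κ₁)
    (h2 : Bad.card + 2 * C₁.card + 21 * J + 36 * (m * C₁.card) + 1100 ≤ κ₂) :
    ∃ P ⊆ C₁ \ Bad, ∃ Q ⊆ C₂ \ Bad, Disjoint P Q ∧
      Q.card ≤ 18 * J + 36 * (m * C₁.card) + 12 ∧ B.k ∣ (P ∪ Q).card + J ∧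
      ∀ L : Finset G, L.card = J → Disjoint L (P ∪ Q) → (0 : G) ∉ L →
        (B.k = 3 → -s ∉ L ∧ -s - s ∉ L) → ∀ t : ℕ, ∑ v ∈ P ∪ Q ∪ L, v = t • B.τ →
        (P ∪ Q ∪ L).card = t * B.k → Tiles B.OK (P ∪ Q ∪ L) := by
  set P := (C₁ \ Bad).filter fun v => s - v ∈ C₁ \ Bad ∧ v ≠ s - v with hP
  have hPC : P ⊆ C₁ \ Bad := Finset.filter_subset _ _
  have hPm : ∀ v ∈ P, s - v ∈ P ∧ v ≠ s - v := by
    intro v hv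
    obtain ⟨g1, g2, g3⟩ := Finset.mem_filter.1 hv
    refine ⟨Finset.mem_filter.2 ⟨g2, by rwa [sub_sub_cancel], ?_⟩, g3⟩
    rw [sub_sub_cancel]
    exact g3.symm
  obtain ⟨p, M, hp, hPM, hsub⟩ := exists_isPairFamily P
    (fun h' => (Finset.mem_sdiff.1 (hPC h')).2 h0) hPm
  have hPc : 2 * M ≤ C₁.card := hPM ▸ Finset.card_le_card (hPC.trans Finset.sdiff_subset)
  have hmM : m * M ≤ m * C₁.card := Nat.mul_le_mul_left _ (by omega)
  have c1 : (Bad ∪ P).card ≤ Bad.card + C₁.card :=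
    Finset.card_union_le_add le_rfl (Finset.card_le_card (hPC.trans Finset.sdiff_subset))
  obtain ⟨f, hf⟩ := B.exists_filler_seq (hC₂.lt_card hs) (Bad := Bad ∪ P)
    (Finset.mem_union_left _ h0) (3 * J + 2) (by omega)
  set V := (Finset.range (3 * J + 2)).biUnion f with hV
  have hfV : ∀ n < 3 * J + 2, f n ⊆ V := fun n hn =>
    Finset.subset_biUnion_of_mem f (Finset.mem_range.2 hn)
  have hVc : V.card ≤ (3 * J + 2) * 6 := by
    refine (Finset.card_biUnion_le_card_mul _ _ 6 fun n hn => ?_).trans (by rw [Finset.card_range])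
    exact B.card_filler_le (hf n (Finset.mem_range.1 hn)).2.1
  have hVC : V ⊆ C₂ \ (Bad ∪ P) :=
    Finset.biUnion_subset.2 fun n hn => (hf n (Finset.mem_range.1 hn)).1
  have c2 : (Bad ∪ P ∪ V).card ≤ Bad.card + C₁.card + (3 * J + 2) * 6 :=
    Finset.card_union_le_add c1 hVc
  obtain ⟨A, hA, hAc, hAt⟩ := B.exists_absorber (u := M - (3 + 4 * J)) hC₂ hC₂ hs
    (Bad := Bad ∪ P ∪ V) (Finset.mem_union_left _ (Finset.mem_union_left _ h0)) hp hm
    (by omega) (by omega)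
  rw [Finset.union_self] at hA
  have hVP : Disjoint V P := Finset.disjoint_left.2 fun v hv hv' =>
    (Finset.mem_sdiff.1 (hVC hv)).2 (Finset.mem_union_right _ hv')
  have hAP : Disjoint A P := Finset.disjoint_left.2 fun v hv hv' =>
    (Finset.mem_sdiff.1 (hA hv)).2 (Finset.mem_union_left _ (Finset.mem_union_right _ hv'))
  have hAV : Disjoint A V := Finset.disjoint_left.2 fun v hv hv' =>
    (Finset.mem_sdiff.1 (hA hv)).2 (Finset.mem_union_right _ hv')
  have hk := B.three_le
  have hVcard : V.card = (3 * J + 2) * (B.k - 3) := by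
    rw [hV, Finset.card_biUnion, Finset.sum_congr rfl fun n hn => B.card_of_filler
      (hf n (Finset.mem_range.1 hn)).2.1, Finset.sum_const, Finset.card_range, smul_eq_mul]
    intro i hi j hj hij
    rcases lt_or_gt_of_ne hij with h | h
    · exact ((hf j (Finset.mem_range.1 hj)).2.2 i h).1
    · exact ((hf i (Finset.mem_range.1 hi)).2.2 j h).1.symm
  have key : ∀ L : Finset G, L.card = J → Disjoint L (P ∪ (V ∪ A)) → (0 : G) ∉ L →
      (B.k = 3 → -s ∉ L ∧ -s - s ∉ L) → ∃ q, (P ∪ (V ∪ A) ∪ L).card = B.k * q ∧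
        (∑ v ∈ P ∪ (V ∪ A) ∪ L, v = q • B.τ → Tiles B.OK (P ∪ (V ∪ A) ∪ L)) := by
    intro L hLc hLd hL0 hL3
    have hLP : Disjoint L P := hLd.mono_right Finset.subset_union_left
    have hLV : Disjoint L V :=
      hLd.mono_right (Finset.subset_union_left.trans Finset.subset_union_right)
    have hLA : Disjoint L A :=
      hLd.mono_right (Finset.subset_union_right.trans Finset.subset_union_right)
    set Bad' := Bad ∪ L ∪ V with hBad'
    have hLB : L ⊆ Bad' := Finset.subset_union_right.trans Finset.subset_union_left
    have hVB : V ⊆ Bad' := Finset.subset_union_right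
    have hBB : Bad ⊆ Bad' := Finset.subset_union_left.trans Finset.subset_union_left
    have c3 : Bad'.card ≤ Bad.card + J + (3 * J + 2) * 6 :=
      Finset.card_union_le_add (Finset.card_union_le_add le_rfl hLc.le) hVc
    obtain ⟨l, F, hD, hd1, heq⟩ := B.exists_coverData (s := s) (f := f) (Bad := Bad') (L := L)
      (fun n hn => ⟨(hfV n hn).trans hVB, (hf n hn).2⟩) hLB hLc hL0
      (fun n hn => hLV.mono_right (hfV n hn)) hL3
    obtain ⟨U, hU, hUm, hUc, hUt⟩ := B.exists_cover hC₁ hs hs2 (hBB h0) hD (hf 1 (by omega)).2.1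
      ((hfV 1 (by omega)).trans hVB) (((hf 1 (by omega)).2.2 0 (by omega)).1.symm) hd1 (by omega)
    rw [heq] at hUt
    have hUC : U ⊆ C₁ \ Bad := hU.trans (Finset.sdiff_subset_sdiff subset_rfl hBB)
    have hUP : U ⊆ P := fun v hv =>
      Finset.mem_filter.2 ⟨hUC hv, hUC (hUm v hv).1, (hUm v hv).2⟩
    obtain ⟨F', hF', hPF, hF'c⟩ := hsub (P \ U) Finset.sdiff_subset (by
      intro v hv
      obtain ⟨hv1, hv2⟩ := Finset.mem_sdiff.1 hv
      refine Finset.mem_sdiff.2 ⟨(hPm v hv1).1, fun h' => hv2 ?_⟩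
      simpa using (hUm _ h').1)
    have hPU := Finset.card_sdiff_add_card_eq_card hUP
    have hAT := hAt F' hF' (by omega)
    rw [← hPF] at hAT
    obtain ⟨q, hq, hqs⟩ := hAT.card_sum (fun _ => B.card_of_ok) (fun _ => B.sum_of_ok)
    have hdisj : Disjoint (A ∪ P \ U) (L ∪ V ∪ U) := by
      refine Finset.disjoint_union_left.2 ⟨Finset.disjoint_union_right.2
        ⟨Finset.disjoint_union_right.2 ⟨hLA.symm, hAV⟩, hAP.mono_right hUP⟩,
        Finset.disjoint_union_right.2 ⟨?_, Finset.sdiff_disjoint⟩⟩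
      exact (Finset.disjoint_union_right.2 ⟨hLP.symm, hVP.symm⟩).mono_left Finset.sdiff_subset
    have hsplit : P ∪ (V ∪ A) ∪ L = (A ∪ P \ U) ∪ (L ∪ V ∪ U) := by
      nth_rw 1 [← Finset.sdiff_union_of_subset hUP]
      ext v
      simp only [Finset.mem_union]
      clear * -
      tauto
    have hc : (L ∪ V ∪ U).card = B.k * (3 * J + 2) := by
      rw [Finset.card_union_of_disjoint, Finset.card_union_of_disjoint hLV, hLc, hVcard, hUc]
      · obtain ⟨c, hc⟩ := Nat.exists_eq_add_of_le hk
        rw [hc, Nat.add_sub_cancel_left]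
        ring
      · exact Finset.disjoint_union_left.2 ⟨hLP.mono_right hUP, hVP.mono_right hUP⟩
    refine ⟨q + (3 * J + 2), ?_, fun hsum => ?_⟩
    · rw [hsplit, Finset.card_union_of_disjoint hdisj, hq, hc]
      ring
    rw [hsplit] at hsum ⊢
    rw [Finset.sum_union hdisj, hqs, add_nsmul] at hsum
    exact hAT.union (hUt (3 * J + 2) (add_left_cancel hsum) (hc.trans (mul_comm _ _))) hdisj
  refine ⟨P, hPC, V ∪ A, ?_, (Finset.disjoint_union_left.2 ⟨hVP, hAP⟩).symm, ?_, ?_, ?_⟩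
  · refine Finset.union_subset (hVC.trans (Finset.sdiff_subset_sdiff subset_rfl
      Finset.subset_union_left)) (hA.trans (Finset.sdiff_subset_sdiff subset_rfl ?_))
    exact Finset.subset_union_left.trans Finset.subset_union_left
  · refine (Finset.card_union_le_add hVc hAc).trans ?_
    omega
  · have hlt := hC₂.lt_card hs
    have c4 : (Bad ∪ P ∪ V ∪ A ∪ {-s, -s - s}).card ≤
        Bad.card + C₁.card + (3 * J + 2) * 6 + 36 * (m * M) + 2 :=
      Finset.card_union_le_add (Finset.card_union_le_add c2 hAc) Finset.card_le_two
    obtain ⟨L, hL, hLc⟩ := Finset.exists_subset_card_eq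
      (s := C₂ \ (Bad ∪ P ∪ V ∪ A ∪ {-s, -s - s})) (n := J) (by
        have := Finset.le_card_sdiff (Bad ∪ P ∪ V ∪ A ∪ {-s, -s - s}) C₂
        omega)
    have hL' : ∀ v ∈ L, v ∉ Bad ∧ v ∉ P ∪ (V ∪ A) ∧ v ≠ -s ∧ v ≠ -s - s := by
      intro v hv
      have h := (Finset.mem_sdiff.1 (hL hv)).2
      simp only [Finset.mem_union, Finset.mem_insert, Finset.mem_singleton] at h ⊢
      clear * - h
      tauto
    have hLd : Disjoint L (P ∪ (V ∪ A)) := Finset.disjoint_left.2 fun v hv => (hL' v hv).2.1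
    obtain ⟨q, hq, -⟩ := key L hLc hLd (fun h => (hL' 0 h).1 h0)
      fun _ => ⟨fun h => (hL' _ h).2.2.1 rfl, fun h => (hL' _ h).2.2.2 rfl⟩
    exact ⟨q, by rw [← hq, Finset.card_union_of_disjoint hLd.symm, hLc]⟩
  · intro L hLc hLd hL0 hL3 t hsum hcard
    obtain ⟨q, hq, hT⟩ := key L hLc hLd hL0 hL3
    obtain rfl : q = t := Nat.eq_of_mul_eq_mul_left (by omega : 0 < B.k)
      (hq.symm.trans (hcard.trans (mul_comm _ _)))
    exact hT hsum

end BlockSystem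

/-! ### Sets close to a template -/

/-- The range of parameters in which the assembly works: `r` is small, the density `ρ` is much
larger than `r`, and `n` is larger than a large power of `1 / r`. -/
structure Regime (r ρ n : ℝ) : Prop where
  pos : 0 < r
  le : r ≤ 1 / 10 ^ 6
  le_density : 10 ^ 5 * r ≤ ρ
  density_le : ρ ≤ 1
  one_le : 1 ≤ r ^ 5000 * n

namespace Regime

variable {r ρ n : ℝ}

theorem size_pos (h : Regime r ρ n) : 0 < n :=
  pos_of_mul_pos_right (one_pos.trans_le h.one_le) (pow_nonneg h.pos.le _)

theorem density_pos (h : Regime r ρ n) : 0 < ρ :=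
  lt_of_lt_of_le (mul_pos (by norm_num) h.pos) h.le_density

theorem pow_le (h : Regime r ρ n) {a b : ℕ} (hab : a < b) : 10 ^ 6 * r ^ b ≤ r ^ a := by
  obtain ⟨c, rfl⟩ := Nat.exists_eq_add_of_lt hab
  have h1 : r ≤ 1 := h.le.trans (by norm_num)
  have h2 : r ^ (a + c) ≤ r ^ a := pow_le_pow_of_le_one h.pos.le h1 (Nat.le_add_right _ _)
  have h3 := h.le
  have h4 := pow_pos h.pos (a + c)
  rw [pow_succ r]
  nlinarith

theorem mul_le (h : Regime r ρ n) {a b : ℕ} (hab : a < b) :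
    10 ^ 6 * (r ^ b * n) ≤ r ^ a * n := by
  rw [← mul_assoc]
  exact mul_le_mul_of_nonneg_right (h.pow_le hab) h.size_pos.le

theorem one_le_mul (h : Regime r ρ n) {a : ℕ} (ha : a < 5000) : 10 ^ 6 ≤ r ^ a * n := by
  have h1 := h.mul_le ha
  have h2 := h.one_le
  linarith

theorem mul_pos (h : Regime r ρ n) (a : ℕ) : 0 < r ^ a * n :=
  _root_.mul_pos (pow_pos h.pos _) h.size_pos

end Regime

section Assembly

variable {G : Type} [AddCommGroup G] [Fintype G] {ι : Type} {r ρ : ℝ}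

theorem sum_sumDegree_sub_sq_le_of_regime (h : Regime r ρ (Fintype.card G)) {B : Finset ι}
    {w : ι → G} {Y : Finset G} {μ : ℝ}
    (hμ : ∀ v, ((B.filter fun i => w i = v).card : ℝ) ≤ μ) (hμ0 : 0 ≤ μ) (hμr : μ * r ^ 100 ≤ 2)
    (hb : r ^ 500 * Fintype.card G ≤ B.card)
    (hY : ρ * Fintype.card G - Y.card ≤ r ^ 1000 * Fintype.card G)
    (hdev : diffDev Y ρ ≤ 3 * (Fintype.card G : ℝ) ^ 2 / r) :
    ∑ g, (sumDegree B w Y g - ρ * B.card) ^ 2 ≤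
      4 * (B.card : ℝ) ^ 2 * (r ^ 1000 * Fintype.card G) := by
  have hsum := sum_sumDegree_sub_sq_le (Y := Y) (ρ := ρ) hμ
  have hr := h.pos
  have hρ0 := h.density_pos
  have hρ1 := h.density_le
  have hn := h.size_pos
  have hd0 := diffDev_nonneg Y ρ
  have hone := h.one_le_mul (show 2601 < 5000 by norm_num)
  have hone' := h.one_le_mul (show 1600 < 5000 by norm_num)
  set n : ℝ := (Fintype.card G : ℝ)
  set b : ℝ := (B.card : ℝ)
  have hb0 : 0 < b := (h.mul_pos 500).trans_le hb
  have hμb : 3 * μ ≤ b * r ^ 2001 := by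
    refine le_of_mul_le_mul_right (a := r ^ 100) ?_ (pow_pos hr _)
    calc 3 * μ * r ^ 100 ≤ 6 := by linarith
      _ ≤ r ^ 2601 * n := by linarith
      _ = (r ^ 500 * n) * r ^ 2001 * r ^ 100 := by ring
      _ ≤ b * r ^ 2001 * r ^ 100 := by gcongr
  have hμb' : μ ≤ b * r ^ 1000 := by
    refine le_of_mul_le_mul_right (a := r ^ 100) ?_ (pow_pos hr _)
    calc μ * r ^ 100 ≤ r ^ 1600 * n := by linarith
      _ = (r ^ 500 * n) * r ^ 1000 * r ^ 100 := by ring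
      _ ≤ b * r ^ 1000 * r ^ 100 := by gcongr
  have hsqrt : √(b * μ * diffDev Y ρ) ≤ b * (r ^ 1000 * n) := by
    refine Real.sqrt_le_iff.2 ⟨by positivity, ?_⟩
    calc b * μ * diffDev Y ρ ≤ b * μ * (3 * n ^ 2 / r) := by gcongr
      _ = b * (3 * μ) * n ^ 2 / r := by ring
      _ ≤ b * (b * r ^ 2001) * n ^ 2 / r := by gcongr
      _ = (b * (r ^ 1000 * n)) ^ 2 := by field_simp
  have t1 : 2 * ρ * b ^ 2 * (ρ * n - Y.card) ≤ 2 * b ^ 2 * (r ^ 1000 * n) := by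
    calc 2 * ρ * b ^ 2 * (ρ * n - Y.card) ≤ 2 * ρ * b ^ 2 * (r ^ 1000 * n) := by gcongr
      _ ≤ 2 * 1 * b ^ 2 * (r ^ 1000 * n) := by
        have := h.mul_pos 1000
        gcongr
      _ = _ := by ring
  have t2 : b * μ * n ≤ b ^ 2 * (r ^ 1000 * n) := by
    calc b * μ * n ≤ b * (b * r ^ 1000) * n := by gcongr
      _ = _ := by ring
  have t3 : b * √(b * μ * diffDev Y ρ) ≤ b ^ 2 * (r ^ 1000 * n) := by
    calc b * √(b * μ * diffDev Y ρ) ≤ b * (b * (r ^ 1000 * n)) := by gcongr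
      _ = _ := by ring
  linarith

theorem card_le_card_filter_add (h : Regime r ρ (Fintype.card G)) {B : Finset ι}
    {w : ι → G} {Y Z Y' S : Finset G} {μ : ℝ} {forb : ι → Finset G}
    (hμ : ∀ v, ((B.filter fun i => w i = v).card : ℝ) ≤ μ) (hμ0 : 0 ≤ μ) (hμr : μ * r ^ 100 ≤ 2)
    (hb : r ^ 500 * Fintype.card G ≤ B.card)
    (hY : ρ * Fintype.card G - Y.card ≤ r ^ 1000 * Fintype.card G)
    (hYdev : diffDev Y ρ ≤ 3 * (Fintype.card G : ℝ) ^ 2 / r)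
    (hZ : ρ * Fintype.card G - Z.card ≤ r ^ 1000 * Fintype.card G)
    (hZdev : diffDev Z ρ ≤ 3 * (Fintype.card G : ℝ) ^ 2 / r)
    (hY' : Y' ⊆ Y) (hYY : (Y.card : ℝ) - Y'.card ≤ 5 * (r ^ 1000 * Fintype.card G))
    (hforb : ∀ i, (forb i).card ≤ 20) (hS : S ⊆ Z) :
    S.card ≤ (Y'.filter fun y => ∃ i ∈ B, w i - y ∈ S ∧ y ∉ forb i).card +
      ⌊r ^ 498 * Fintype.card G⌋₊ := by
  have hexp := expansion_le hY' hforb hS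
    (sum_sumDegree_sub_sq_le_of_regime h hμ hμ0 hμr hb hY hYdev)
    (sum_sumDegree_sub_sq_le_of_regime h hμ hμ0 hμr hb hZ hZdev)
  set U := Y'.filter fun y => ∃ i ∈ B, w i - y ∈ S ∧ y ∉ forb i
  have hr := h.pos
  have hρ := h.le_density
  have hn := h.size_pos
  have hone := h.one_le_mul (show 499 < 5000 by norm_num)
  have h1 := h.mul_le (show 500 < 1000 by norm_num)
  have h2 := h.mul_le (show 499 < 500 by norm_num)
  have hp := h.mul_pos 499
  rw [← Nat.sub_le_iff_le_add']
  refine Nat.le_floor ?_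
  set n : ℝ := (Fintype.card G : ℝ)
  set b : ℝ := (B.card : ℝ)
  have hb0 : 0 < b := (h.mul_pos 500).trans_le hb
  have hsq : √(n * (4 * b ^ 2 * (r ^ 1000 * n))) = 2 * b * (r ^ 500 * n) := by
    rw [show n * (4 * b ^ 2 * (r ^ 1000 * n)) = (2 * b * (r ^ 500 * n)) ^ 2 by ring]
    exact Real.sqrt_sq (by positivity)
  rw [hsq] at hexp
  have hexp' : b * (ρ * ((S.card : ℝ) - U.card)) ≤ b * (r ^ 499 * n) := by
    have : b * (4 * (r ^ 500 * n) + 5 * (r ^ 1000 * n) + 20) ≤ b * (r ^ 499 * n) :=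
      mul_le_mul_of_nonneg_left (by linarith) hb0.le
    have := mul_le_mul_of_nonneg_left hYY hb0.le
    linarith
  have hle := le_of_mul_le_mul_left hexp' hb0
  rcases Nat.le_total S.card U.card with hSU | hSU
  · rw [Nat.sub_eq_zero_of_le hSU, Nat.cast_zero]
    positivity
  · rw [Nat.cast_sub hSU]
    have hSU' : (0 : ℝ) ≤ (S.card : ℝ) - U.card := sub_nonneg.2 (Nat.cast_le.2 hSU)
    refine le_of_mul_le_mul_left (a := r) ?_ hr
    calc r * ((S.card : ℝ) - U.card) ≤ ρ * ((S.card : ℝ) - U.card) :=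
          mul_le_mul_of_nonneg_right (by linarith) hSU'
      _ ≤ r ^ 499 * n := hle
      _ = r * (r ^ 498 * n) := by ring

/-- Two pseudorandom sets of equal size together with a set `X` of the complementary size are
almost completely tiled. -/
theorem BlockSystem.exists_near_tiling [DecidableEq G] (B : BlockSystem G)
    (h : Regime r ρ (Fintype.card G)) {Y Z X Y' Z' : Finset G}
    (hY : ρ * Fintype.card G - Y.card ≤ r ^ 1000 * Fintype.card G)
    (hYdev : diffDev Y ρ ≤ 3 * (Fintype.card G : ℝ) ^ 2 / r)
    (hZ : ρ * Fintype.card G - Z.card ≤ r ^ 1000 * Fintype.card G)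
    (hZdev : diffDev Z ρ ≤ 3 * (Fintype.card G : ℝ) ^ 2 / r)
    (hY' : Y' ⊆ Y) (hYY : (Y.card : ℝ) - Y'.card ≤ 5 * (r ^ 1000 * Fintype.card G))
    (hZ' : Z' ⊆ Z) (hYZc : Z'.card = Y'.card) (hX : (B.k - 2) * Y'.card ≤ X.card)
    (h0X : (0 : G) ∉ X) (h0Y : (0 : G) ∉ Y') (h0Z : (0 : G) ∉ Z') (hXY : Disjoint X Y')
    (hXZ : Disjoint X Z') (hYZ : Disjoint Y' Z') :
    ∃ S ⊆ X ∪ Y' ∪ Z', Tiles B.OK S ∧ ∃ j : ℕ, S.card = B.k * j ∧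
      (Y'.card : ℝ) ≤ j + r ^ 98 * Fintype.card G := by
  have hr := h.pos
  have hn := h.size_pos
  have hk := B.three_le
  have hr1 := h.le
  have hone := h.one_le_mul (show 499 < 5000 by norm_num)
  have hm1 := h.mul_le (show 498 < 499 by norm_num)
  have hm2 := h.mul_le (show 200 < 498 by norm_num)
  have hm3 := h.mul_le (show 100 < 200 by norm_num)
  have hm4 := h.mul_le (show 99 < 100 by norm_num)
  have hm5 := h.mul_le (show 98 < 99 by norm_num)
  have hm6 := h.mul_le (show 200 < 300 by norm_num)
  have hm7 := h.mul_le (show 499 < 500 by norm_num)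
  set n : ℝ := (Fintype.card G : ℝ) with hnG
  have hpw : ∀ a : ℕ, r ^ a ≤ 1 := fun a => pow_le_one₀ hr.le (hr1.trans (by norm_num))
  set μ := ⌈(r ^ 100)⁻¹⌉₊ with hμ
  set N := ⌈(r ^ 200)⁻¹⌉₊ + 1 with hN
  set b := ⌈r ^ 500 * n⌉₊ with hb
  set g := ⌈r ^ 200 * n⌉₊ with hg
  set e := ⌊r ^ 498 * n⌋₊ with he
  have hμ1 : (r ^ 100)⁻¹ ≤ μ := Nat.le_ceil _
  have hμ2 : (μ : ℝ) < (r ^ 100)⁻¹ + 1 := Nat.ceil_lt_add_one (by positivity)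
  have hN1 : (r ^ 200)⁻¹ + 1 ≤ N := by rw [hN]; push_cast; gcongr; exact Nat.le_ceil _
  have hN2 : (N : ℝ) ≤ (r ^ 200)⁻¹ + 2 := by
    have := Nat.ceil_lt_add_one (show 0 ≤ (r ^ 200)⁻¹ by positivity)
    rw [hN]; push_cast; linarith
  have hb1 : r ^ 500 * n ≤ b := Nat.le_ceil _
  have hb2 : (b : ℝ) < r ^ 500 * n + 1 := Nat.ceil_lt_add_one (by positivity)
  have hg1 : r ^ 200 * n ≤ g := Nat.le_ceil _
  have hg2 : (g : ℝ) < r ^ 200 * n + 1 := Nat.ceil_lt_add_one (by positivity)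
  have he2 : (e : ℝ) ≤ r ^ 498 * n := Nat.floor_le (by positivity)
  have hμ0 : 0 < μ := Nat.ceil_pos.2 (by positivity)
  have hμr : (μ : ℝ) * r ^ 100 ≤ 2 := by
    have h1 := mul_le_mul_of_nonneg_right hμ2.le (pow_pos hr 100).le
    rw [add_mul, inv_mul_cancel₀ (by positivity)] at h1
    linarith [hpw 100]
  obtain ⟨I, hI, hIc⟩ := B.exists_isGrouping X h0X hμ0
  obtain ⟨M, hM, hmax⟩ := SumMatching.exists_maximum I (fun e => B.δ e.2 - e.1)
    (fun e => B.bad e.1 e.2) Y' Z'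
  obtain ⟨S, hS, hSc, hSt⟩ := hI.tiles B h0X h0Y h0Z hXY hXZ hYZ hM
  refine ⟨S, hS, hSt, M.card, hSc, ?_⟩
  have hdiv : ((Fintype.card G / μ : ℕ) : ℝ) ≤ r ^ 100 * n := by
    refine Nat.cast_div_le.trans ?_
    rw [div_le_iff₀ (by positivity), ← hnG]
    calc n = r ^ 100 * n * (r ^ 100)⁻¹ := by field_simp
      _ ≤ r ^ 100 * n * μ := by gcongr
  have hYI : Y'.card ≤ I.card + Fintype.card G / μ + 40 := by
    by_contra hlt
    push Not at hlt
    obtain ⟨c, hc⟩ := Nat.exists_eq_add_of_le hk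
    have hc' : B.k - 2 = c + 1 := by omega
    rw [hc'] at hX hIc
    have : (c + 1) * (I.card + Fintype.card G / μ + 40 + 1) ≤ (c + 1) * Y'.card :=
      Nat.mul_le_mul_left _ hlt
    have : Fintype.card G / μ + 40 + 1 ≤ (c + 1) * (Fintype.card G / μ + 40 + 1) :=
      Nat.le_mul_of_pos_left _ (by omega)
    have : (c + 1) * (I.card + Fintype.card G / μ + 40 + 1) =
      (c + 1) * I.card + (c + 1) * (Fintype.card G / μ + 40 + 1) := by ring
    omega
  by_cases hcase : N * b + M.card ≤ I.card
  · have hZN : Z'.card < N * g := by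
      have hZn : Z'.card < Fintype.card G := by
        rw [← Finset.card_univ]
        exact Finset.card_lt_card ⟨Finset.subset_univ _, fun h' => h0Z (h' (Finset.mem_univ 0))⟩
      have : n ≤ ((N * g : ℕ) : ℝ) := by
        push_cast
        calc n = (r ^ 200)⁻¹ * (r ^ 200 * n) := by field_simp
          _ ≤ N * g := by gcongr; linarith
      exact hZn.trans_le (by rw [hnG] at this; exact_mod_cast this)
    have hlt := hM.card_sdiff_lt hmax (b := b) (N := N) (e := e) (g := g) (fun B₀ hB₀ hB₀c S₀ hS₀ =>
      card_le_card_filter_add h (μ := μ) (fun v => Nat.cast_le.2 (by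
        refine le_trans (Finset.card_le_card ?_) (hI.card_le v)
        intro e he
        simp only [Finset.mem_filter] at he ⊢
        exact ⟨hB₀ he.1, he.2⟩)) (Nat.cast_nonneg _) hμr
        (by rw [hB₀c]; exact hb1) hY hYdev hZ hZdev hY' hYY (fun i => B.card_bad _ _)
        (hS₀.trans hZ')) hcase hZN
    rw [hYZc] at hlt
    have hlt' : (Y'.card : ℝ) ≤ M.card + e + g := by exact_mod_cast hlt.le
    linarith
  · push Not at hcase
    have h1 : (Y'.card : ℝ) ≤ N * b + M.card + (Fintype.card G / μ : ℕ) + 40 := by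
      have : Y'.card ≤ N * b + M.card + Fintype.card G / μ + 40 := by omega
      exact_mod_cast this
    have hNb : (N : ℝ) * b ≤ r ^ 200 * n := by
      calc (N : ℝ) * b ≤ ((r ^ 200)⁻¹ + 2) * (2 * (r ^ 500 * n)) := by
            gcongr
            have := h.one_le_mul (show 500 < 5000 by norm_num)
            linarith
        _ = 2 * (r ^ 300 * n) + 4 * (r ^ 500 * n) := by field_simp; ring
        _ ≤ r ^ 200 * n := by linarith
    linarith

/-- The pseudorandomness required of the parts `Y`, `Z`, `C₁`, `C₂` of a random set. -/
structure IsTemplate [DecidableEq G] (k : ℕ) (r ρ : ℝ) (Y Z C₁ C₂ : Finset G) : Prop where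
  disjoint : Disjoint Y Z
  disjoint_union : Disjoint (Y ∪ Z) (C₁ ∪ C₂)
  card_fst : |(Y.card : ℝ) - ρ * Fintype.card G| ≤ r ^ 1000 * Fintype.card G
  card_snd : |(Z.card : ℝ) - ρ * Fintype.card G| ≤ r ^ 1000 * Fintype.card G
  card_union : |((Y ∪ Z ∪ (C₁ ∪ C₂)).card : ℝ) - k * (ρ + r ^ 8) * Fintype.card G| ≤
    r ^ 1000 * Fintype.card G
  card_reserve : (C₁.card : ℝ) ≤ 2 * (r ^ 10 * Fintype.card G)
  diffDev_fst : diffDev Y ρ ≤ 3 * (Fintype.card G : ℝ) ^ 2 / r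
  diffDev_snd : diffDev Z ρ ≤ 3 * (Fintype.card G : ℝ) ^ 2 / r
  supply_fst : Supply C₁ ⌊r ^ 81 * Fintype.card G⌋₊
  supply_snd : Supply C₂ ⌊20 * (r ^ 8 * Fintype.card G)⌋₊

theorem BlockSystem.tiles_of_close_aux [DecidableEq G] (B : BlockSystem G)
    (h : Regime r ρ (Fintype.card G)) {Y Z C₁ C₂ : Finset G} (hT : IsTemplate B.k r ρ Y Z C₁ C₂)
    {s : G} (hs : s ≠ 0) (hs2 : (∀ x, x + x ≠ s) ∨ DoublingInjective G) {m : ℕ} (hm : 1 ≤ m)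
    (hmG : Fintype.card G ≤ 2 ^ m) (hmr : m * r ≤ 2) {R : Finset G}
    (hR : ((symmDiff R (Y ∪ Z ∪ (C₁ ∪ C₂))).card : ℝ) ≤ 2 * (r ^ 1000 * Fintype.card G))
    (h0 : (0 : G) ∉ R) (h3 : B.k = 3 → -s ∉ R ∧ -s - s ∉ R) {t : ℕ}
    (hsum : ∑ v ∈ R, v = t • B.τ) (hcard : R.card = t * B.k) : Tiles B.OK R := by
  have hr := h.pos
  have hn := h.size_pos
  have hk := B.three_le
  have hk9 := B.le_nine
  have hk' : (3 : ℝ) ≤ B.k := by exact_mod_cast hk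
  have hk9' : (B.k : ℝ) ≤ 9 := by exact_mod_cast hk9
  have hone := h.one_le_mul (show 1000 < 5000 by norm_num)
  have m1 := h.mul_le (show 98 < 1000 by norm_num)
  have m2 := h.mul_le (show 88 < 98 by norm_num)
  have m3 := h.mul_le (show 81 < 88 by norm_num)
  have m4 := h.mul_le (show 10 < 81 by norm_num)
  have m5 := h.mul_le (show 9 < 10 by norm_num)
  have m6 := h.mul_le (show 8 < 9 by norm_num)
  have m7 := h.mul_le (show 1 < 8 by norm_num)
  have hρ := h.le_density
  have cY := abs_le.1 hT.card_fst
  have cZ := abs_le.1 hT.card_snd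
  have cR := abs_le.1 hT.card_union
  have cC := hT.card_reserve
  set R₀ := Y ∪ Z ∪ (C₁ ∪ C₂) with hR₀
  have hYR : Y ⊆ R₀ := Finset.subset_union_left.trans Finset.subset_union_left
  have hZR : Z ⊆ R₀ := Finset.subset_union_right.trans Finset.subset_union_left
  have hC₁R : C₁ ⊆ R₀ := Finset.subset_union_left.trans Finset.subset_union_right
  have hC₂R : C₂ ⊆ R₀ := Finset.subset_union_right.trans Finset.subset_union_right
  set n : ℝ := (Fintype.card G : ℝ)
  have hρn : 10 ^ 5 * (r ^ 1 * n) ≤ ρ * n := by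
    rw [pow_one, ← mul_assoc]
    exact mul_le_mul_of_nonneg_right hρ hn.le
  have hpos := h.mul_pos 1000
  have d1 : ((R₀ \ R).card : ℝ) ≤ 2 * (r ^ 1000 * n) := by
    refine le_trans (Nat.cast_le.2 (Finset.card_le_card ?_)) hR
    exact Finset.subset_union_right
  have d2 : ((R \ R₀).card : ℝ) ≤ 2 * (r ^ 1000 * n) := by
    refine le_trans (Nat.cast_le.2 (Finset.card_le_card ?_)) hR
    exact Finset.subset_union_left
  have e1 : (R.card : ℝ) ≤ R₀.card + 2 * (r ^ 1000 * n) := by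
    have : R.card ≤ R₀.card + (R \ R₀).card := by
      have := Finset.le_card_sdiff R₀ R
      omega
    have : (R.card : ℝ) ≤ R₀.card + (R \ R₀).card := by exact_mod_cast this
    linarith
  have e2 : (R₀.card : ℝ) ≤ R.card + 2 * (r ^ 1000 * n) := by
    have : R₀.card ≤ R.card + (R₀ \ R).card := by
      have := Finset.le_card_sdiff R R₀
      omega
    have : (R₀.card : ℝ) ≤ R.card + (R₀ \ R).card := by exact_mod_cast this
    linarith
  set Bad := insert (0 : G) (R₀ \ R) with hBad
  have h0B : (0 : G) ∈ Bad := Finset.mem_insert_self _ _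
  have hBadc : (Bad.card : ℝ) ≤ 2 * (r ^ 1000 * n) + 1 := by
    have : Bad.card ≤ (R₀ \ R).card + 1 := Finset.card_insert_le _ _
    have : (Bad.card : ℝ) ≤ (R₀ \ R).card + 1 := by exact_mod_cast this
    linarith
  have hmem : ∀ v ∈ R₀, v ∉ Bad → v ∈ R := by
    intro v hv hvB
    by_contra hvR
    exact hvB (Finset.mem_insert_of_mem (Finset.mem_sdiff.2 ⟨hv, hvR⟩))
  have hmC : (m : ℝ) * C₁.card ≤ 4 * (r ^ 9 * n) := by
    calc (m : ℝ) * C₁.card ≤ m * (2 * (r ^ 10 * n)) := by gcongr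
      _ = (m * r) * (2 * (r ^ 9 * n)) := by ring
      _ ≤ 2 * (2 * (r ^ 9 * n)) := by gcongr
      _ = _ := by ring
  set J := ⌈r ^ 88 * n⌉₊ with hJ
  have hJ1 : r ^ 88 * n ≤ J := Nat.le_ceil _
  have hJ2 : (J : ℝ) < r ^ 88 * n + 1 := Nat.ceil_lt_add_one (by positivity)
  obtain ⟨P, hP, Q, hQ, hPQ, hQc, hdvd, hres⟩ := B.exists_reserve (J := J) (m := m)
    hT.supply_fst hT.supply_snd hs hs2 h0B hm ((Finset.card_le_univ _).trans hmG)
    (by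
      refine Nat.le_floor ?_
      push_cast
      linarith)
    (by
      refine Nat.le_floor ?_
      push_cast
      linarith)
  have hPR : P ⊆ R := fun v hv =>
    hmem v (hC₁R (Finset.mem_sdiff.1 (hP hv)).1) (Finset.mem_sdiff.1 (hP hv)).2
  have hQR : Q ⊆ R := fun v hv =>
    hmem v (hC₂R (Finset.mem_sdiff.1 (hQ hv)).1) (Finset.mem_sdiff.1 (hQ hv)).2
  have hPQR : P ∪ Q ⊆ R := Finset.union_subset hPR hQR
  have hPQc : ((P ∪ Q).card : ℝ) ≤ r ^ 8 * n := by
    have h1 : (P ∪ Q).card ≤ C₁.card + (18 * J + 36 * (m * C₁.card) + 12) :=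
      Finset.card_union_le_add (Finset.card_le_card (hP.trans Finset.sdiff_subset)) hQc
    have h2 : ((P ∪ Q).card : ℝ) ≤ C₁.card + (18 * J + 36 * (m * C₁.card) + 12) := by
      exact_mod_cast h1
    linarith
  set b := ⌊ρ * n - 3 * (r ^ 1000 * n)⌋₊ with hb
  have hb1 : (b : ℝ) ≤ ρ * n - 3 * (r ^ 1000 * n) := Nat.floor_le (by linarith)
  have hb2 : ρ * n - 3 * (r ^ 1000 * n) < b + 1 := Nat.lt_floor_add_one _
  have hsel : ∀ Y₀ : Finset G, Y₀ ⊆ R₀ → ρ * n - r ^ 1000 * n ≤ Y₀.card →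
      ∃ Y' ⊆ Y₀ \ (R₀ \ R), Y'.card = b := by
    intro Y₀ hY₀ hc
    refine Finset.exists_subset_card_eq ?_
    have h1 := Finset.le_card_sdiff (R₀ \ R) Y₀
    have h2 : Y₀.card ≤ (Y₀ \ (R₀ \ R)).card + (R₀ \ R).card := by omega
    have h3 : (Y₀.card : ℝ) ≤ (Y₀ \ (R₀ \ R)).card + (R₀ \ R).card := by exact_mod_cast h2
    have h4 : (b : ℝ) ≤ (Y₀ \ (R₀ \ R)).card := by linarith
    exact_mod_cast h4
  obtain ⟨Y', hY', hY'c⟩ := hsel Y hYR (by linarith)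
  obtain ⟨Z', hZ', hZ'c⟩ := hsel Z hZR (by linarith)
  have hY'Y : Y' ⊆ Y := hY'.trans Finset.sdiff_subset
  have hZ'Z : Z' ⊆ Z := hZ'.trans Finset.sdiff_subset
  have hsubR : ∀ Y₀ Y' : Finset G, Y₀ ⊆ R₀ → Y' ⊆ Y₀ \ (R₀ \ R) → Y' ⊆ R := by
    intro Y₀ Y' hY₀ hY' v hv
    obtain ⟨g1, g2⟩ := Finset.mem_sdiff.1 (hY' hv)
    by_contra hvR
    exact g2 (Finset.mem_sdiff.2 ⟨hY₀ g1, hvR⟩)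
  have hY'R := hsubR Y Y' hYR hY'
  have hZ'R := hsubR Z Z' hZR hZ'
  have hYZ' : Disjoint Y' Z' := hT.disjoint.mono hY'Y hZ'Z
  have hYZC : ∀ v ∈ Y' ∪ Z', v ∉ C₁ ∪ C₂ := fun v hv =>
    Finset.disjoint_left.1 hT.disjoint_union (Finset.union_subset_union hY'Y hZ'Z hv)
  set W₀ := R \ (P ∪ Q) with hW₀
  have hW₀c : W₀.card + (P ∪ Q).card = R.card := Finset.card_sdiff_add_card_eq_card hPQR
  have hW₀c' : (W₀.card : ℝ) + (P ∪ Q).card = R.card := by exact_mod_cast hW₀c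
  have hkb1 : (B.k : ℝ) * b ≤ B.k * (ρ * n) - 9 * (r ^ 1000 * n) := by
    calc (B.k : ℝ) * b ≤ B.k * (ρ * n - 3 * (r ^ 1000 * n)) := by gcongr
      _ = B.k * (ρ * n) - B.k * (3 * (r ^ 1000 * n)) := by ring
      _ ≤ B.k * (ρ * n) - 3 * (3 * (r ^ 1000 * n)) := by gcongr
      _ = _ := by ring
  have hkb2 : B.k * (ρ * n) ≤ (B.k : ℝ) * b + 27 * (r ^ 1000 * n) + 9 := by
    calc B.k * (ρ * n) ≤ (B.k : ℝ) * (b + (3 * (r ^ 1000 * n) + 1)) := by gcongr; linarith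
      _ = (B.k : ℝ) * b + B.k * (3 * (r ^ 1000 * n) + 1) := by ring
      _ ≤ (B.k : ℝ) * b + 9 * (3 * (r ^ 1000 * n) + 1) := by gcongr
      _ = _ := by ring
  have hkr1 : 3 * (r ^ 8 * n) ≤ B.k * (r ^ 8 * n) := by
    have := h.mul_pos 8
    gcongr
  have hkρ : (B.k : ℝ) * (ρ + r ^ 8) * n = B.k * (ρ * n) + B.k * (r ^ 8 * n) := by ring
  have hbW : B.k * b ≤ W₀.card := by
    have : (B.k : ℝ) * b ≤ W₀.card := by linarith
    exact_mod_cast this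
  set T := (W₀.card - B.k * b) / B.k with hTdef
  have hTk : B.k * T ≤ W₀.card - B.k * b := Nat.mul_div_le _ _
  have hTk' : W₀.card - B.k * b < B.k * T + B.k := by
    have := Nat.lt_mul_div_succ (W₀.card - B.k * b) (by omega : 0 < B.k)
    rw [mul_add, mul_one] at this
    exact this
  have hTc : (T : ℝ) ≤ r ^ 8 * n + 13 * (r ^ 1000 * n) := by
    have h1 : B.k * T + B.k * b ≤ W₀.card := by omega
    have h2 : (B.k : ℝ) * T + B.k * b ≤ W₀.card := by exact_mod_cast h1
    refine le_of_mul_le_mul_left (a := (B.k : ℝ)) ?_ (by linarith)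
    rw [mul_add]
    have h3 : 3 * (13 * (r ^ 1000 * n)) ≤ B.k * (13 * (r ^ 1000 * n)) := by gcongr
    have h4 : (0 : ℝ) ≤ (P ∪ Q).card := Nat.cast_nonneg _
    linarith
  obtain ⟨S₁, hS₁, hS₁c, hS₁t⟩ := B.exists_tiles_card hT.supply_snd (Bad := Bad ∪ (P ∪ Q))
    (Finset.mem_union_left _ h0B) hs T (by
      refine Nat.le_floor ?_
      have : ((Bad ∪ (P ∪ Q)).card : ℝ) ≤ Bad.card + (P ∪ Q).card := by
        exact_mod_cast Finset.card_union_le _ _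
      push_cast
      linarith)
  have hS₁W : S₁ ⊆ W₀ := by
    intro v hv
    obtain ⟨g1, g2⟩ := Finset.mem_sdiff.1 (hS₁ hv)
    rw [Finset.mem_union, not_or] at g2
    exact Finset.mem_sdiff.2 ⟨hmem v (hC₂R g1) g2.1, g2.2⟩
  set W := W₀ \ S₁ with hW
  have hWc : W.card + S₁.card = W₀.card := Finset.card_sdiff_add_card_eq_card hS₁W
  have hYZW : Y' ∪ Z' ⊆ W := by
    intro v hv
    have hvC := hYZC v hv
    rw [Finset.mem_union, not_or] at hvC
    refine Finset.mem_sdiff.2 ⟨Finset.mem_sdiff.2 ⟨Finset.union_subset hY'R hZ'R hv, ?_⟩, ?_⟩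
    · rw [Finset.mem_union, not_or]
      exact ⟨fun h' => hvC.1 (Finset.mem_sdiff.1 (hP h')).1,
        fun h' => hvC.2 (Finset.mem_sdiff.1 (hQ h')).1⟩
    · exact fun h' => hvC.2 (Finset.mem_sdiff.1 (hS₁ h')).1
  set X := W \ (Y' ∪ Z') with hX
  have hXc : X.card + (Y' ∪ Z').card = W.card := Finset.card_sdiff_add_card_eq_card hYZW
  rw [Finset.card_union_of_disjoint hYZ', hY'c, hZ'c] at hXc
  have hWR : W ⊆ R := Finset.sdiff_subset.trans Finset.sdiff_subset
  have hXYZ : Disjoint X (Y' ∪ Z') := Finset.sdiff_disjoint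
  rw [Finset.disjoint_union_right] at hXYZ
  have hk2 : (B.k - 2) * b + 2 * b = B.k * b := by
    rw [← add_mul, Nat.sub_add_cancel (by omega)]
  obtain ⟨S₂, hS₂, hS₂t, j, hS₂c, hj⟩ := B.exists_near_tiling h (X := X) (Y' := Y') (Z' := Z')
    (by linarith) hT.diffDev_fst (by linarith) hT.diffDev_snd hY'Y (by rw [hY'c]; linarith) hZ'Z
    (by rw [hY'c, hZ'c]) (by rw [hY'c]; omega) (fun h' => h0 (hWR (Finset.mem_sdiff.1 h').1))
    (fun h' => h0 (hY'R h')) (fun h' => h0 (hZ'R h')) hXYZ.1 hXYZ.2 hYZ'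
  have hS₂W : S₂ ⊆ W := by
    refine hS₂.trans ?_
    rw [Finset.union_assoc]
    exact Finset.union_subset Finset.sdiff_subset hYZW
  have hJW : J ≤ W.card := by
    have h1 : J ≤ b := by
      have : (J : ℝ) ≤ b := by linarith
      exact_mod_cast this
    have : b ≤ B.k * b := Nat.le_mul_of_pos_left _ (by omega)
    omega
  obtain ⟨q, hq⟩ : B.k ∣ W.card - J := by
    obtain ⟨c, hc⟩ := hdvd
    have hsumc : W.card - J + B.k * (c + T) = B.k * t := by
      rw [mul_add, mul_comm B.k t]
      omega
    exact (Nat.dvd_add_left (dvd_mul_right _ _)).1 ⟨t, hsumc⟩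
  have hqj : q ≤ j := by
    have h1 : B.k * q + J ≤ B.k * b + B.k := by omega
    have h2 : (B.k : ℝ) * q + J ≤ B.k * b + B.k := by exact_mod_cast h1
    have h3 : (B.k : ℝ) * b ≤ B.k * (j + r ^ 98 * n) := by
      rw [hY'c] at hj
      gcongr
    have h4 : (B.k : ℝ) * (r ^ 98 * n) ≤ 9 * (r ^ 98 * n) := by
      have := h.mul_pos 98
      gcongr
    have h5 : (B.k : ℝ) * q ≤ B.k * j := by
      rw [mul_add] at h3
      linarith
    exact_mod_cast le_of_mul_le_mul_left h5 (by linarith)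
  obtain ⟨S₃, hS₃, hS₃t, -, hS₃c⟩ := hS₂t.exists_subset (fun _ => B.card_of_ok) (j := q)
    (by rw [hS₂c]; exact Nat.mul_le_mul_left _ hqj) (by omega)
  set L := W \ S₃ with hL
  have hS₃W : S₃ ⊆ W := hS₃.trans hS₂W
  have hLc : L.card + S₃.card = W.card := Finset.card_sdiff_add_card_eq_card hS₃W
  have hLR : L ⊆ R := Finset.sdiff_subset.trans hWR
  have hWPQ : Disjoint W (P ∪ Q) := Finset.sdiff_disjoint.mono_left Finset.sdiff_subset
  obtain ⟨t₁, ht₁, hs₁⟩ := hS₁t.card_sum (fun _ => B.card_of_ok) (fun _ => B.sum_of_ok)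
  obtain ⟨t₃, ht₃, hs₃⟩ := hS₃t.card_sum (fun _ => B.card_of_ok) (fun _ => B.sum_of_ok)
  have hLS : Disjoint L S₃ := Finset.sdiff_disjoint
  have hWS : Disjoint W S₁ := Finset.sdiff_disjoint
  have hsplit : R = (P ∪ Q ∪ L) ∪ (S₃ ∪ S₁) := by
    rw [Finset.union_assoc (P ∪ Q), ← Finset.union_assoc L, Finset.sdiff_union_of_subset hS₃W,
      Finset.sdiff_union_of_subset hS₁W, Finset.union_comm, Finset.sdiff_union_of_subset hPQR]
  have hS₁PQ : Disjoint S₁ (P ∪ Q) := Finset.sdiff_disjoint.mono_left hS₁W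
  have hd1 : Disjoint S₃ S₁ := hWS.mono_left hS₃W
  have hd : Disjoint (P ∪ Q ∪ L) (S₃ ∪ S₁) :=
    Finset.disjoint_union_left.2 ⟨Finset.disjoint_union_right.2
      ⟨(hWPQ.mono_left hS₃W).symm, hS₁PQ.symm⟩, Finset.disjoint_union_right.2
      ⟨hLS, hWS.mono_left Finset.sdiff_subset⟩⟩
  have hrest := hres L (by omega) (hWPQ.mono_left Finset.sdiff_subset) (fun h' => h0 (hLR h'))
    (fun hk3 => ⟨fun h' => (h3 hk3).1 (hLR h'), fun h' => (h3 hk3).2 (hLR h')⟩)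
    (t - (t₁ + t₃))
  have hle : t₁ + t₃ ≤ t ∧ (P ∪ Q ∪ L).card = (t - (t₁ + t₃)) * B.k := by
    have h1 : R.card = (P ∪ Q ∪ L).card + (S₃.card + S₁.card) := by
      conv_lhs => rw [hsplit]
      rw [Finset.card_union_of_disjoint hd, Finset.card_union_of_disjoint hd1]
    have h2 : (P ∪ Q ∪ L).card + (t₁ + t₃) * B.k = t * B.k := by
      rw [← hcard, h1, ht₁, ht₃]
      ring
    have h3 : t₁ + t₃ ≤ t := Nat.le_of_mul_le_mul_right (by omega : _ ≤ t * B.k) (by omega)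
    refine ⟨h3, ?_⟩
    rw [Nat.sub_mul]
    omega
  rw [hsplit]
  refine (hrest ?_ hle.2).union (hS₃t.union hS₁t hd1) hd
  have h4 := hsum
  rw [hsplit, Finset.sum_union hd, Finset.sum_union hd1, hs₁, hs₃] at h4
  obtain ⟨c, rfl⟩ := Nat.exists_eq_add_of_le hle.1
  rw [Nat.add_sub_cancel_left]
  rw [add_nsmul, add_nsmul] at h4
  rw [eq_sub_of_add_eq h4]
  abel

/-- Every set close to a template whose sum is right can be tiled. -/
theorem BlockSystem.tiles_of_close [DecidableEq G] (B : BlockSystem G)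
    (h : Regime r ρ (Fintype.card G)) {Y Z C₁ C₂ : Finset G} (hT : IsTemplate B.k r ρ Y Z C₁ C₂)
    {s : G} (hs : s ≠ 0) (hs2 : (∀ x, x + x ≠ s) ∨ DoublingInjective G) {m : ℕ} (hm : 1 ≤ m)
    (hmG : Fintype.card G ≤ 2 ^ m) (hmr : m * r ≤ 2) {R : Finset G}
    (hR : ((symmDiff R (Y ∪ Z ∪ (C₁ ∪ C₂))).card : ℝ) ≤ r ^ 1000 * Fintype.card G)
    (h0 : (0 : G) ∉ R) {t : ℕ} (hsum : ∑ v ∈ R, v = t • B.τ) (hcard : R.card = t * B.k) :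
    Tiles B.OK R := by
  have hone := h.one_le_mul (show 1000 < 5000 by norm_num)
  have m1 := h.mul_le (show 8 < 1000 by norm_num)
  have hk := B.three_le
  have hk9 := B.le_nine
  set R₀ := Y ∪ Z ∪ (C₁ ∪ C₂) with hR₀
  have hC₂R : C₂ ⊆ R₀ := Finset.subset_union_right.trans Finset.subset_union_right
  set n : ℝ := (Fintype.card G : ℝ)
  set L := R ∩ {-s, -s - s} with hL
  have hLc : L.card ≤ 2 := (Finset.card_le_card Finset.inter_subset_right).trans Finset.card_le_two
  set Bad := insert (0 : G) ((R₀ \ R) ∪ L) with hBad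
  have hLB : L ⊆ Bad := Finset.subset_union_right.trans (Finset.subset_insert _ _)
  have hBadc : (Bad.card : ℝ) ≤ r ^ 1000 * n + 3 := by
    have h1 : Bad.card ≤ (R₀ \ R).card + 2 + 1 :=
      (Finset.card_insert_le _ _).trans
        (Nat.add_le_add_right (Finset.card_union_le_add le_rfl hLc) _)
    have h2 : (R₀ \ R).card ≤ (symmDiff R R₀).card :=
      Finset.card_le_card Finset.subset_union_right
    have h3 : Bad.card ≤ (symmDiff R R₀).card + 3 := by omega
    have h4 : (Bad.card : ℝ) ≤ (symmDiff R R₀).card + 3 := by exact_mod_cast h3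
    linarith
  have hLc' : (L.card : ℝ) ≤ 2 := by exact_mod_cast hLc
  obtain ⟨S, hS, hSc, hSt⟩ := B.exists_tiles_through hT.supply_snd (Bad := Bad)
    (Finset.mem_insert_self _ _) L hLB (fun h' => h0 (Finset.mem_inter.1 h').1) (by
      refine Nat.le_floor ?_
      push_cast
      linarith)
  have hSR : S ⊆ R := by
    intro v hv
    obtain ⟨g1, g2⟩ := Finset.mem_sdiff.1 (hS hv)
    by_contra hvR
    exact g2 (Finset.mem_insert_of_mem (Finset.mem_union_left _
      (Finset.mem_sdiff.2 ⟨hC₂R g1, hvR⟩)))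
  have hLSR : L ∪ S ⊆ R := Finset.union_subset Finset.inter_subset_left hSR
  have hLS18 : (L ∪ S).card ≤ 18 := hSc.trans_le (Nat.mul_le_mul hk9 hLc)
  have hR'c := Finset.card_sdiff_add_card_eq_card hLSR
  obtain ⟨q, hq, hqs⟩ := hSt.card_sum (fun _ => B.card_of_ok) (fun _ => B.sum_of_ok)
  have hqt : q ≤ t := by
    refine Nat.le_of_mul_le_mul_right (c := B.k) ?_ (by omega)
    rw [← hcard, mul_comm, ← hq]
    exact Finset.card_le_card hLSR
  obtain ⟨c, rfl⟩ := Nat.exists_eq_add_of_le hqt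
  have hrest : Tiles B.OK (R \ (L ∪ S)) := by
    refine B.tiles_of_close_aux h hT hs hs2 hm hmG hmr (t := c) ?_
      (fun h' => h0 (Finset.mem_sdiff.1 h').1) (fun _ => ?_) ?_ ?_
    · have h1 : symmDiff (R \ (L ∪ S)) R₀ ⊆ symmDiff R R₀ ∪ (L ∪ S) := by
        intro v hv
        simp only [Finset.mem_symmDiff, Finset.mem_sdiff, Finset.mem_union] at hv ⊢
        clear * - hv
        tauto
      have h2 : (symmDiff (R \ (L ∪ S)) R₀).card ≤ (symmDiff R R₀).card + 18 :=
        (Finset.card_le_card h1).trans (Finset.card_union_le_add le_rfl hLS18)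
      have h3 : ((symmDiff (R \ (L ∪ S)) R₀).card : ℝ) ≤ (symmDiff R R₀).card + 18 := by
        exact_mod_cast h2
      linarith
    · constructor <;>
      · intro h'
        obtain ⟨g1, g2⟩ := Finset.mem_sdiff.1 h'
        exact g2 (Finset.mem_union_left _ (Finset.mem_inter.2 ⟨g1, by simp⟩))
    · have := Finset.sum_sdiff hLSR (f := fun v => v)
      rw [hqs, hsum, add_comm q c, add_nsmul] at this
      exact add_right_cancel this
    · rw [add_mul] at hcard
      rw [mul_comm] at hq
      omega
  have := hrest.union hSt Finset.sdiff_disjoint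
  rwa [Finset.sdiff_union_of_subset hLSR] at this

end Assembly

/-! ### Random sets -/

section Expectation

variable {G ι : Type} [Fintype G] [Fintype ι] {π : ι → ℝ}

/-- The expectation of `f` over independent labels with distribution `π`. -/
noncomputable def labelExp (π : ι → ℝ) (f : (G → ι) → ℝ) : ℝ := ∑ ω, (∏ g, π (ω g)) * f ω

/-- The set of elements whose label lies in `A`. -/
noncomputable def labelled (A : Finset ι) (ω : G → ι) : Finset G :=
  Finset.univ.filter fun g => ω g ∈ A

theorem mem_labelled {G ι : Type} [Fintype G] {A : Finset ι} {ω : G → ι} {g : G} :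
    g ∈ labelled A ω ↔ ω g ∈ A := by
  simp [labelled]

theorem labelExp_mono (hπ : ∀ i, 0 ≤ π i) {f f' : (G → ι) → ℝ} (h : ∀ ω, f ω ≤ f' ω) :
    labelExp π f ≤ labelExp π f' :=
  Finset.sum_le_sum fun ω _ => mul_le_mul_of_nonneg_left (h ω)
    (Finset.prod_nonneg fun _ _ => hπ _)

theorem labelExp_add (f f' : (G → ι) → ℝ) :
    labelExp π (fun ω => f ω + f' ω) = labelExp π f + labelExp π f' := by
  simp only [labelExp, mul_add, Finset.sum_add_distrib]

theorem labelExp_const_mul (c : ℝ) (f : (G → ι) → ℝ) :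
    labelExp π (fun ω => c * f ω) = c * labelExp π f := by
  simp only [labelExp, Finset.mul_sum]
  exact Finset.sum_congr rfl fun _ _ => by ring

theorem labelExp_sum {κ : Type} (s : Finset κ) (f : κ → (G → ι) → ℝ) :
    labelExp π (fun ω => ∑ i ∈ s, f i ω) = ∑ i ∈ s, labelExp π (f i) := by
  simp only [labelExp, Finset.mul_sum]
  exact Finset.sum_comm

theorem labelExp_prod (f : G → ι → ℝ) :
    labelExp π (fun ω => ∏ g, f g (ω g)) = ∏ g, ∑ i, π i * f g i := by
  simp only [labelExp, ← Finset.prod_mul_distrib]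
  rw [Finset.prod_univ_sum]
  simp

theorem labelExp_one (hπ1 : ∑ i, π i = 1) : labelExp π (fun _ : G → ι => 1) = 1 := by
  have := labelExp_prod (π := π) (fun (_ : G) (_ : ι) => (1 : ℝ))
  simpa [hπ1] using this

theorem labelExp_const (hπ1 : ∑ i, π i = 1) (c : ℝ) : labelExp π (fun _ : G → ι => c) = c := by
  have := labelExp_const_mul (π := π) c (fun _ : G → ι => 1)
  rw [labelExp_one hπ1, mul_one] at this
  simpa using this

/-- The probability that all elements of `S` have labels in `A`. -/
theorem labelExp_subset (hπ1 : ∑ i, π i = 1) (A : Finset ι) (S : Finset G) :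
    labelExp π (fun ω => if S ⊆ labelled A ω then 1 else 0) = (∑ i ∈ A, π i) ^ S.card := by
  have := labelExp_prod (π := π) (fun (g : G) (i : ι) =>
    if g ∈ S then if i ∈ A then 1 else 0 else 1)
  refine Eq.trans ?_ (this.trans ?_)
  · congr 1
    funext ω
    by_cases h : S ⊆ labelled A ω
    · rw [if_pos h, Finset.prod_eq_one]
      intro g _
      split_ifs with h1 h2
      · rfl
      · exact absurd (mem_labelled.1 (h h1)) h2
      · rfl
    · rw [if_neg h]
      obtain ⟨g, hg, hg'⟩ := Finset.not_subset.1 h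
      refine (Finset.prod_eq_zero (Finset.mem_univ g) ?_).symm
      rw [if_pos hg, if_neg fun h' => hg' (mem_labelled.2 h')]
  · rw [← Finset.prod_const, ← Finset.prod_subset (Finset.subset_univ S)]
    · refine Finset.prod_congr rfl fun g hg => ?_
      simp [hg]
    · intro g _ hg
      simp [hg, hπ1]

theorem labelExp_eq (hπ1 : ∑ i, π i = 1) (A : Finset ι) (S : Finset G) :
    labelExp π (fun ω => if labelled A ω = S then 1 else 0) =
      (∑ i ∈ A, π i) ^ S.card * (1 - ∑ i ∈ A, π i) ^ (Fintype.card G - S.card) := by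
  have := labelExp_prod (π := π) (fun (g : G) (i : ι) => if (i ∈ A ↔ g ∈ S) then 1 else 0)
  refine Eq.trans ?_ (this.trans ?_)
  · congr 1
    funext ω
    by_cases h : labelled A ω = S
    · rw [if_pos h, Finset.prod_eq_one]
      intro g _
      exact if_pos (h ▸ mem_labelled.symm)
    · rw [if_neg h]
      have : ∃ g, ¬ (ω g ∈ A ↔ g ∈ S) := by
        by_contra hne
        push Not at hne
        exact h (Finset.ext fun g => mem_labelled.trans (hne g))
      obtain ⟨g, hg⟩ := this
      exact (Finset.prod_eq_zero (Finset.mem_univ g) (if_neg hg)).symm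
  · rw [← Finset.prod_const, ← Finset.card_compl, ← Finset.prod_const,
      ← Finset.prod_mul_prod_compl S]
    congr 1
    · refine Finset.prod_congr rfl fun g hg => ?_
      simp [hg]
    · refine Finset.prod_congr rfl fun g hg => ?_
      have h2 := Finset.sum_sdiff (Finset.subset_univ A) (f := π)
      rw [hπ1] at h2
      rw [← eq_sub_of_add_eq h2, Finset.sdiff_eq_filter]
      simp [Finset.mem_compl.1 hg, Finset.sum_filter]

/-- The set of elements with labels in `A` is distributed as a random subset. -/
theorem sum_setProb_eq [DecidableEq G] (hπ1 : ∑ i, π i = 1) (A : Finset ι) (E : Finset G → Prop) :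
    ∑ R : Finset G, (if E R then setProb G (∑ i ∈ A, π i) R else 0) =
      labelExp π (fun ω : G → ι => if E (labelled A ω) then 1 else 0) := by
  obtain rfl : ‹DecidableEq G› = fun a b => Classical.propDecidable (a = b) := Subsingleton.elim _ _
  have h1 : ∀ R : Finset G, (if E R then setProb G (∑ i ∈ A, π i) R else 0) =
      labelExp π (fun ω : G → ι => (if E R then 1 else 0) * if labelled A ω = R then 1 else 0) := by
    intro R
    rw [labelExp_const_mul, labelExp_eq hπ1, setProb]
    split_ifs <;> simp
  rw [Finset.sum_congr rfl fun R _ => h1 R, ← labelExp_sum]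
  congr 1
  funext ω
  rw [Finset.sum_eq_single (labelled A ω)]
  · simp
  · intro R _ hR
    simp [hR.symm]
  · simp

/-- The probability of an event. -/
noncomputable def labelProb (π : ι → ℝ) (E : (G → ι) → Prop) : ℝ :=
  labelExp π fun ω => if E ω then 1 else 0

theorem labelProb_mono (hπ : ∀ i, 0 ≤ π i) {E E' : (G → ι) → Prop} (h : ∀ ω, E ω → E' ω) :
    labelProb π E ≤ labelProb π E' := by
  refine labelExp_mono hπ fun ω => ?_
  by_cases hE : E ω
  · rw [if_pos hE, if_pos (h ω hE)]
  · rw [if_neg hE]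
    split_ifs <;> norm_num

theorem labelProb_or_le (hπ : ∀ i, 0 ≤ π i) (E E' : (G → ι) → Prop) :
    labelProb π (fun ω => E ω ∨ E' ω) ≤ labelProb π E + labelProb π E' := by
  rw [labelProb, labelProb, labelProb, ← labelExp_add]
  refine labelExp_mono hπ fun ω => ?_
  by_cases h1 : E ω <;> by_cases h2 : E' ω <;> simp [h1, h2]

theorem labelProb_exists_le (hπ : ∀ i, 0 ≤ π i) {κ : Type} (s : Finset κ)
    (E : κ → (G → ι) → Prop) :
    labelProb π (fun ω => ∃ i ∈ s, E i ω) ≤ ∑ i ∈ s, labelProb π (E i) := by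
  simp only [labelProb]
  rw [← labelExp_sum]
  refine labelExp_mono hπ fun ω => ?_
  split_ifs with h
  · obtain ⟨i, hi, h⟩ := h
    refine le_trans ?_ (Finset.single_le_sum (f := fun i => if E i ω then (1 : ℝ) else 0)
      (fun j _ => ?_) hi)
    · simp [h]
    · split_ifs <;> norm_num
  · exact Finset.sum_nonneg fun j _ => by split_ifs <;> norm_num

theorem one_sub_labelProb_not (hπ1 : ∑ i, π i = 1) (E : (G → ι) → Prop) :
    1 - labelProb π (fun ω : G → ι => ¬ E ω) = labelProb π E := by
  rw [sub_eq_iff_eq_add, labelProb, labelProb, ← labelExp_add]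
  refine (labelExp_one (G := G) hπ1).symm.trans ?_
  congr 1
  funext ω
  by_cases h : E ω <;> simp [h]

theorem labelProb_le_of_labelExp_le (hπ : ∀ i, 0 ≤ π i) {f : (G → ι) → ℝ} (hf : ∀ ω, 0 ≤ f ω)
    {c x : ℝ} (hc : 0 < c) (h : labelExp π f ≤ c * x) : labelProb π (fun ω => c < f ω) ≤ x := by
  refine le_of_mul_le_mul_left (h.trans' ?_) hc
  rw [labelProb, ← labelExp_const_mul]
  refine labelExp_mono hπ fun ω => ?_
  split_ifs with h'
  · linarith
  · simpa using hf ω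

end Expectation

section SecondMoment

variable {G ι : Type} [Fintype G] [Fintype ι] {π : ι → ℝ}

theorem labelExp_mul_sub (hπ1 : ∑ i, π i = 1) (A : Finset ι) {S T : Finset G} {c : ℕ}
    (hS : S.card = c) (hT : T.card = c) :
    labelExp π (fun ω => ((if S ⊆ labelled A ω then 1 else 0) - (∑ i ∈ A, π i) ^ c) *
      ((if T ⊆ labelled A ω then 1 else 0) - (∑ i ∈ A, π i) ^ c)) =
      (∑ i ∈ A, π i) ^ (S ∪ T).card - ((∑ i ∈ A, π i) ^ c) ^ 2 := by
  set m := (∑ i ∈ A, π i) ^ c with hm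
  have e : (fun ω : G → ι => ((if S ⊆ labelled A ω then (1 : ℝ) else 0) - m) *
      ((if T ⊆ labelled A ω then 1 else 0) - m)) = fun ω =>
      (if S ∪ T ⊆ labelled A ω then 1 else 0) + ((-m) * (if S ⊆ labelled A ω then 1 else 0) +
        ((-m) * (if T ⊆ labelled A ω then 1 else 0) + m ^ 2)) := by
    funext ω
    by_cases h1 : S ⊆ labelled A ω <;> by_cases h2 : T ⊆ labelled A ω <;>
      simp only [h1, h2, Finset.union_subset_iff, and_true, and_false, if_true, if_false] <;> ring
  rw [e, labelExp_add, labelExp_add, labelExp_add, labelExp_const_mul, labelExp_const_mul,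
    labelExp_const hπ1, labelExp_subset hπ1, labelExp_subset hπ1, labelExp_subset hπ1, hS, hT]
  ring

/-- The second moment bound for the number of members of a family contained in a random set. -/
theorem labelExp_sq_le (hπ : ∀ i, 0 ≤ π i) (hπ1 : ∑ i, π i = 1) (A : Finset ι) {κ : Type}
    (I : Finset κ) (S : κ → Finset G) {c : ℕ} (hS : ∀ i ∈ I, (S i).card = c) :
    labelExp π (fun ω => (∑ i ∈ I, (if S i ⊆ labelled A ω then 1 else 0) -
      (∑ i ∈ A, π i) ^ c * I.card) ^ 2) ≤
      ((I ×ˢ I).filter fun e => ¬ Disjoint (S e.1) (S e.2)).card := by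
  have hq0 : 0 ≤ ∑ i ∈ A, π i := Finset.sum_nonneg fun i _ => hπ i
  have hq1 : ∑ i ∈ A, π i ≤ 1 := by
    rw [← hπ1]
    exact Finset.sum_le_sum_of_subset_of_nonneg (Finset.subset_univ _) fun i _ _ => hπ i
  set m := (∑ i ∈ A, π i) ^ c with hm
  have e : (fun ω : G → ι => (∑ i ∈ I, (if S i ⊆ labelled A ω then (1 : ℝ) else 0) -
      m * I.card) ^ 2) = fun ω => ∑ e ∈ I ×ˢ I, ((if S e.1 ⊆ labelled A ω then 1 else 0) - m) *
        ((if S e.2 ⊆ labelled A ω then 1 else 0) - m) := by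
    funext ω
    rw [Finset.sum_product]
    have := Finset.sum_mul_sum I I (fun i => (if S i ⊆ labelled A ω then (1 : ℝ) else 0) - m)
      (fun i => (if S i ⊆ labelled A ω then (1 : ℝ) else 0) - m)
    refine Eq.trans ?_ this
    rw [← sq, Finset.sum_sub_distrib, Finset.sum_const, nsmul_eq_mul, mul_comm m]
  rw [e, labelExp_sum, Finset.card_filter, Nat.cast_sum]
  refine Finset.sum_le_sum fun e he => ?_
  obtain ⟨h1, h2⟩ := Finset.mem_product.1 he
  rw [labelExp_mul_sub hπ1 A (hS _ h1) (hS _ h2)]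
  by_cases hd : Disjoint (S e.1) (S e.2)
  · rw [if_neg (not_not.2 hd), Finset.card_union_of_disjoint hd, hS _ h1, hS _ h2, pow_add]
    simp [sq]
  · rw [if_pos hd, Nat.cast_one]
    have := pow_le_one₀ (n := (S e.1 ∪ S e.2).card) hq0 hq1
    nlinarith [sq_nonneg m]

theorem labelExp_card_sub_sq_le (hπ : ∀ i, 0 ≤ π i) (hπ1 : ∑ i, π i = 1) (A : Finset ι) :
    labelExp π (fun ω : G → ι => (((labelled A ω).card : ℝ) -
      (∑ i ∈ A, π i) * Fintype.card G) ^ 2) ≤ Fintype.card G := by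
  have h := labelExp_sq_le hπ hπ1 A (Finset.univ : Finset G) (fun g => {g}) (c := 1)
    fun _ _ => Finset.card_singleton _
  refine (le_of_eq ?_).trans (h.trans (Nat.cast_le.2 ?_))
  · congr 1
    funext ω
    simp
  · refine (Finset.card_le_card (t := Finset.univ.image fun g : G => (g, g)) fun e he => ?_).trans
      (Finset.card_image_le.trans (by rw [Finset.card_univ]))
    have := (Finset.mem_filter.1 he).2
    simp only [Finset.disjoint_singleton, not_not] at this
    exact Finset.mem_image.2 ⟨e.1, Finset.mem_univ _, Prod.ext rfl this⟩

theorem labelProb_card_le (hπ : ∀ i, 0 ≤ π i) (hπ1 : ∑ i, π i = 1) (A : Finset ι) {x y : ℝ}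
    (hx : 0 < x) (hxy : (Fintype.card G : ℝ) ≤ x ^ 2 * y) :
    labelProb π (fun ω : G → ι => x < |((labelled A ω).card : ℝ) -
      (∑ i ∈ A, π i) * Fintype.card G|) ≤ y := by
  refine (labelProb_mono hπ fun ω h => ?_).trans (labelProb_le_of_labelExp_le hπ
    (fun ω => sq_nonneg (((labelled A ω).card : ℝ) - (∑ i ∈ A, π i) * Fintype.card G))
    (pow_pos hx 2) ((labelExp_card_sub_sq_le hπ hπ1 A).trans hxy))
  rw [← sq_abs (((labelled A ω).card : ℝ) - _)]
  exact pow_lt_pow_left₀ h hx.le two_ne_zero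

variable [AddCommGroup G]

theorem labelExp_diffDev_le (hπ : ∀ i, 0 ≤ π i) (hπ1 : ∑ i, π i = 1) (A : Finset ι) :
    labelExp π (fun ω : G → ι => diffDev (labelled A ω) (∑ i ∈ A, π i)) ≤
      3 * (Fintype.card G : ℝ) ^ 2 := by
  unfold diffDev
  rw [labelExp_sum]
  have hterm : ∀ d ∈ Finset.univ.filter (fun d : G => d ≠ 0),
      labelExp π (fun ω : G → ι => (diffCount (labelled A ω) d -
        (∑ i ∈ A, π i) ^ 2 * Fintype.card G) ^ 2) ≤ 3 * (Fintype.card G : ℝ) := by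
    intro d hd
    have hd0 : d ≠ 0 := (Finset.mem_filter.1 hd).2
    have h := labelExp_sq_le hπ hπ1 A (Finset.univ : Finset G) (fun g => {g, g + d}) (c := 2)
      fun g _ => Finset.card_pair fun h' => hd0 (left_eq_add.1 h')
    refine (le_of_eq ?_).trans (h.trans ?_)
    · congr 1
      funext ω
      rw [diffCount, Finset.card_univ]
      congr 3
      funext g
      by_cases h1 : g ∈ labelled A ω <;> by_cases h2 : g + d ∈ labelled A ω <;>
        simp [ind, h1, h2, Finset.insert_subset_iff]
    · have : ((Finset.univ ×ˢ Finset.univ : Finset (G × G)).filter fun e =>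
          ¬ Disjoint ({e.1, e.1 + d} : Finset G) {e.2, e.2 + d}).card ≤ 3 * Fintype.card G := by
        refine (Finset.card_le_card (t := Finset.univ.biUnion fun g : G =>
          ({(g, g), (g, g + d), (g, g - d)} : Finset (G × G))) fun e he => ?_).trans ?_
        · have := (Finset.mem_filter.1 he).2
          obtain ⟨v, h1, h2⟩ := Finset.not_disjoint_iff.1 this
          refine Finset.mem_biUnion.2 ⟨e.1, Finset.mem_univ _, ?_⟩
          obtain ⟨x, y⟩ := e
          simp only [Finset.mem_insert, Finset.mem_singleton, Prod.mk.injEq, true_and] at h1 h2 ⊢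
          rcases h1 with rfl | rfl <;> rcases h2 with h | h
          · exact Or.inl h.symm
          · exact Or.inr (Or.inr (eq_sub_of_add_eq h.symm))
          · exact Or.inr (Or.inl h.symm)
          · exact Or.inl (add_right_cancel h).symm
        · refine (Finset.card_biUnion_le_card_mul _ _ 3 fun g _ => Finset.card_le_three).trans ?_
          rw [Finset.card_univ, mul_comm]
      exact_mod_cast this
  refine (Finset.sum_le_sum hterm).trans ?_
  rw [Finset.sum_const, nsmul_eq_mul]
  have : (((Finset.univ.filter fun d : G => d ≠ 0).card : ℕ) : ℝ) ≤ Fintype.card G :=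
    Nat.cast_le.2 (Finset.card_le_univ _)
  nlinarith [(Nat.cast_nonneg (Fintype.card G) : (0 : ℝ) ≤ _)]

theorem labelProb_diffDev_le (hπ : ∀ i, 0 ≤ π i) (hπ1 : ∑ i, π i = 1) (A : Finset ι) {r : ℝ}
    (hr : 0 < r) :
    labelProb π (fun ω : G → ι => 3 * (Fintype.card G : ℝ) ^ 2 / r <
      diffDev (labelled A ω) (∑ i ∈ A, π i)) ≤ r := by
  have hn : (0 : ℝ) < Fintype.card G := Nat.cast_pos.2 Fintype.card_pos
  refine labelProb_le_of_labelExp_le hπ (fun _ => diffDev_nonneg _ _) (by positivity) ?_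
  refine (labelExp_diffDev_le hπ hπ1 A).trans (le_of_eq ?_)
  field_simp

end SecondMoment

/-! ### Supply in random sets -/

section RandomSupply

/-- A family with bounded conflicts has a large pairwise disjoint subfamily. -/
theorem exists_pairwiseDisjoint_card_le {α β : Type} {T : Finset α} {S : α → Finset β} {d : ℕ}
    (hS : ∀ t ∈ T, (S t).Nonempty)
    (hd : ∀ t ∈ T, (T.filter fun u => ¬ Disjoint (S t) (S u)).card ≤ d) :
    ∃ U ⊆ T, (∀ t ∈ U, ∀ u ∈ U, t ≠ u → Disjoint (S t) (S u)) ∧ T.card ≤ U.card * d := by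
  obtain ⟨U, hU, hmax⟩ := Finset.exists_max_image
    (T.powerset.filter fun U => ∀ t ∈ U, ∀ u ∈ U, t ≠ u → Disjoint (S t) (S u)) Finset.card
    ⟨∅, by simp⟩
  simp only [Finset.mem_filter, Finset.mem_powerset] at hU hmax
  refine ⟨U, hU.1, hU.2, ?_⟩
  refine (Finset.card_le_card fun t ht => ?_).trans (Finset.card_biUnion_le_card_mul U
    (fun u => T.filter fun v => ¬ Disjoint (S u) (S v)) d fun u hu => hd u (hU.1 hu))
  by_contra hcon
  simp only [Finset.mem_biUnion, Finset.mem_filter, not_exists, not_and, not_not] at hcon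
  have htU : t ∉ U := fun h => (hS t ht).ne_empty (disjoint_self.1 (hcon t h ht))
  have := hmax (insert t U) ⟨Finset.insert_subset ht hU.1, fun a ha b hb hab => ?_⟩
  · rw [Finset.card_insert_of_notMem htU] at this
    omega
  · rcases Finset.mem_insert.1 ha with h1 | ha <;> rcases Finset.mem_insert.1 hb with h2 | hb
    · exact absurd (h1.trans h2.symm) hab
    · exact h1 ▸ (hcon b hb ht).symm
    · exact h2 ▸ hcon a ha ht
    · exact hU.2 a ha b hb hab

theorem exists_disjoint_of_card_lt {α β : Type} {T : Finset α} {S : α → Finset β} {D : Finset β}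
    (hT : ∀ t ∈ T, ∀ u ∈ T, t ≠ u → Disjoint (S t) (S u)) (hD : D.card < T.card) :
    ∃ t ∈ T, Disjoint (S t) D := by
  by_contra! hcon
  have : ∀ t ∈ T, ∃ x, x ∈ S t ∧ x ∈ D := fun t ht => Finset.not_disjoint_iff.1 (hcon t ht)
  have : Nonempty β := by
    obtain ⟨t, ht⟩ := Finset.card_pos.1 ((Nat.zero_le _).trans_lt hD)
    exact ⟨(this t ht).choose⟩
  choose! f hf using ‹∀ t ∈ T, _›
  refine hD.not_ge (Finset.card_le_card_of_injOn f (fun t ht => (hf t ht).2) fun t ht u hu h => ?_)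
  by_contra hne
  exact Finset.disjoint_left.1 (hT t ht u hu hne) (hf t ht).1 (h ▸ (hf u hu).1)

variable {G ι : Type} [Fintype G] [Fintype ι] {π : ι → ℝ}

theorem labelExp_prod_one_sub (hπ1 : ∑ i, π i = 1) (A : Finset ι) {κ : Type} {U : Finset κ}
    {S : κ → Finset G} (hS : ∀ t ∈ U, ∀ u ∈ U, t ≠ u → Disjoint (S t) (S u)) :
    labelExp π (fun ω => ∏ t ∈ U, (1 + (-1 / 2) * if S t ⊆ labelled A ω then 1 else 0)) =
      ∏ t ∈ U, (1 + (-1 / 2) * (∑ i ∈ A, π i) ^ (S t).card) := by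
  simp only [Finset.prod_one_add]
  rw [labelExp_sum]
  refine Finset.sum_congr rfl fun V hV => ?_
  have hV := Finset.mem_powerset.1 hV
  have e : (fun ω : G → ι => ∏ t ∈ V, ((-1 / 2 : ℝ) * if S t ⊆ labelled A ω then 1 else 0)) =
      fun ω => (∏ _t ∈ V, (-1 / 2 : ℝ)) * if V.biUnion S ⊆ labelled A ω then 1 else 0 := by
    funext ω
    rw [Finset.prod_mul_distrib, Finset.prod_boole]
    simp only [Finset.biUnion_subset]
  rw [e, labelExp_const_mul, labelExp_subset hπ1, Finset.prod_mul_distrib,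
    Finset.prod_pow_eq_pow_sum,
    Finset.card_biUnion fun t ht u hu h => hS t (hV ht) u (hV hu) h]

theorem labelProb_card_filter_subset_le (hπ : ∀ i, 0 ≤ π i) (hπ1 : ∑ i, π i = 1) (A : Finset ι)
    {κ : Type} {U : Finset κ} {S : κ → Finset G} {c h : ℕ}
    (hS : ∀ t ∈ U, ∀ u ∈ U, t ≠ u → Disjoint (S t) (S u)) (hc : ∀ t ∈ U, (S t).card ≤ c) :
    labelProb π (fun ω => (U.filter fun t => S t ⊆ labelled A ω).card ≤ h) ≤
      Real.exp (h - U.card * (∑ i ∈ A, π i) ^ c / 2) := by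
  have hq0 : 0 ≤ ∑ i ∈ A, π i := Finset.sum_nonneg fun i _ => hπ i
  have hq1 : ∑ i ∈ A, π i ≤ 1 := by
    rw [← hπ1]
    exact Finset.sum_le_sum_of_subset_of_nonneg (Finset.subset_univ _) fun i _ _ => hπ i
  set q := ∑ i ∈ A, π i with hq
  have h1 : labelProb π (fun ω => (U.filter fun t => S t ⊆ labelled A ω).card ≤ h) ≤
      2 ^ h * ∏ t ∈ U, (1 + (-1 / 2) * q ^ (S t).card) := by
    rw [hq, ← labelExp_prod_one_sub hπ1 A hS, ← labelExp_const_mul]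
    refine labelExp_mono hπ fun ω => ?_
    have e : ∏ t ∈ U, (1 + (-1 / 2 : ℝ) * if S t ⊆ labelled A ω then 1 else 0) =
        (1 / 2) ^ (U.filter fun t => S t ⊆ labelled A ω).card := by
      rw [← Finset.prod_const, Finset.prod_filter]
      refine Finset.prod_congr rfl fun t _ => ?_
      split_ifs <;> norm_num
    rw [e]
    split_ifs with hle
    · calc (1 : ℝ) = 2 ^ h * (1 / 2) ^ h := by rw [← mul_pow]; norm_num
        _ ≤ _ := mul_le_mul_of_nonneg_left
          (pow_le_pow_of_le_one (by norm_num) (by norm_num) hle) (by positivity)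
    · positivity
  have h2 : ∏ t ∈ U, (1 + (-1 / 2) * q ^ (S t).card) ≤ ∏ _t ∈ U, Real.exp (-(q ^ c / 2)) := by
    refine Finset.prod_le_prod (fun t _ => ?_) fun t ht => ?_
    · have := pow_le_one₀ (n := (S t).card) hq0 hq1
      linarith
    · have := pow_le_pow_of_le_one hq0 hq1 (hc t ht)
      have := Real.add_one_le_exp (-(q ^ c / 2))
      linarith
  have h3 : (2 : ℝ) ^ h ≤ Real.exp h := by
    rw [← mul_one (h : ℝ), Real.exp_nat_mul]
    refine pow_le_pow_left₀ (by norm_num) ?_ h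
    have := Real.add_one_le_exp (1 : ℝ)
    linarith
  refine h1.trans ((mul_le_mul h3 h2 (Finset.prod_nonneg fun t _ => ?_)
    (Real.exp_pos _).le).trans (le_of_eq ?_))
  · have := pow_le_one₀ (n := (S t).card) hq0 hq1
    linarith
  · rw [Finset.prod_const, ← Real.exp_nat_mul, ← Real.exp_add]
    congr 1
    ring

variable [AddCommGroup G]

theorem card_le_mul_card_filter_double_notMem {V : Finset G} (hV : V.card ≤ 20)
    (hV0 : ∀ v ∈ V, v ≠ 0 ∨ DoublingInjective G) (hG : 40 ≤ Fintype.card G) :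
    Fintype.card G ≤ 21 * (Finset.univ.filter fun t : G => t + t ∉ V).card := by
  have hsplit := Finset.card_filter_add_card_filter_not (s := (Finset.univ : Finset G))
    (fun t => t + t ∈ V)
  rw [Finset.card_univ] at hsplit
  have key : ∀ g, (∀ v ∈ V, (Finset.univ.filter fun t : G => t + t = v).card ≤ g) →
      (Finset.univ.filter fun t : G => t + t ∈ V).card ≤ 20 * g := by
    intro g hg
    refine le_trans (Finset.card_le_card fun t ht => ?_) ((Finset.card_biUnion_le_card_mul V
      (fun v => Finset.univ.filter fun t : G => t + t = v) g hg).trans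
      (Nat.mul_le_mul_right _ hV))
    simp only [Finset.mem_filter, Finset.mem_univ, true_and, Finset.mem_biUnion] at ht ⊢
    exact ⟨_, ht, rfl⟩
  by_cases hinj : DoublingInjective G
  · have := key 1 fun v _ => Finset.card_le_one.2 fun t ht u hu => by
      simp only [Finset.mem_filter, Finset.mem_univ, true_and] at ht hu
      exact hinj (ht.trans hu.symm)
    omega
  · have h1 := key (Finset.univ.filter fun t : G => t + t = 0).card fun v _ => by
      rcases (Finset.univ.filter fun t : G => t + t = v).eq_empty_or_nonempty with h | ⟨u, hu⟩
      · rw [h]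
        simp
      · refine Finset.card_le_card_of_injOn (fun t => t - u) (fun t ht => ?_)
          fun t _ t' _ h => sub_left_injective h
        simp only [Finset.coe_filter, Finset.mem_filter, Finset.mem_univ, true_and,
          Set.mem_ofPred_eq] at ht hu ⊢
        rw [sub_add_sub_comm, ht, hu, sub_self]
    have h2 : (Finset.univ.filter fun t : G => t + t = 0).card ≤
        (Finset.univ.filter fun t : G => t + t ∉ V).card := by
      refine Finset.card_le_card fun t ht => ?_
      simp only [Finset.mem_filter, Finset.mem_univ, true_and] at ht ⊢
      intro h
      exact (hV0 _ h).elim (fun h => h ht) hinj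
    omega

theorem exists_disjoint_translates (hG : 40 ≤ Fintype.card G) {a b e : Fin 4 → G}
    (hab : ∀ i j, a i ≠ b j ∨ DoublingInjective G) (he : ∀ i, e i ≠ 0 ∨ DoublingInjective G) :
    ∃ U : Finset G, Fintype.card G ≤ 2560 * U.card ∧
      (∀ t ∈ U, (∀ i j, t + a i ≠ b j - t) ∧ ∀ i, t + t ≠ e i) ∧
      ∀ t ∈ U, ∀ u ∈ U, t ≠ u →
        Disjoint (Finset.univ.image (fun i => t + a i) ∪ Finset.univ.image (fun j => b j - t))
          (Finset.univ.image (fun i => u + a i) ∪ Finset.univ.image (fun j => b j - u)) := by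
  set V : Finset G := (Finset.univ.image fun x : Fin 4 × Fin 4 => b x.2 - a x.1) ∪
    Finset.univ.image e with hV
  have hcard : V.card ≤ 20 := by
    refine (Finset.card_union_le _ _).trans ?_
    have h1 := Finset.card_image_le (s := Finset.univ) (f := fun x : Fin 4 × Fin 4 => b x.2 - a x.1)
    have h2 := Finset.card_image_le (s := Finset.univ) (f := e)
    simp only [Finset.card_univ, Fintype.card_prod, Fintype.card_fin] at h1 h2
    omega
  have h0 : ∀ v ∈ V, v ≠ 0 ∨ DoublingInjective G := by
    intro v hv
    simp only [hV, Finset.mem_union, Finset.mem_image, Finset.mem_univ, true_and] at hv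
    rcases hv with ⟨x, rfl⟩ | ⟨i, rfl⟩
    · exact (hab x.1 x.2).imp_left fun h => sub_ne_zero.2 h.symm
    · exact he i
  have hgood := card_le_mul_card_filter_double_notMem hcard h0 hG
  set S : G → Finset G := fun t =>
    Finset.univ.image (fun i => t + a i) ∪ Finset.univ.image (fun j => b j - t) with hS
  have hScard : ∀ t, (S t).card ≤ 8 := fun t => by
    refine (Finset.card_union_le _ _).trans ?_
    have h1 := Finset.card_image_le (s := Finset.univ) (f := fun i => t + a i)
    have h2 := Finset.card_image_le (s := Finset.univ) (f := fun j => b j - t)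
    simp only [Finset.card_univ, Fintype.card_fin] at h1 h2
    omega
  obtain ⟨U, hUT, hU, hUc⟩ := exists_pairwiseDisjoint_card_le
    (T := Finset.univ.filter fun t : G => t + t ∉ V) (S := S) (d := 64)
    (fun t _ => ⟨t + a 0, Finset.mem_union_left _ (Finset.mem_image_of_mem _ (Finset.mem_univ 0))⟩)
    fun t _ => by
      refine le_trans (Finset.card_le_card (t := (S t).biUnion fun x =>
        (Finset.univ.image fun i => x - a i) ∪ Finset.univ.image fun j => b j - x)
        fun u hu => ?_) ((Finset.card_biUnion_le_card_mul _ _ 8 fun x _ => ?_).trans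
          (Nat.mul_le_mul_right 8 (hScard t)))
      · simp only [Finset.mem_filter] at hu
        obtain ⟨x, hx, hxu⟩ := Finset.not_disjoint_iff.1 hu.2
        refine Finset.mem_biUnion.2 ⟨x, hx, ?_⟩
        simp only [hS, Finset.mem_union, Finset.mem_image, Finset.mem_univ, true_and] at hxu ⊢
        rcases hxu with ⟨i, rfl⟩ | ⟨j, rfl⟩
        · exact Or.inl ⟨i, by abel⟩
        · exact Or.inr ⟨j, by abel⟩
      · refine (Finset.card_union_le _ _).trans ?_
        have h1 := Finset.card_image_le (s := Finset.univ) (f := fun i => x - a i)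
        have h2 := Finset.card_image_le (s := Finset.univ) (f := fun j => b j - x)
        simp only [Finset.card_univ, Fintype.card_fin] at h1 h2
        omega
  refine ⟨U, by omega, fun t ht => ?_, hU⟩
  have htV := hUT ht
  simp only [hV, Finset.mem_filter, Finset.mem_univ, true_and, Finset.mem_union, Finset.mem_image,
    not_or, not_exists] at htV
  refine ⟨fun i j h => htV.1 (i, j) ?_, fun i h => htV.2 i h.symm⟩
  rw [sub_eq_iff_eq_add, add_assoc, h]
  abel

/-- A random set has supply with overwhelming probability. -/
theorem labelProb_not_supply_le (hπ : ∀ i, 0 ≤ π i) (hπ1 : ∑ i, π i = 1) (A : Finset ι) {κ : ℕ}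
    (hG : 40 ≤ Fintype.card G)
    (hκ : (κ : ℝ) ≤ (∑ i ∈ A, π i) ^ 8 * Fintype.card G / 10400) :
    labelProb π (fun ω : G → ι => ¬ Supply (labelled A ω) κ) ≤
      (Fintype.card G : ℝ) ^ 12 *
        Real.exp (-((∑ i ∈ A, π i) ^ 8 * Fintype.card G / 10400)) := by
  have hq0 : 0 ≤ ∑ i ∈ A, π i := Finset.sum_nonneg fun i _ => hπ i
  set q := ∑ i ∈ A, π i with hq
  set n : ℝ := (Fintype.card G : ℝ) with hn
  have h := labelProb_exists_le hπ (Finset.univ : Finset ((Fin 4 → G) × (Fin 4 → G) × (Fin 4 → G)))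
    fun x (ω : G → ι) => ((∀ i j, x.1 i ≠ x.2.1 j ∨ DoublingInjective G) ∧
      ∀ i, x.2.2 i ≠ 0 ∨ DoublingInjective G) ∧ ∃ Bad : Finset G, Bad.card ≤ κ ∧
      ∀ t, ¬ ((∀ i j, t + x.1 i ≠ x.2.1 j - t) ∧ (∀ i, t + t ≠ x.2.2 i) ∧
        (∀ i, t + x.1 i ∈ labelled A ω \ Bad) ∧ ∀ j, x.2.1 j - t ∈ labelled A ω \ Bad)
  refine (labelProb_mono hπ fun ω hω => ?_).trans (h.trans
    ((Finset.sum_le_card_nsmul _ _ (Real.exp (-(q ^ 8 * n / 10400))) fun x _ => ?_).trans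
      (le_of_eq ?_)))
  · by_contra hcon
    refine hω fun a b e hab he Bad hBad => ?_
    by_contra hno
    exact hcon ⟨(a, b, e), Finset.mem_univ _, ⟨hab, he⟩, Bad, hBad, fun t ht => hno ⟨t, ht⟩⟩
  · obtain ⟨a, b, e⟩ := x
    by_cases hx : (∀ i j, a i ≠ b j ∨ DoublingInjective G) ∧ ∀ i, e i ≠ 0 ∨ DoublingInjective G
    · obtain ⟨U, hUc, hUg, hUd⟩ := exists_disjoint_translates hG hx.1 hx.2
      have hb := labelProb_card_filter_subset_le (h := κ) (c := 8) hπ hπ1 A hUd fun t _ => by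
        refine (Finset.card_union_le _ _).trans ?_
        have h1 := Finset.card_image_le (s := Finset.univ) (f := fun i => t + a i)
        have h2 := Finset.card_image_le (s := Finset.univ) (f := fun j => b j - t)
        simp only [Finset.card_univ, Fintype.card_fin] at h1 h2
        omega
      refine (labelProb_mono hπ ?_).trans (hb.trans (Real.exp_le_exp.2 ?_))
      · rintro ω ⟨-, Bad, hBad, hno⟩
        by_contra! hlt
        obtain ⟨t, ht, htd⟩ := exists_disjoint_of_card_lt (D := Bad)
          (fun t ht u hu => hUd t (Finset.filter_subset _ _ ht) u (Finset.filter_subset _ _ hu))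
          (hBad.trans_lt hlt)
        simp only [Finset.mem_filter] at ht
        refine hno t ⟨(hUg t ht.1).1, (hUg t ht.1).2, fun i => ?_, fun j => ?_⟩
        · have hm := Finset.mem_union_left (Finset.univ.image (fun j => b j - t))
            (Finset.mem_image_of_mem (fun i => t + a i) (Finset.mem_univ i))
          exact Finset.mem_sdiff.2 ⟨ht.2 hm, Finset.disjoint_left.1 htd hm⟩
        · have hm := Finset.mem_union_right (Finset.univ.image (fun i => t + a i))
            (Finset.mem_image_of_mem (fun j => b j - t) (Finset.mem_univ j))
          exact Finset.mem_sdiff.2 ⟨ht.2 hm, Finset.disjoint_left.1 htd hm⟩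
      · have hUr : n ≤ 2560 * (U.card : ℝ) := by
          rw [hn]
          exact_mod_cast hUc
        have hn0 : 0 ≤ n := Nat.cast_nonneg _
        have hq8 := pow_nonneg hq0 8
        have := mul_le_mul_of_nonneg_left hUr hq8
        have := mul_nonneg hq8 hn0
        rw [← hq]
        linarith
    · refine le_trans (le_of_eq ?_) (Real.exp_pos _).le
      refine Eq.trans ?_ (labelExp_const (G := G) hπ1 0)
      rw [labelProb]
      congr 1
      funext ω
      exact if_neg (not_and_of_not_left _ hx)
  · rw [Finset.card_univ, nsmul_eq_mul]
    simp only [Fintype.card_prod, Fintype.card_fun, Fintype.card_fin]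
    push_cast
    rw [hn]
    ring

end RandomSupply

/-! ### Random templates -/

section RandomTemplate

variable {G : Type} [Fintype G] {r ρ p : ℝ}

theorem pow_mul_exp_neg_le {r n x : ℝ} (hr : 0 < r) (hn : 0 < n) (hlog : Real.log n ≤ 1 / r)
    (hx : 13 / r ≤ x) : n ^ 12 * Real.exp (-x) ≤ r := by
  have h1 : n ^ 12 ≤ Real.exp (12 * (1 / r)) := by
    rw [← Real.exp_log (pow_pos hn 12), Real.log_pow]
    refine Real.exp_le_exp.2 ?_
    push_cast
    linarith
  calc n ^ 12 * Real.exp (-x) ≤ Real.exp (12 * (1 / r)) * Real.exp (-x) :=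
        mul_le_mul_of_nonneg_right h1 (Real.exp_pos _).le
    _ = Real.exp (12 * (1 / r) - x) := by rw [← Real.exp_add, sub_eq_add_neg]
    _ ≤ Real.exp (-(1 / r)) := Real.exp_le_exp.2 (by
        have : 13 / r = 13 * (1 / r) := by ring
        linarith)
    _ ≤ r := by
        rw [Real.exp_neg, inv_le_comm₀ (Real.exp_pos _) hr, ← one_div]
        have := Real.add_one_le_exp (1 / r)
        linarith

/-- The labels for splitting a `p`-random set into two dense parts, a sparse reserve and the
remainder. -/
noncomputable def templateLabels (p ρ r : ℝ) : Fin 5 → ℝ :=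
  ![1 - p, ρ, ρ, r ^ 10, p - 2 * ρ - r ^ 10]

theorem sum_templateLabels (p ρ r : ℝ) : ∑ i, templateLabels p ρ r i = 1 := by
  simp only [templateLabels, Fin.sum_univ_five, Matrix.cons_val]
  ring

theorem sum_templateLabels_compl_zero (p ρ r : ℝ) :
    ∑ i ∈ ({1, 2, 3, 4} : Finset (Fin 5)), templateLabels p ρ r i = p := by
  rw [Finset.sum_insert (by decide), Finset.sum_insert (by decide), Finset.sum_insert (by decide),
    Finset.sum_singleton]
  simp only [templateLabels, Matrix.cons_val]
  ring

theorem templateLabels_nonneg (h : Regime r ρ (Fintype.card G)) (hp : p ≤ 1)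
    (hρ : r ^ 10 ≤ p - 2 * ρ) (i : Fin 5) : 0 ≤ templateLabels p ρ r i := by
  have h1 := pow_pos h.pos 10
  have h2 := h.density_pos
  fin_cases i <;> simp [templateLabels] <;> linarith

theorem labelled_templateLabels_union (ω : G → Fin 5) :
    labelled {1} ω ∪ labelled {2} ω ∪ (labelled {3} ω ∪ labelled {4} ω) =
      labelled {1, 2, 3, 4} ω := by
  ext g
  simp only [Finset.mem_union, mem_labelled, Finset.mem_insert, Finset.mem_singleton, or_assoc]

theorem labelled_disjoint {κ : Type} {A A' : Finset κ} (h : Disjoint A A') (ω : G → κ) :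
    Disjoint (labelled A ω) (labelled A' ω) :=
  Finset.disjoint_left.2 fun _ h1 h2 =>
    Finset.disjoint_left.1 h (mem_labelled.1 h1) (mem_labelled.1 h2)

variable [AddCommGroup G]

theorem labelProb_not_supply_le_of_regime (h : Regime r ρ (Fintype.card G))
    (hlog : Real.log (Fintype.card G) ≤ 1 / r) {ι : Type} [Fintype ι]
    {π : ι → ℝ} (hπ : ∀ i, 0 ≤ π i) (hπ1 : ∑ i, π i = 1)
    (A : Finset ι) {x : ℝ} (hx : r ^ 81 * Fintype.card G ≤ x)
    (hxA : x ≤ (∑ i ∈ A, π i) ^ 8 * Fintype.card G / 10400) :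
    labelProb π (fun ω : G → ι => ¬ Supply (labelled A ω) ⌊x⌋₊) ≤ r := by
  have hx0 : 0 ≤ x := (h.mul_pos 81).le.trans hx
  have hG : 40 ≤ Fintype.card G := by
    have h1 := h.one_le_mul (show 0 < 5000 by norm_num)
    rw [pow_zero, one_mul] at h1
    have : (40 : ℝ) ≤ Fintype.card G := by linarith
    exact_mod_cast this
  refine (labelProb_not_supply_le hπ hπ1 A hG ((Nat.floor_le hx0).trans hxA)).trans
    (pow_mul_exp_neg_le h.pos h.size_pos hlog (le_trans ?_ (hx.trans hxA)))
  rw [div_le_iff₀ h.pos]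
  have h1 := h.one_le_mul (show 82 < 5000 by norm_num)
  rw [pow_succ] at h1
  linarith

/-- Randomly splitting a random set typically produces a template. -/
theorem labelProb_not_isTemplate_le {k : ℕ} (hk : 3 ≤ k) (h : Regime r ρ (Fintype.card G))
    (hlog : Real.log (Fintype.card G) ≤ 1 / r) (hp : p ≤ 1) (hkp : p = k * (ρ + r ^ 8)) :
    labelProb (templateLabels p ρ r) (fun ω : G → Fin 5 =>
      ¬ IsTemplate k r ρ (labelled {1} ω) (labelled {2} ω) (labelled {3} ω) (labelled {4} ω)) ≤
      8 * r := by
  have hr := h.pos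
  have hr10 := pow_pos hr 10
  have hr8 := pow_pos hr 8
  have h810 := h.pow_le (show 8 < 10 by norm_num)
  have hρr := h.le_density
  have hρ := h.density_pos
  have hn := h.size_pos
  have hk' : (3 : ℝ) ≤ k := by exact_mod_cast hk
  have hpρ : 3 * (ρ + r ^ 8) ≤ p := by
    rw [hkp]
    exact mul_le_mul_of_nonneg_right hk' (by positivity)
  have hπ : ∀ i, 0 ≤ templateLabels p ρ r i := templateLabels_nonneg h hp (by linarith)
  have hπ1 := sum_templateLabels p ρ r
  have e1 : ∑ i ∈ ({1} : Finset (Fin 5)), templateLabels p ρ r i = ρ := by simp [templateLabels]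
  have e2 : ∑ i ∈ ({2} : Finset (Fin 5)), templateLabels p ρ r i = ρ := by simp [templateLabels]
  have e3 : ∑ i ∈ ({3} : Finset (Fin 5)), templateLabels p ρ r i = r ^ 10 := by
    simp [templateLabels]
  have e4 : ∑ i ∈ ({4} : Finset (Fin 5)), templateLabels p ρ r i = p - 2 * ρ - r ^ 10 := by
    simp [templateLabels]
  have e5 := sum_templateLabels_compl_zero p ρ r
  have hx : (0 : ℝ) < r ^ 1000 * Fintype.card G := h.mul_pos 1000
  have hxy : (Fintype.card G : ℝ) ≤ (r ^ 1000 * Fintype.card G) ^ 2 * r := by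
    have h1 := h.one_le_mul (show 2001 < 5000 by norm_num)
    calc (Fintype.card G : ℝ) = 1 * Fintype.card G := (one_mul _).symm
      _ ≤ (r ^ 2001 * Fintype.card G) * Fintype.card G :=
        mul_le_mul_of_nonneg_right (by linarith) hn.le
      _ = _ := by ring
  have c1 := labelProb_card_le (G := G) hπ hπ1 {1} hx hxy
  have c2 := labelProb_card_le (G := G) hπ hπ1 {2} hx hxy
  have c3 := labelProb_card_le (G := G) hπ hπ1 {3} hx hxy
  have c5 := labelProb_card_le (G := G) hπ hπ1 {1, 2, 3, 4} hx hxy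
  have d1 := labelProb_diffDev_le (G := G) hπ hπ1 {1} hr
  have d2 := labelProb_diffDev_le (G := G) hπ hπ1 {2} hr
  have s3 := labelProb_not_supply_le_of_regime h hlog hπ hπ1 {3} le_rfl (by
    rw [e3]
    have := h.mul_le (show 10 * 8 < 81 by norm_num)
    rw [← pow_mul, le_div_iff₀ (by norm_num)]
    have := (h.mul_pos 81)
    linarith)
  have s4 := labelProb_not_supply_le_of_regime h hlog hπ hπ1 {4}
    (x := 20 * (r ^ 8 * Fintype.card G)) (by
      have := h.mul_le (show 8 < 81 by norm_num)
      have := h.mul_pos 81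
      linarith) (by
      rw [e4, le_div_iff₀ (by norm_num)]
      have hq : 10 ^ 5 * r ≤ p - 2 * ρ - r ^ 10 := by linarith
      have := pow_le_pow_left₀ (by positivity) hq 8
      have := mul_le_mul_of_nonneg_right this hn.le
      rw [mul_pow, mul_assoc] at this
      have h2 := h.mul_pos 8
      linarith)
  rw [e1] at c1 d1
  rw [e2] at c2 d2
  rw [e3] at c3
  rw [e5] at c5
  have hor : ∀ {E E' : (G → Fin 5) → Prop} {x y : ℝ}, labelProb (templateLabels p ρ r) E ≤ x →
      labelProb (templateLabels p ρ r) E' ≤ y →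
      labelProb (templateLabels p ρ r) (fun ω => E ω ∨ E' ω) ≤ x + y := fun hE hE' =>
    (labelProb_or_le hπ _ _).trans (add_le_add hE hE')
  refine (labelProb_mono hπ fun ω hω => ?_).trans ((hor c1 <| hor c2 <| hor c3 <| hor c5 <|
    hor d1 <| hor d2 <| hor s3 s4).trans (le_of_eq (by ring)))
  by_contra hcon
  simp only [not_or, not_lt, not_not] at hcon
  obtain ⟨c1, c2, c3, c5, d1, d2, s3, s4⟩ := hcon
  refine hω ⟨labelled_disjoint (by decide) ω, ?_, c1, c2, ?_, ?_, d1, d2, s3, s4⟩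
  · simp only [Finset.disjoint_union_left, Finset.disjoint_union_right]
    exact ⟨⟨labelled_disjoint (by decide) ω, labelled_disjoint (by decide) ω⟩,
      labelled_disjoint (by decide) ω, labelled_disjoint (by decide) ω⟩
  · rw [labelled_templateLabels_union, ← hkp]
    exact c5
  · have h1 := (abs_le.1 c3).2
    have := h.mul_le (show 10 < 1000 by norm_num)
    linarith

end RandomTemplate

/-! ### The theorem -/

section Conclusion

theorem exists_ne_zero_and_forall_double_ne {G : Type} [AddCommGroup G] [Fintype G]
    (hG : 1 < Fintype.card G) : ∃ s : G, s ≠ 0 ∧ ((∀ x, x + x ≠ s) ∨ DoublingInjective G) := by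
  by_cases h : DoublingInjective G
  · have := Fintype.one_lt_card_iff_nontrivial.1 hG
    obtain ⟨s, hs⟩ := exists_ne (0 : G)
    exact ⟨s, hs, Or.inr h⟩
  · have h' : ¬ Function.Surjective fun x : G => x + x := mt Finite.injective_iff_surjective.2 h
    simp only [Function.Surjective, not_forall, not_exists] at h'
    obtain ⟨s, hs⟩ := h'
    exact ⟨s, fun h0 => hs 0 (by rw [h0, add_zero]), Or.inl hs⟩

theorem le_sum_setProb {G : Type} [AddCommGroup G] [Fintype G] [DecidableEq G] {r ρ p : ℝ} {k : ℕ}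
    (hk : 3 ≤ k) (h : Regime r ρ (Fintype.card G)) (hlog : Real.log (Fintype.card G) ≤ 1 / r)
    (hp : p ≤ 1) (hkp : p = k * (ρ + r ^ 8)) (E : Finset G → Prop) [DecidablePred E]
    (hE : ∀ Y Z C₁ C₂, IsTemplate k r ρ Y Z C₁ C₂ → E (Y ∪ Z ∪ (C₁ ∪ C₂))) :
    1 - 8 * r ≤ ∑ R : Finset G, if E R then setProb G p R else 0 := by
  obtain rfl : ‹DecidableEq G› = fun a b => Classical.propDecidable (a = b) := Subsingleton.elim _ _
  obtain rfl : ‹DecidablePred E› = fun a => Classical.propDecidable (E a) := Subsingleton.elim _ _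
  have hsum := sum_setProb_eq (sum_templateLabels p ρ r) {1, 2, 3, 4} E
  rw [sum_templateLabels_compl_zero] at hsum
  rw [hsum]
  have hr8 := pow_pos h.pos 8
  have h810 := h.pow_le (show 8 < 10 by norm_num)
  have hr10 := pow_pos h.pos 10
  have hρ := h.density_pos
  have hpρ : 3 * (ρ + r ^ 8) ≤ p := by
    rw [hkp]
    exact mul_le_mul_of_nonneg_right (by exact_mod_cast hk) (by positivity)
  have h1 := labelProb_not_isTemplate_le hk h hlog hp hkp
  have h2 := one_sub_labelProb_not (sum_templateLabels p ρ r) fun ω : G → Fin 5 =>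
    IsTemplate k r ρ (labelled {1} ω) (labelled {2} ω) (labelled {3} ω) (labelled {4} ω)
  have h3 := labelProb_mono (templateLabels_nonneg h hp (by linarith))
    (E := fun ω : G → Fin 5 =>
      IsTemplate k r ρ (labelled {1} ω) (labelled {2} ω) (labelled {3} ω) (labelled {4} ω))
    (E' := fun ω => E (labelled {1, 2, 3, 4} ω)) fun ω hω => by
      rw [← labelled_templateLabels_union]
      exact hE _ _ _ _ hω
  refine le_trans ?_ h3
  rw [← h2]
  linarith

theorem pow_mul_div_pow_le {p L n : ℝ} (hp : 0 ≤ p) (hp1 : p ≤ 1) (hL : 1 ≤ L) (hn : 0 ≤ n)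
    {a b c : ℕ} (ha : c ≤ a) (hb : c ≤ b) : p ^ a * n / L ^ b ≤ (p / L) ^ c * n := by
  rw [div_pow, div_mul_eq_mul_div]
  exact div_le_div₀ (by positivity)
    (mul_le_mul_of_nonneg_right (pow_le_pow_of_le_one hp hp1 ha) hn) (by positivity)
    (pow_le_pow_right₀ hL hb)

theorem eventually_log_large (δ : ℝ) (hδ : 0 < δ) : ∃ N : ℕ, 2 ≤ N ∧ ∀ n : ℕ, N ≤ n →
    10 ^ 6 ≤ Real.log n ∧ 8 ≤ δ * Real.log n ∧ Real.log n ^ 10000 ≤ n := by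
  have h1 : ∀ᶠ x : ℝ in Filter.atTop, 10 ^ 6 ≤ Real.log x :=
    Real.tendsto_log_atTop.eventually_ge_atTop _
  have h2 : ∀ᶠ x : ℝ in Filter.atTop, 8 / δ ≤ Real.log x :=
    Real.tendsto_log_atTop.eventually_ge_atTop _
  have h3 := (Real.isLittleO_pow_log_id_atTop (n := 10000)).bound one_pos
  have h := tendsto_natCast_atTop_atTop.eventually (h1.and (h2.and h3))
  obtain ⟨N, hN⟩ := Filter.eventually_atTop.1 h
  refine ⟨max N 2, le_max_right _ _, fun n hn => ?_⟩
  obtain ⟨g1, g2, g3⟩ := hN n ((le_max_left _ _).trans hn)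
  refine ⟨g1, ?_, ?_⟩
  · rwa [div_le_iff₀ hδ, mul_comm] at g2
  · rw [one_mul] at g3
    simpa using (Real.le_norm_self _).trans g3

theorem regime_of_rpow_neg_le {n p : ℝ} {k : ℕ} (hk : 3 ≤ k) (hk9 : k ≤ 9) (hn : 1 ≤ n)
    (hpn : n ^ (-(1 / 10000 : ℝ)) ≤ p) (hp : p ≤ 1) (hL : 10 ^ 6 ≤ Real.log n)
    (hLn : Real.log n ^ 10000 ≤ n) :
    Regime (p / Real.log n) (p / k - (p / Real.log n) ^ 8) n := by
  have hn0 : 0 < n := by linarith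
  have hp0 : 0 < p := (Real.rpow_pos_of_pos hn0 _).trans_le hpn
  set L := Real.log n
  have hL0 : 0 < L := lt_of_lt_of_le (by norm_num) hL
  have hr0 : 0 < p / L := div_pos hp0 hL0
  have hrp : 10 ^ 6 * (p / L) ≤ p := by
    rw [mul_div_assoc', div_le_iff₀ hL0, mul_comm]
    exact mul_le_mul_of_nonneg_left hL hp0.le
  have hk3 : (3 : ℝ) ≤ k := by exact_mod_cast hk
  have hk9' : (k : ℝ) ≤ 9 := by exact_mod_cast hk9
  have hr8 : (p / L) ^ 8 ≤ p / L := pow_le_of_le_one hr0.le (by linarith) (by norm_num)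
  have hpk : p / 9 ≤ p / k := div_le_div_of_nonneg_left hp0.le (by linarith) hk9'
  have hpk1 : p / k ≤ p := div_le_self hp0.le (by linarith)
  have hr8' := pow_pos hr0 8
  refine ⟨hr0, by linarith, by linarith, by linarith, ?_⟩
  rw [div_pow, div_mul_eq_mul_div, one_le_div (pow_pos hL0 _)]
  have h1 : n⁻¹ ≤ p ^ 10000 := by
    have := pow_le_pow_left₀ (Real.rpow_nonneg hn0.le _) hpn 10000
    rw [← Real.rpow_natCast, ← Real.rpow_mul hn0.le] at this
    norm_num [Real.rpow_neg_one] at this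
    exact this
  refine (pow_le_pow_iff_left₀ (by positivity) (by positivity) two_ne_zero).1 ?_
  calc (L ^ 5000) ^ 2 = L ^ 10000 := by rw [← pow_mul]
    _ ≤ n := hLn
    _ = n⁻¹ * n ^ 2 := by field_simp
    _ ≤ p ^ 10000 * n ^ 2 := mul_le_mul_of_nonneg_right h1 (sq_nonneg n)
    _ = (p ^ 5000 * n) ^ 2 := by rw [mul_pow, ← pow_mul]

theorem exists_le_two_pow {n : ℕ} {p : ℝ} (hn : 0 < n) (hp : p ≤ 1)
    (hL : 10 ^ 6 ≤ Real.log n) :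
    ∃ m : ℕ, 1 ≤ m ∧ n ≤ 2 ^ m ∧ m * (p / Real.log n) ≤ 2 := by
  have hn' : (0 : ℝ) < n := Nat.cast_pos.2 hn
  have hL0 : 0 < Real.log n := lt_of_lt_of_le (by norm_num) hL
  have h1 := Nat.le_ceil (3 / 2 * Real.log n)
  have h2 := Nat.ceil_lt_add_one (show 0 ≤ 3 / 2 * Real.log n by positivity)
  refine ⟨⌈3 / 2 * Real.log n⌉₊, Nat.one_le_iff_ne_zero.2 fun h => ?_, ?_, ?_⟩
  · rw [h, Nat.cast_zero] at h1
    linarith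
  · have : (n : ℝ) ≤ 2 ^ ⌈3 / 2 * Real.log n⌉₊ := by
      rw [← Real.log_le_log_iff hn' (by positivity), Real.log_pow]
      have := Real.log_two_gt_d9
      nlinarith
    exact_mod_cast this
  · rw [mul_div_assoc', div_le_iff₀ hL0]
    have := mul_le_mul_of_nonneg_left hp (Nat.cast_nonneg ⌈3 / 2 * Real.log n⌉₊)
    linarith

end Conclusion

/-- Partitioning sets close to random sets into rainbow cycle-candidates (resp., for
`k = 4`, rainbow path-candidates with prescribed sum). -/
theorem generalised_tannenbaum :
    ∃ ε : ℝ, 0 < ε ∧ ∀ δ : ℝ, 0 < δ → ∃ N : ℕ,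
      ∀ (G : Type) [AddCommGroup G] [Fintype G] [DecidableEq G], ∀ (k : ℕ) (p : ℝ),
      3 ≤ k → k ≤ 9 →
      N ≤ Fintype.card G →
      (Fintype.card G : ℝ) ^ (-ε) ≤ p → p ≤ 1 →
      1 - δ ≤ ∑ R : Finset G,
        (if (∀ R' : Finset G,
              ((symmDiff R' R).card : ℝ) ≤
                p ^ (10 ^ 10 : ℕ) * Fintype.card G
                  / (Real.log (Fintype.card G)) ^ (10 ^ 23 : ℕ) →
              k ∣ R'.card → (0 : G) ∉ R' →
              (((∑ x ∈ R', x) = 0 →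
                ∃ P : Finset (Finset G),
                  (∀ A ∈ P, ∀ B ∈ P, A ≠ B → Disjoint A B) ∧
                  P.biUnion id = R' ∧
                  (∀ A ∈ P, ∃ c : Fin k → G, Function.Injective c ∧
                    Finset.univ.image c = A ∧ IsCycleCandidate c)) ∧
               (k = 4 → ∀ α : G, α ≠ 0 → (∑ x ∈ R', x) = (R'.card / 4) • α →
                ∃ P : Finset (Finset G),
                  (∀ A ∈ P, ∀ B ∈ P, A ≠ B → Disjoint A B) ∧
                  P.biUnion id = R' ∧
                  (∀ A ∈ P, ∃ c : Fin 4 → G, Function.Injective c ∧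
                    Finset.univ.image c = A ∧ IsPathCandidate c ∧ (∑ i, c i) = α))))
        then setProb G p R else 0) := by
  refine ⟨1 / 10000, by norm_num, fun δ hδ => ?_⟩
  obtain ⟨N, hN2, hN⟩ := eventually_log_large δ hδ
  refine ⟨N, fun G _ _ _ k p hk hk9 hNG hpn hp => ?_⟩
  obtain ⟨hL, hδL, hLn⟩ := hN _ hNG
  have hn2 := hN2.trans hNG
  have hn1 : (1 : ℝ) ≤ Fintype.card G := by exact_mod_cast (by omega : 1 ≤ Fintype.card G)
  have hp0 : 0 < p := (Real.rpow_pos_of_pos (by linarith) _).trans_le hpn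
  have hL0 : 0 < Real.log (Fintype.card G) := lt_of_lt_of_le (by norm_num) hL
  have hreg := regime_of_rpow_neg_le hk hk9 hn1 hpn hp hL hLn
  obtain ⟨m, hm, hmG, hmr⟩ := exists_le_two_pow (by omega) hp hL
  obtain ⟨s, hs, hs2⟩ := exists_ne_zero_and_forall_double_ne (G := G) (by omega)
  set r := p / Real.log (Fintype.card G) with hr
  have hk0 : (k : ℝ) ≠ 0 := Nat.cast_ne_zero.2 (by omega)
  have hδr : 8 * r ≤ δ := by
    rw [hr, mul_div_assoc', div_le_iff₀ hL0]
    linarith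
  have hlog : Real.log (Fintype.card G) ≤ 1 / r := by
    rw [hr, one_div_div, le_div_iff₀ hp0]
    exact mul_le_of_le_one_right hL0.le hp
  refine (sub_le_sub_left hδr 1).trans (le_sum_setProb hk hreg hlog hp ?_ _ ?_)
  · field_simp
    ring
  intro Y Z C₁ C₂ hT R hR hkR h0
  have hR' := hR.trans (pow_mul_div_pow_le (c := 1000) hp0.le hp (by linarith) (by linarith)
    (by norm_num) (by norm_num))
  obtain ⟨t, ht⟩ := hkR
  rw [mul_comm] at ht
  refine ⟨fun hsum => ?_, fun hk4 α hα hsum => ?_⟩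
  · refine (cycleSystem G k hk hk9).tiles_of_close hreg hT hs hs2 hm hmG hmr hR' h0 (t := t) ?_ ht
    rw [hsum]
    exact (smul_zero t).symm
  · subst hk4
    refine (pathSystem G α hα).tiles_of_close hreg hT hs hs2 hm hmG hmr hR' h0 (t := t) ?_ ht
    rw [hsum, ht, Nat.mul_div_cancel _ (by norm_num)]
    rfl
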